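/- arXiv:1608.08942 — 2 statements merged into one kernel-verified Lean document; each statement's English description precedes it below -/
import Mathlib

section
/- Let A be a column-graded m×n matrix of linear forms over S with m ≤ n. Then the set of maximal (m×m) minors of A is a universal Gröbner basis of the ideal I_m(A), i.e. it is a Gröbner basis of I_m(A) with respect to every term order on S. -/
open MvPolynomial

noncomputable section

namespace CSPaper

/-- The set of variables of the standard `ℤ^v`-graded polynomial ring `S`:
the variable `x_{i j}` of the paper (with `1 ≤ i ≤ v`, `1 ≤ j ≤ n_i`) corresponds to
`⟨i-1, j-1⟩ : MVar v n` where `n (i-1) = n_i - 1`; thus row `i` has `n i + 1 > 0`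
variables and the first variable `x_{i 1}` of row `i` corresponds to `⟨i, 0⟩`. -/
abbrev MVar (v : ℕ) (n : Fin v → ℕ) : Type := Σ i : Fin v, Fin (n i + 1)

/-- The weight function giving the standard `ℤ^v`-grading: `deg (x_{i j}) = e_i ∈ ℤ^v`. -/
def wt (v : ℕ) (n : Fin v → ℕ) : MVar v n → (Fin v → ℕ) := fun p => Pi.single p.1 1

variable {K : Type} [Field K] {v : ℕ} {n : Fin v → ℕ}

/-- An ideal of `S` is `ℤ^v`-graded (multigraded) iff it contains every multihomogeneous
component of each of its elements. -/
def IsMultigraded (I : Ideal (MvPolynomial (MVar v n) K)) : Prop :=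
  ∀ f ∈ I, ∀ a : Fin v → ℕ, weightedHomogeneousComponent (wt v n) a f ∈ I

/-- The value of the `ℤ^v`-graded Hilbert function of the ideal `I` at `a ∈ ℕ^v`:
`dim_K I_a`. -/
def hilb (I : Ideal (MvPolynomial (MVar v n) K)) (a : Fin v → ℕ) : ℕ :=
  Module.finrank K
    ((Submodule.restrictScalars K I ⊓ weightedHomogeneousSubmodule K (wt v n) a :
      Submodule K (MvPolynomial (MVar v n) K)))

/-- Two ideals have the same `ℤ^v`-graded Hilbert series. -/
def sameHS (I J : Ideal (MvPolynomial (MVar v n) K)) : Prop :=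
  ∀ a : Fin v → ℕ, hilb I a = hilb J a

/-- The `ℤ^v`-graded `K`-algebra endomorphism of `S` determined by a `v`-tuple of square
matrices: `x_{i j} ↦ ∑_k (g i)_{k j} x_{i k}`.  For invertible `g i` these are exactly the
elements of `G = GL_{n_1}(K) × ⋯ × GL_{n_v}(K)` acting on `S`. -/
def gAct (g : ∀ i : Fin v, Matrix (Fin (n i + 1)) (Fin (n i + 1)) K) :
    MvPolynomial (MVar v n) K →ₐ[K] MvPolynomial (MVar v n) K :=
  aeval fun p : MVar v n => ∑ k : Fin (n p.1 + 1), C (g p.1 k p.2) * X ⟨p.1, k⟩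

/-- A property `P` of `v`-tuples of matrices holds generically (i.e. for a general
`g ∈ GL_{n_1}(K) × ⋯ × GL_{n_v}(K)`) if there is a nonzero polynomial `h` in the matrix
entries such that `P g` holds for every invertible `g` with `h(g) ≠ 0`. -/
def Generically
    (P : (∀ i : Fin v, Matrix (Fin (n i + 1)) (Fin (n i + 1)) K) → Prop) : Prop :=
  ∃ h : MvPolynomial (Σ i : Fin v, Fin (n i + 1) × Fin (n i + 1)) K, h ≠ 0 ∧
    ∀ g : ∀ i : Fin v, Matrix (Fin (n i + 1)) (Fin (n i + 1)) K,
      (∀ i, IsUnit (g i).det) →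
      eval (fun q : Σ i : Fin v, Fin (n i + 1) × Fin (n i + 1) => g q.1 q.2.1 q.2.2) h ≠ 0 →
      P g

/-- The leading exponent (exponent of the leading monomial) of a polynomial with respect to
a term order `τ` (a `MonomialOrder`); by convention `leadExp τ 0 = 0`. -/
def leadExp (τ : MonomialOrder (MVar v n)) (f : MvPolynomial (MVar v n) K) :
    MVar v n →₀ ℕ :=
  τ.toSyn.symm (f.support.sup τ.toSyn)

/-- The initial ideal `in_τ(I)`: the monomial ideal generated by the leading monomials of the
nonzero elements of `I`. -/
def inIdeal (τ : MonomialOrder (MVar v n)) (I : Ideal (MvPolynomial (MVar v n) K)) :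
    Ideal (MvPolynomial (MVar v n) K) :=
  Ideal.span {m | ∃ f ∈ I, f ≠ 0 ∧ m = monomial (leadExp τ f) (1 : K)}

/-- `G` is a Gröbner basis of `I` with respect to the term order `τ`. -/
def IsGroebnerBasis (τ : MonomialOrder (MVar v n)) (G : Set (MvPolynomial (MVar v n) K))
    (I : Ideal (MvPolynomial (MVar v n) K)) : Prop :=
  G ⊆ (I : Set (MvPolynomial (MVar v n) K)) ∧
    Ideal.span ((fun f => monomial (leadExp τ f) (1 : K)) '' {f ∈ G | f ≠ 0}) = inIdeal τ I

/-- `J = gin_τ(I)`, the `ℤ^v`-graded generic initial ideal: for a general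
`g ∈ GL_{n_1}(K) × ⋯ × GL_{n_v}(K)` one has `in_τ(g(I)) = J`. -/
def IsGin (τ : MonomialOrder (MVar v n)) (I J : Ideal (MvPolynomial (MVar v n) K)) : Prop :=
  Generically fun g => inIdeal τ (Ideal.map (gAct g) I) = J

/-- A term order such that `x_{i j} > x_{i k}` whenever `j < k`. -/
def RespectsVarOrder (τ : MonomialOrder (MVar v n)) : Prop :=
  ∀ (i : Fin v) (j k : Fin (n i + 1)), j < k →
    τ.toSyn (Finsupp.single (⟨i, k⟩ : MVar v n) 1) <
      τ.toSyn (Finsupp.single (⟨i, j⟩ : MVar v n) 1)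

/-- An ideal is Borel fixed if it is fixed by every element of the Borel subgroup
`B = B_{n_1}(K) × ⋯ × B_{n_v}(K)` of upper triangular invertible matrices (upper triangular
with respect to the order `x_{i 1} > x_{i 2} > ⋯` of the variables in each row). -/
def BorelFixed (I : Ideal (MvPolynomial (MVar v n) K)) : Prop :=
  ∀ g : ∀ i : Fin v, Matrix (Fin (n i + 1)) (Fin (n i + 1)) K,
    (∀ i, IsUnit (g i).det) →
    (∀ (i : Fin v) (k j : Fin (n i + 1)), j < k → g i k j = 0) →
    Ideal.map (gAct g) I = I

/-- A Cartwright-Sturmfels ideal: a `ℤ^v`-graded ideal with the same `ℤ^v`-graded Hilbert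
series as some radical Borel fixed ideal. -/
def IsCS (I : Ideal (MvPolynomial (MVar v n) K)) : Prop :=
  IsMultigraded I ∧ ∃ J : Ideal (MvPolynomial (MVar v n) K),
    J.IsRadical ∧ BorelFixed J ∧ sameHS I J

/-- The exponent of the monomial `x_{1 1}^{a 1} ⋯ x_{v 1}^{a v}` of
`T = K[x_{1 1}, …, x_{v 1}] ⊆ S`. -/
def Tmono (v : ℕ) (n : Fin v → ℕ) (a : Fin v → ℕ) : MVar v n →₀ ℕ :=
  ∑ i : Fin v, Finsupp.single (⟨i, 0⟩ : MVar v n) (a i)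

/-- A `ℤ^v`-graded ideal of `S` extended from `T`, i.e. generated by monomials in the
variables `x_{1 1}, …, x_{v 1}`. -/
def ExtendedFromT (J : Ideal (MvPolynomial (MVar v n) K)) : Prop :=
  ∃ A : Set (Fin v → ℕ),
    J = Ideal.span ((fun a => monomial (Tmono v n a) (1 : K)) '' A)

/-- A Cartwright-Sturmfels* ideal: a `ℤ^v`-graded ideal with the same `ℤ^v`-graded Hilbert
series as some ideal extended from `T`. -/
def IsCSstar (J : Ideal (MvPolynomial (MVar v n) K)) : Prop :=
  IsMultigraded J ∧ ∃ C : Ideal (MvPolynomial (MVar v n) K), ExtendedFromT C ∧ sameHS J C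

/-- A monomial ideal. -/
def IsMonomialIdeal (I : Ideal (MvPolynomial (MVar v n) K)) : Prop :=
  ∃ A : Set (MVar v n →₀ ℕ), I = Ideal.span ((fun s => monomial s (1 : K)) '' A)

/-- A squarefree monomial ideal. -/
def IsSqfreeMonomialIdeal (I : Ideal (MvPolynomial (MVar v n) K)) : Prop :=
  ∃ A : Set (MVar v n →₀ ℕ), (∀ s ∈ A, ∀ x, s x ≤ 1) ∧
    I = Ideal.span ((fun s => monomial s (1 : K)) '' A)

/-- `J` is the Alexander dual of the squarefree monomial ideal `I`: `J` is generated by the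
products `∏_{x ∈ P} x` as `P` ranges over the minimal primes of `I`. -/
def IsAlexanderDual (I J : Ideal (MvPolynomial (MVar v n) K)) : Prop :=
  J = Ideal.span {m | ∃ F : Finset (MVar v n),
    Ideal.span ((fun x => (X x : MvPolynomial (MVar v n) K)) '' ↑F) ∈ I.minimalPrimes ∧
    m = ∏ x ∈ F, X x}

/-- The sequence `x_{i j} - λ_{i j} x_{i 1}`, `1 ≤ i ≤ v`, `2 ≤ j ≤ n_i`, as a list. -/
def LamList (lam : MVar v n → K) : List (MvPolynomial (MVar v n) K) :=
  (List.finRange v).flatMap fun i =>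
    ((List.finRange (n i + 1)).drop 1).map fun j =>
      X (⟨i, j⟩ : MVar v n) - C (lam ⟨i, j⟩) * X (⟨i, 0⟩ : MVar v n)

/-- A property of the scalars `λ = (λ_{i j})` holds for general `λ ∈ K^N` if there is a
nonzero polynomial `h` in the `λ_{i j}` such that the property holds whenever `h(λ) ≠ 0`. -/
def GenericallyLam {v : ℕ} {n : Fin v → ℕ} (K : Type) [Field K]
    (P : (MVar v n → K) → Prop) : Prop :=
  ∃ h : MvPolynomial (MVar v n) K, h ≠ 0 ∧
    ∀ lam : MVar v n → K, eval lam h ≠ 0 → P lam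

variable {K : Type} [Field K] {v : ℕ} {n : Fin v → ℕ}

/-- A graded free resolution of an ideal `I` of a polynomial ring graded by an additive
monoid `M` via a weight function `w` on the variables:
`⋯ → F_2 → F_1 → F_0 → I → 0`, where `F_p` is the free module with (finite) basis `ι p`,
the basis element `i : ι p` having degree `deg p i ∈ M`, all maps are graded of degree `0`,
and the complex is exact. -/
structure GradedFreeResolution (σ : Type) (K : Type) [Field K] (M : Type) [AddCommMonoid M]
    (w : σ → M) (I : Ideal (MvPolynomial σ K)) where
  ι : ℕ → Type
  finite : ∀ p, Finite (ι p)
  deg : ∀ p, ι p → M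
  aug : (ι 0 →₀ MvPolynomial σ K) →ₗ[MvPolynomial σ K] MvPolynomial σ K
  d : ∀ p, (ι (p + 1) →₀ MvPolynomial σ K) →ₗ[MvPolynomial σ K] (ι p →₀ MvPolynomial σ K)
  aug_graded : ∀ i : ι 0, (aug (Finsupp.single i 1)).IsWeightedHomogeneous w (deg 0 i)
  d_graded : ∀ (p : ℕ) (i : ι (p + 1)) (j : ι p),
    (d p (Finsupp.single i 1)) j = 0 ∨
      ∃ b, ((d p (Finsupp.single i 1)) j).IsWeightedHomogeneous w b ∧
        b + deg p j = deg (p + 1) i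
  range_aug : LinearMap.range aug = (I : Submodule (MvPolynomial σ K) (MvPolynomial σ K))
  exact_zero : LinearMap.ker aug = LinearMap.range (d 0)
  exact : ∀ p, LinearMap.ker (d p) = LinearMap.range (d (p + 1))

/-- A graded free resolution is minimal if all entries of the matrices of the differentials
between free modules lie in the irrelevant maximal ideal, i.e. have zero constant term. -/
def GradedFreeResolution.Minimal {σ M : Type} [AddCommMonoid M] {w : σ → M}
    {I : Ideal (MvPolynomial σ K)} (F : GradedFreeResolution σ K M w I) : Prop :=
  ∀ (p : ℕ) (i : F.ι (p + 1)) (j : F.ι p),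
    MvPolynomial.constantCoeff ((F.d p (Finsupp.single i 1)) j) = 0

/-- The graded Betti number `β_{p,a}` read off from a (minimal) graded free resolution:
the number of basis elements of `F_p` of degree `a`. -/
def GradedFreeResolution.betti {σ M : Type} [AddCommMonoid M] {w : σ → M}
    {I : Ideal (MvPolynomial σ K)} (F : GradedFreeResolution σ K M w I) (p : ℕ) (a : M) :
    ℕ :=
  Nat.card {i : F.ι p // F.deg p i = a}

/-- The set of `t × t` minors of the matrix `A`. -/
def minorsSet {R : Type} [CommRing R] (t : ℕ) {m N : ℕ} (A : Matrix (Fin m) (Fin N) R) :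
    Set R :=
  {d | ∃ (r : Fin t → Fin m) (c : Fin t → Fin N),
    Function.Injective r ∧ Function.Injective c ∧ d = (A.submatrix r c).det}

/-- `I_t(A)`, the ideal generated by the `t × t` minors of `A`. -/
def minorsIdeal {R : Type} [CommRing R] (t : ℕ) {m N : ℕ}
    (A : Matrix (Fin m) (Fin N) R) : Ideal R :=
  Ideal.span (minorsSet t A)

/-- `A` is column-graded: `N ≤ v` and each entry of the `j`-th column is either `0` or
multihomogeneous of degree `e_j ∈ ℤ^v`. -/
def ColumnGraded {m N : ℕ} (A : Matrix (Fin m) (Fin N) (MvPolynomial (MVar v n) K)) :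
    Prop :=
  ∃ h : N ≤ v, ∀ i j, A i j = 0 ∨
    (A i j).IsWeightedHomogeneous (wt v n) (Pi.single (Fin.castLE h j) 1)

/-- `A` is row-graded: `m ≤ v` and each entry of the `i`-th row is either `0` or
multihomogeneous of degree `e_i ∈ ℤ^v`. -/
def RowGraded {m N : ℕ} (A : Matrix (Fin m) (Fin N) (MvPolynomial (MVar v n) K)) : Prop :=
  ∃ h : m ≤ v, ∀ i j, A i j = 0 ∨
    (A i j).IsWeightedHomogeneous (wt v n) (Pi.single (Fin.castLE h i) 1)

/-- The exponent of the polarization of the monomial `x_{1 1}^{a 1} ⋯ x_{v 1}^{a v}` of `T`: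
the squarefree monomial `∏_i x_{i 1} x_{i 2} ⋯ x_{i (a i)}`. -/
def polExp (v : ℕ) (n : Fin v → ℕ) (a : Fin v → ℕ) : MVar v n →₀ ℕ :=
  ∑ i : Fin v, ∑ j ∈ Finset.univ.filter (fun j : Fin (n i + 1) => (j : ℕ) < a i),
    Finsupp.single (⟨i, j⟩ : MVar v n) 1

/-- `P = pol(C)`, the polarization of an ideal `C` extended from `T`
(the exponents of the generators of `C` must fit inside `S`). -/
def IsPolarizationOfT (C P : Ideal (MvPolynomial (MVar v n) K)) : Prop :=
  ∃ A : Set (Fin v → ℕ), (∀ a ∈ A, ∀ i, a i ≤ n i + 1) ∧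
    C = Ideal.span ((fun a => monomial (Tmono v n a) (1 : K)) '' A) ∧
    P = Ideal.span ((fun a => monomial (polExp v n a) (1 : K)) '' A)

/-- `ψ` is an identification of the quotient of `S` by the `ℤ^v`-graded ideal `Q` with a
standard `ℤ^v`-graded polynomial ring, compatible with the gradings. -/
def IsGradedStructureIso {n₂ : Fin v → ℕ} (Q : Ideal (MvPolynomial (MVar v n) K))
    (ψ : (MvPolynomial (MVar v n) K ⧸ Q) ≃ₐ[K] MvPolynomial (MVar v n₂) K) : Prop :=
  ∀ (f : MvPolynomial (MVar v n) K) (a : Fin v → ℕ),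
    f.IsWeightedHomogeneous (wt v n) a →
      (ψ (Ideal.Quotient.mk Q f)).IsWeightedHomogeneous (wt v n₂) a

end CSPaper

open CSPaper

section LeadingExponents

variable {σ : Type*} {F : Type*} [Field F]

/-- Polynomials with pairwise distinct leading exponents are linearly independent. -/
theorem linearIndependent_of_injective_degree {ι : Type*} (τ : MonomialOrder σ)
    (f : ι → MvPolynomial σ F) (hf : ∀ i, f i ≠ 0)
    (hinj : Function.Injective fun i => τ.degree (f i)) : LinearIndependent F f := by
  classical
  rw [linearIndependent_iff']
  intro s c hsum
  by_contra! hne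
  obtain ⟨i₀, hi₀, hc₀⟩ := hne
  have hT : (s.filter fun i => c i ≠ 0).Nonempty := ⟨i₀, by simp [hi₀, hc₀]⟩
  obtain ⟨i, hi, hmax⟩ := Finset.exists_max_image _ (fun i => τ.toSyn (τ.degree (f i))) hT
  rw [Finset.mem_filter] at hi
  have hcoeff := congrArg (coeff (τ.degree (f i))) hsum
  rw [coeff_sum, Finset.sum_eq_single_of_mem i hi.1] at hcoeff
  · rw [coeff_smul, coeff_zero, smul_eq_mul, mul_eq_zero] at hcoeff
    exact hcoeff.elim hi.2 ((τ.coeff_degree_ne_zero_iff).2 (hf i))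
  · intro j hj hji
    rw [coeff_smul, smul_eq_mul]
    by_cases hcj : c j = 0
    · simp [hcj]
    · rw [τ.coeff_eq_zero_of_lt, mul_zero]
      refine lt_of_le_of_ne (hmax j (by simp [hj, hcj])) fun h => hji (hinj ?_)
      exact τ.toSyn.injective h

/-- A finite set of exponents realised as leading exponents in a finite-dimensional subspace has
cardinality at most the dimension of the subspace. -/
theorem card_le_finrank_of_degree (τ : MonomialOrder σ) (W : Submodule F (MvPolynomial σ F))
    [FiniteDimensional F W] (s : Finset (σ →₀ ℕ))
    (h : ∀ d ∈ s, ∃ f ∈ W, f ≠ 0 ∧ τ.degree f = d) : s.card ≤ Module.finrank F W := by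
  choose! f hfW hf0 hfd using h
  have hli : LinearIndependent F fun d : s => f d :=
    linearIndependent_of_injective_degree τ _ (fun d => hf0 d d.2) fun a b hab => by
      simp only [hfd _ a.2, hfd _ b.2] at hab
      exact Subtype.ext hab
  have hli' : LinearIndependent F fun d : s => (⟨f d, hfW d d.2⟩ : W) :=
    LinearIndependent.of_comp W.subtype hli
  simpa using hli'.fintype_card_le_finrank

theorem finrank_restrictSupport (s : Finset (σ →₀ ℕ)) :
    Module.finrank F (restrictSupport F (s : Set (σ →₀ ℕ))) = s.card := by
  rw [Module.finrank_eq_card_basis (basisRestrictSupport F (s : Set (σ →₀ ℕ)))]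
  simp

theorem finiteDimensional_restrictSupport (s : Finset (σ →₀ ℕ)) :
    FiniteDimensional F (restrictSupport F (s : Set (σ →₀ ℕ))) :=
  Module.Finite.of_basis (basisRestrictSupport F (s : Set (σ →₀ ℕ)))

/-- Bounds the dimension of a subspace `W` of the span of the monomials in `s`, given an
endomorphism of this span that maps no nonzero combination of monomials of `s` without property
`p` into `W`. -/
theorem finrank_le_card_filter (s : Finset (σ →₀ ℕ)) (p : (σ →₀ ℕ) → Prop) [DecidablePred p]
    (W : Submodule F (MvPolynomial σ F)) (hW : W ≤ restrictSupport F (s : Set (σ →₀ ℕ)))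
    (g : MvPolynomial σ F →ₗ[F] MvPolynomial σ F)
    (hg : ∀ u ∈ restrictSupport F (s : Set (σ →₀ ℕ)), g u ∈ restrictSupport F (s : Set (σ →₀ ℕ)))
    (hgW : ∀ u ∈ restrictSupport F ((s.filter fun d => ¬ p d : Finset (σ →₀ ℕ)) : Set (σ →₀ ℕ)),
      g u ∈ W → u = 0) :
    Module.finrank F W ≤ (s.filter p).card := by
  classical
  set B := restrictSupport F (s : Set (σ →₀ ℕ)) with hB
  set U := restrictSupport F ((s.filter fun d => ¬ p d : Finset _) : Set (σ →₀ ℕ))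
  have : FiniteDimensional F B := finiteDimensional_restrictSupport s
  have : FiniteDimensional F U := finiteDimensional_restrictSupport _
  have hUB : U ≤ B := restrictSupport_mono F (by exact_mod_cast Finset.filter_subset _ _)
  have hinj : Function.Injective (g.domRestrict U) := by
    rw [injective_iff_map_eq_zero]
    intro u hu
    exact Subtype.ext (hgW u u.2 (by
      have : g u = 0 := hu
      rw [this]; exact W.zero_mem))
  have hdisj : Disjoint W (LinearMap.range (g.domRestrict U)) := by
    rw [Submodule.disjoint_def]
    rintro x hx ⟨u, rfl⟩
    have hu0 : (u : MvPolynomial σ F) = 0 := hgW u u.2 hx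
    have : u = 0 := Subtype.ext hu0
    rw [this, map_zero]
  have hle : W ⊔ LinearMap.range (g.domRestrict U) ≤ B := by
    refine sup_le hW ?_
    rintro _ ⟨u, rfl⟩
    exact hg _ (hUB u.2)
  have : FiniteDimensional F W := Submodule.finiteDimensional_of_le hW
  have h1 := Submodule.finrank_sup_add_finrank_inf_eq W (LinearMap.range (g.domRestrict U))
  rw [hdisj.eq_bot, finrank_bot, LinearMap.finrank_range_of_inj hinj,
    finrank_restrictSupport] at h1
  have h2 := Submodule.finrank_mono hle
  rw [hB, finrank_restrictSupport] at h2
  have h3 := Finset.card_filter_add_card_filter_not (s := s) p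
  omega

/-- Substituting polynomials of degree at most one does not raise the total degree. -/
theorem totalDegree_aeval_le_of_linear (g : σ → MvPolynomial σ F)
    (hg : ∀ x, (g x).totalDegree ≤ 1) (p : MvPolynomial σ F) :
    (aeval g p).totalDegree ≤ p.totalDegree := by
  classical
  rw [aeval_def, eval₂_eq]
  refine (totalDegree_finsetSum _ _).trans (Finset.sup_le fun d hd => ?_)
  refine (totalDegree_mul _ _).trans ?_
  rw [algebraMap_eq, totalDegree_C, zero_add]
  refine (totalDegree_finsetProd _ _).trans (le_trans ?_ (le_totalDegree hd))
  exact Finset.sum_le_sum fun x _ =>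
    (totalDegree_pow _ _).trans (by simpa using Nat.mul_le_mul_left (d x) (hg x))

theorem coeff_zero_prod {ι R : Type*} [CommSemiring R] (s : Finset ι) (f : ι → Polynomial R) :
    (∏ i ∈ s, f i).coeff 0 = ∏ i ∈ s, (f i).coeff 0 := by
  simp only [Polynomial.coeff_zero_eq_eval_zero, Polynomial.eval_prod]

/-- The lowest coefficient of a polynomial evaluated along a curve whose coordinates vanish to
prescribed orders `w x`. -/
theorem coeff_aeval_curve [Fintype σ] (w : σ → ℕ) (q : σ → Polynomial F)
    (u : MvPolynomial σ F) (d : ℕ) (hd : ∀ s ∈ u.support, d ≤ ∑ x, w x * s x) :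
    (aeval (fun x => Polynomial.X ^ w x * q x) u).coeff d =
      ∑ s ∈ u.support with ∑ x, w x * s x = d, u.coeff s * ∏ x, (q x).coeff 0 ^ s x := by
  classical
  rw [aeval_def, eval₂_eq', Polynomial.finsetSum_coeff, Finset.sum_filter]
  refine Finset.sum_congr rfl fun s hs => ?_
  have hprod : ∏ x, (Polynomial.X ^ w x * q x) ^ s x =
      Polynomial.X ^ (∑ x, w x * s x) * ∏ x, q x ^ s x := by
    rw [← Finset.prod_pow_eq_pow_sum, ← Finset.prod_mul_distrib]
    exact Finset.prod_congr rfl fun x _ => by rw [mul_pow, pow_mul]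
  rw [hprod, Polynomial.algebraMap_eq, Polynomial.coeff_C_mul, Polynomial.coeff_X_pow_mul']
  split_ifs with h1 h2 h2
  · rw [h2, Nat.sub_self, coeff_zero_prod]
    simp [Polynomial.coeff_zero_eq_eval_zero]
  · have := hd s hs
    omega
  · exact absurd h2.le h1
  · rw [mul_zero]

end LeadingExponents

section DegenerateCurve

open Matrix

variable {F : Type*} [Field F] {m : ℕ} {ι : Type*} [DecidableEq ι]

/-- The matrix over `F[t]` whose `j`-th column is `α j • w j + β j • a j`. -/
def pencil (w a : Matrix (Fin m) ι F) (α β : ι → Polynomial F) :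
    Matrix (Fin m) ι (Polynomial F) :=
  Matrix.of fun i j => α j * Polynomial.C (w i j) + β j * Polynomial.C (a i j)

/-- Let `H` be a maximal set of columns on which all maximal minors of pencils vanish. A curve
that moves freely in the columns of `H` can be completed, with prescribed leading terms in the
direction `a`, so that all maximal minors vanish along it. -/
theorem exists_pencil_minors_eq_zero (w a : Matrix (Fin m) ι F) (H : Finset ι)
    (hH : ∀ c : Fin m → ι, (∀ r, c r ∈ H) → ∀ α β, ((pencil w a α β).submatrix id c).det = 0)
    (hmax : ∀ j ∉ H, ∃ c : Fin m → ι, (∀ r, c r ∈ insert j H) ∧ (w.submatrix id c).det ≠ 0)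
    (ξ : ι → F) (hξ : ∀ j, ξ j ≠ 0) :
    ∃ α β : ι → Polynomial F, (∀ j ∈ H, α j = Polynomial.C (ξ j)) ∧
      (∀ j ∉ H, ∃ α', α j = Polynomial.X * α') ∧
      (∀ j, ∃ β', β j = Polynomial.X * β' ∧ β'.coeff 0 = 1) ∧
      ∀ c : Fin m → ι, ((pencil w a α β).submatrix id c).det = 0 := by
  classical
  by_cases huniv : ∀ j, j ∈ H
  · exact ⟨fun j => Polynomial.C (ξ j), fun _ => Polynomial.X, fun _ _ => rfl,
      fun j hj => absurd (huniv j) hj, fun _ => ⟨1, by simp, by simp⟩,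
      fun c => hH c (fun r => huniv _) _ _⟩
  push Not at huniv
  obtain ⟨j₀, hj₀⟩ := huniv
  obtain ⟨c₀, hc₀, hdet₀⟩ := hmax j₀ hj₀
  have hwH : ∀ c : Fin m → ι, (∀ r, c r ∈ H) → (w.submatrix id c).det = 0 := by
    intro c hc
    have h := hH c hc (fun _ => 1) (fun _ => 0)
    have h2 : (pencil w a (fun _ => 1) (fun _ => 0)).submatrix id c =
        (w.submatrix id c).map Polynomial.C := by
      ext1 i j
      simp [pencil]
    rw [h2, ← RingHom.mapMatrix_apply, ← RingHom.map_det] at h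
    exact Polynomial.C_eq_zero.1 h
  obtain ⟨r₀, hr₀⟩ : ∃ r₀, c₀ r₀ ∉ H := by
    by_contra! h
    exact hdet₀ (hwH c₀ h)
  have hinj : Function.Injective c₀ := by
    intro r s hrs
    by_contra hne
    exact hdet₀ (det_zero_of_column_eq hne fun i => by simp [hrs])
  have hothers : ∀ r, r ≠ r₀ → c₀ r ∈ H := by
    intro r hr
    have h0 := Finset.mem_insert.1 (hc₀ r₀)
    rcases Finset.mem_insert.1 (hc₀ r) with h | h
    · exact absurd (hinj (h.trans (h0.resolve_right hr₀).symm)) hr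
    · exact h
  set N₀ := pencil w a (fun j => Polynomial.C (ξ j)) (fun _ => Polynomial.X) with hN₀
  set M₀ := N₀.submatrix id c₀ with hM₀
  set y : Fin m → Polynomial F := M₀.adjugate r₀ with hy
  have hydot : ∀ b : Fin m → Polynomial F, y ⬝ᵥ b = (M₀.updateCol r₀ b).det := by
    intro b
    rw [← cramer_apply, cramer_eq_adjugate_mulVec]
    rfl
  have hyH : ∀ i ∈ H, y ⬝ᵥ (fun k => N₀ k i) = 0 := by
    intro i hi
    rw [hydot]
    have : M₀.updateCol r₀ (fun k => N₀ k i) = N₀.submatrix id (Function.update c₀ r₀ i) := by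
      ext1 k r
      rcases eq_or_ne r r₀ with rfl | hr
      · simp
      · simp [hr, hM₀]
    rw [this]
    refine hH _ (fun r => ?_) _ _
    rcases eq_or_ne r r₀ with rfl | hr
    · simpa using hi
    · simpa [hr] using hothers r hr
  set y₀ : Fin m → F := fun i => (y i).coeff 0 with hy₀
  have hcoeff : ∀ i, (y ⬝ᵥ (fun k => N₀ k i)).coeff 0 = ξ i * (y₀ ⬝ᵥ fun k => w k i) := by
    intro i
    simp only [dotProduct, Polynomial.finsetSum_coeff, Polynomial.mul_coeff_zero, hN₀, pencil,
      of_apply, Polynomial.coeff_add, Polynomial.coeff_C_zero, Polynomial.coeff_X_zero, zero_mul,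
      add_zero, hy₀, Finset.mul_sum]
    exact Finset.sum_congr rfl fun k _ => by ring
  have hy₀H : ∀ i ∈ H, (y₀ ⬝ᵥ fun k => w k i) = 0 := by
    intro i hi
    have h := hcoeff i
    rw [hyH i hi, Polynomial.coeff_zero] at h
    exact (mul_eq_zero.1 h.symm).resolve_left (hξ i)
  have hy₀ne : y₀ ≠ 0 := by
    intro h0
    have h := hcoeff (c₀ r₀)
    have h1 : M₀.updateCol r₀ (fun k => N₀ k (c₀ r₀)) = M₀ := by
      ext1 k r
      rcases eq_or_ne r r₀ with rfl | hr
      · simp [hM₀]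
      · simp [hr]
    rw [hydot, h1, h0, zero_dotProduct, mul_zero, Polynomial.coeff_zero_eq_eval_zero,
      ← Polynomial.coe_evalRingHom, RingHom.map_det] at h
    have h2 : (Polynomial.evalRingHom (0 : F)).mapMatrix M₀ =
        Matrix.of fun i j => ξ (c₀ j) * w.submatrix id c₀ i j := by
      ext i j
      simp [hM₀, hN₀, pencil]
    rw [h2, det_mul_row] at h
    exact mul_ne_zero (Finset.prod_ne_zero_iff.2 fun r _ => hξ (c₀ r)) hdet₀ h
  have hδ : ∀ j ∉ H, (y₀ ⬝ᵥ fun k => w k j) ≠ 0 := by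
    intro j hj h0
    obtain ⟨c, hc, hdet⟩ := hmax j hj
    refine hy₀ne (eq_zero_of_vecMul_eq_zero hdet ?_)
    ext r
    rcases Finset.mem_insert.1 (hc r) with h | h
    · simpa [vecMul, h] using h0
    · simpa [vecMul] using hy₀H _ h
  set D : ι → Polynomial F := fun j => y ⬝ᵥ fun k => Polynomial.C (w k j) with hD
  set E : ι → Polynomial F := fun j => y ⬝ᵥ fun k => Polynomial.C (a k j) with hE
  have hsplit : ∀ (α β : ι → Polynomial F) (j : ι),
      (y ⬝ᵥ fun k => pencil w a α β k j) = α j * D j + β j * E j := by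
    intro α β j
    simp only [hD, hE, dotProduct, pencil, of_apply, Finset.mul_sum, ← Finset.sum_add_distrib]
    exact Finset.sum_congr rfl fun k _ => by ring
  have hD0 : ∀ j, (D j).coeff 0 = y₀ ⬝ᵥ fun k => w k j := by
    intro j
    simp [hD, dotProduct, Polynomial.finsetSum_coeff, Polynomial.mul_coeff_zero, hy₀]
  set δ : ι → F := fun j => y₀ ⬝ᵥ fun k => w k j with hδdef
  let α : ι → Polynomial F := fun j =>
    if j ∈ H then Polynomial.C (ξ j) else Polynomial.X * (-(Polynomial.C (δ j)⁻¹ * E j))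
  let β : ι → Polynomial F := fun j =>
    if j ∈ H then Polynomial.X else Polynomial.X * (Polynomial.C (δ j)⁻¹ * D j)
  have hzero : ∀ j, (y ⬝ᵥ fun k => pencil w a α β k j) = 0 := by
    intro j
    rw [hsplit]
    by_cases hj : j ∈ H
    · have h := hyH _ hj
      rw [hN₀, hsplit] at h
      simpa [hj, α, β] using h
    · simp only [hj, if_false, α, β]
      ring
  refine ⟨α, β, fun j hj => if_pos hj, fun j hj => ⟨_, if_neg hj⟩, fun j => ?_, fun c => ?_⟩
  · by_cases hj : j ∈ H
    · exact ⟨1, by simp [hj, β], by simp⟩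
    · refine ⟨_, if_neg hj, ?_⟩
      rw [Polynomial.mul_coeff_zero, Polynomial.coeff_C_zero, hD0]
      exact inv_mul_cancel₀ (hδ j hj)
  · rw [← exists_vecMul_eq_zero_iff]
    exact ⟨y, fun h => hy₀ne (by ext i; simp [hy₀, h]), funext fun r => hzero (c r)⟩

end DegenerateCurve

section ColumnGraded

variable {K : Type} [Field K] {v : ℕ} {n : Fin v → ℕ} {m : ℕ}

theorem weight_wt_apply (s : MVar v n →₀ ℕ) (b : Fin v) :
    Finsupp.weight (wt v n) s b = ∑ k, s ⟨b, k⟩ := by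
  rw [Finsupp.weight_apply, Finsupp.sum_fintype _ _ (by simp), Finset.sum_apply,
    Fintype.sum_sigma, Finset.sum_eq_single b]
  · simp [wt]
  · intro j _ hj
    simp [wt, hj.symm]
  · simp

/-- A form of degree `e_j` is a linear form in the variables of block `j`. -/
theorem exists_eq_sum_C_mul_X {a : MvPolynomial (MVar v n) K} {j : Fin v}
    (ha : a.IsWeightedHomogeneous (wt v n) (Pi.single j 1)) :
    ∃ l : Fin (n j + 1) → K, a = ∑ k, C (l k) * X ⟨j, k⟩ := by
  classical
  refine ⟨fun k => a.coeff (Finsupp.single ⟨j, k⟩ 1), ?_⟩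
  ext s
  simp only [coeff_sum, coeff_C_mul, coeff_X]
  by_cases hs : Finsupp.weight (wt v n) s = Pi.single j 1
  · have hb : ∀ b, ∑ k, s ⟨b, k⟩ = if b = j then 1 else 0 := fun b => by
      rw [← weight_wt_apply, hs, Pi.single_apply]
    have hj := hb j
    rw [if_pos rfl] at hj
    obtain ⟨k₀, -, hk₀⟩ := Finset.exists_ne_zero_of_sum_ne_zero (hj.trans_ne one_ne_zero)
    have hsum := Finset.add_sum_erase _ (fun k => s ⟨j, k⟩) (Finset.mem_univ k₀)
    simp only [hj] at hsum
    have hrest : ∑ k ∈ Finset.univ.erase k₀, s ⟨j, k⟩ = 0 := by omega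
    have hk : ∀ k ≠ k₀, s ⟨j, k⟩ = 0 := fun k hkk =>
      Finset.sum_eq_zero_iff.1 hrest k (Finset.mem_erase.2 ⟨hkk, Finset.mem_univ k⟩)
    replace hk₀ : s ⟨j, k₀⟩ = 1 := by omega
    have hs' : s = Finsupp.single ⟨j, k₀⟩ 1 := by
      ext ⟨b, k⟩
      rcases eq_or_ne b j with rfl | hbj
      · rcases eq_or_ne k k₀ with rfl | hkk
        · simp [hk₀]
        · rw [hk k hkk, Finsupp.single_eq_of_ne (by simpa using hkk)]
      · have h0 := hb b
        rw [if_neg hbj, Finset.sum_eq_zero_iff] at h0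
        rw [h0 k (Finset.mem_univ _), Finsupp.single_eq_of_ne]
        intro h
        exact hbj (congrArg Sigma.fst h)
    rw [Finset.sum_eq_single k₀]
    · simp [hs']
    · intro k _ hkk
      rw [if_neg, mul_zero]
      rw [hs', Finsupp.single_left_inj one_ne_zero]
      simpa using hkk
    · simp
  · rw [ha.coeff_eq_zero s hs, eq_comm]
    refine Finset.sum_eq_zero fun k _ => ?_
    rw [if_neg, mul_zero]
    rintro rfl
    exact hs (by simp [Finsupp.weight_apply, wt])

theorem aeval_pencil {a : MvPolynomial (MVar v n) K} {j : Fin v}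
    (ha : a.IsWeightedHomogeneous (wt v n) (Pi.single j 1)) (ω θ : MVar v n → K)
    (α β : Fin v → Polynomial K) :
    aeval (fun x => α x.1 * Polynomial.C (ω x) + β x.1 * Polynomial.C (θ x)) a =
      α j * Polynomial.C (eval ω a) + β j * Polynomial.C (eval θ a) := by
  obtain ⟨l, rfl⟩ := exists_eq_sum_C_mul_X ha
  simp only [map_sum, map_mul, aeval_X, eval_X, eval_C, aeval_C, Polynomial.algebraMap_eq,
    Finset.mul_sum, ← Finset.sum_add_distrib]
  exact Finset.sum_congr rfl fun k _ => by ring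

variable (A : Matrix (Fin m) (Fin v) (MvPolynomial (MVar v n) K))

/-- The minor of `A` on the columns `c` (which vanishes if `c` is not injective). -/
abbrev colMinor (c : Fin m → Fin v) : MvPolynomial (MVar v n) K := (A.submatrix id c).det

variable {A}

theorem colMinor_injective {c : Fin m → Fin v} (hc : colMinor A c ≠ 0) :
    Function.Injective c := by
  intro r s hrs
  by_contra hne
  exact hc (Matrix.det_zero_of_column_eq hne fun i => by simp [hrs])

theorem colMinor_isWeightedHomogeneous
    (hA : ∀ i j, (A i j).IsWeightedHomogeneous (wt v n) (Pi.single j 1)) (c : Fin m → Fin v) :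
    (colMinor A c).IsWeightedHomogeneous (wt v n) (∑ r, Pi.single (c r) 1) := by
  rw [colMinor, Matrix.det_apply']
  refine IsWeightedHomogeneous.sum _ _ _ fun σ _ => ?_
  have h : (∏ i, A.submatrix id c (σ i) i).IsWeightedHomogeneous (wt v n)
      (∑ r, Pi.single (c r) 1) := IsWeightedHomogeneous.prod _ _ _ fun i _ => hA _ _
  have := h.C_mul ((Equiv.Perm.sign σ : ℤ) : K)
  simpa using this

/-- Exponents whose special variables (the first ones in each block) meet the columns of a
nonzero minor. -/
def SpecialSpanning (A : Matrix (Fin m) (Fin v) (MvPolynomial (MVar v n) K))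
    (s : MVar v n →₀ ℕ) : Prop :=
  ∃ c, colMinor A c ≠ 0 ∧ ∀ r, s ⟨c r, 0⟩ ≠ 0

/-- The change of coordinates inverse to `X ⟨b, k⟩ ↦ ω ⟨b, k⟩ * X ⟨b, 0⟩ + X ⟨b, k⟩` (`k ≠ 0`),
`X ⟨b, 0⟩ ↦ ω ⟨b, 0⟩ * X ⟨b, 0⟩`. -/
def recenter (ω : MVar v n → K) : MvPolynomial (MVar v n) K →ₐ[K] MvPolynomial (MVar v n) K :=
  aeval fun x => if x.2 = 0 then C (ω ⟨x.1, 0⟩)⁻¹ * X ⟨x.1, 0⟩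
    else X x - C (ω x * (ω ⟨x.1, 0⟩)⁻¹) * X ⟨x.1, 0⟩

theorem aeval_recenter {ω : MVar v n → K} (hω : ∀ b, ω ⟨b, 0⟩ ≠ 0) (θ : MVar v n → K)
    (α β : Fin v → Polynomial K) (hθ : ∀ b, θ ⟨b, 0⟩ = 0) (u : MvPolynomial (MVar v n) K) :
    aeval (fun x => α x.1 * Polynomial.C (ω x) + β x.1 * Polynomial.C (θ x)) (recenter ω u) =
      aeval (fun x => if x.2 = 0 then α x.1 else β x.1 * Polynomial.C (θ x)) u := by
  rw [recenter, ← AlgHom.comp_apply]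
  congr 1
  refine algHom_ext fun ⟨b, k⟩ => ?_
  have h1 : Polynomial.C (ω ⟨b, 0⟩)⁻¹ * Polynomial.C (ω ⟨b, 0⟩) = 1 := by
    rw [← Polynomial.C_mul, inv_mul_cancel₀ (hω b), Polynomial.C_1]
  simp only [AlgHom.comp_apply, aeval_X]
  split_ifs with hk
  · simp only [map_mul, aeval_X, aeval_C, Polynomial.algebraMap_eq, hθ, map_zero, mul_zero,
      add_zero]
    linear_combination α b * h1
  · simp only [map_mul, map_sub, aeval_X, aeval_C, Polynomial.algebraMap_eq, hθ, map_zero,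
      mul_zero, add_zero]
    linear_combination -(α b * Polynomial.C (ω ⟨b, k⟩)) * h1

/-- In generic coordinates, the monomials whose special support is non-spanning are linearly
independent modulo the ideal of maximal minors. -/
theorem eq_zero_of_recenter_mem [Infinite K]
    (hA : ∀ i j, (A i j).IsWeightedHomogeneous (wt v n) (Pi.single j 1))
    {ω : MVar v n → K} (hω : ∀ b, ω ⟨b, 0⟩ ≠ 0)
    (hωA : ∀ c, colMinor A c ≠ 0 → eval ω (colMinor A c) ≠ 0)
    (u : MvPolynomial (MVar v n) K) (hu : ∀ s ∈ u.support, ¬ SpecialSpanning A s)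
    (hmem : recenter ω u ∈ Ideal.span (Set.range (colMinor A))) : u = 0 := by
  classical
  by_contra hu0
  obtain ⟨s₀, hs₀, hmin⟩ := Finset.exists_min_image u.support
    (fun s => ∑ x : MVar v n, (if x.2 = 0 then 0 else 1) * s x) (support_nonempty.2 hu0)
  set d := ∑ x : MVar v n, (if x.2 = 0 then 0 else 1) * s₀ x with hd
  obtain ⟨H, hGH, hHmax⟩ := Set.Finite.exists_le_maximal
    (Set.toFinite {G : Finset (Fin v) | ∀ c : Fin m → Fin v, (∀ r, c r ∈ G) → colMinor A c = 0})
    (a := Finset.univ.filter fun b => s₀ ⟨b, 0⟩ ≠ 0) (by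
      intro c hc
      by_contra hne
      exact hu s₀ hs₀ ⟨c, hne, fun r => by simpa using hc r⟩)
  have hH : ∀ c : Fin m → Fin v, (∀ r, c r ∈ H) → colMinor A c = 0 := hHmax.prop
  have hmax : ∀ j ∉ H, ∃ c : Fin m → Fin v, (∀ r, c r ∈ insert j H) ∧ colMinor A c ≠ 0 := by
    intro j hj
    by_contra! h
    exact hj (hHmax.le_of_ge (y := insert j H) h (Finset.subset_insert j H)
      (Finset.mem_insert_self j H))
  -- the weight measures the order of vanishing of each coordinate along the curve
  let w : MVar v n → ℕ := fun x => if x.2 = 0 ∧ x.1 ∈ H then 0 else 1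
  have hwle : ∀ s : MVar v n →₀ ℕ,
      ∑ x : MVar v n, (if x.2 = 0 then 0 else 1) * s x ≤ ∑ x, w x * s x := by
    intro s
    refine Finset.sum_le_sum fun x _ => Nat.mul_le_mul_right _ ?_
    by_cases hx : x.2 = 0 <;> simp [w, hx]
  have hdw : ∀ s ∈ u.support, d ≤ ∑ x, w x * s x := fun s hs => (hmin s hs).trans (hwle s)
  have hs₀w : ∑ x, w x * s₀ x = d := by
    refine Finset.sum_congr rfl fun x _ => ?_
    obtain ⟨b, k⟩ := x
    by_cases hk : k = 0
    · subst hk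
      by_cases hb : b ∈ H
      · simp [w, hb]
      · have : s₀ ⟨b, 0⟩ = 0 := by
          by_contra hne
          exact hb (hGH (by simpa using hne))
        simp [this]
    · simp [w, hk]
  have hvanish : ∀ s ∈ u.support, ∑ x, w x * s x = d → ∀ b ∉ H, s ⟨b, 0⟩ = 0 := by
    intro s hs hsd b hb
    by_contra hne
    refine absurd (hmin s hs) (not_le.2 ?_)
    rw [← hsd]
    refine Finset.sum_lt_sum (fun x _ => Nat.mul_le_mul_right _ ?_)
      ⟨⟨b, 0⟩, Finset.mem_univ _, ?_⟩
    · by_cases hx : x.2 = 0 <;> simp [w, hx]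
    · simpa [w, hb] using Nat.pos_of_ne_zero hne
  -- a point where the lowest component does not vanish
  set u' : MvPolynomial (MVar v n) K :=
    ∑ s ∈ u.support with ∑ x, w x * s x = d, monomial s (u.coeff s) with hu'
  have hu'0 : u' ≠ 0 := by
    intro h
    have h1 := congrArg (coeff s₀) h
    rw [hu', coeff_sum, Finset.sum_eq_single_of_mem s₀ (by simp [hs₀w, mem_support_iff.1 hs₀])
      (fun s _ hs => by rw [coeff_monomial, if_neg hs])] at h1
    exact mem_support_iff.1 hs₀ (by simpa using h1)
  obtain ⟨η, hη⟩ : ∃ η : MVar v n → K, eval η (u' * ∏ b : Fin v, X ⟨b, 0⟩) ≠ 0 := by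
    by_contra! h
    refine mul_ne_zero hu'0 (Finset.prod_ne_zero_iff.2 fun b _ => X_ne_zero _)
      (MvPolynomial.funext fun x => by rw [h x, map_zero])
  rw [map_mul, map_prod] at hη
  have hηu := left_ne_zero_of_mul hη
  have hη0 : ∀ b, η ⟨b, 0⟩ ≠ 0 := fun b => by
    simpa using Finset.prod_ne_zero_iff.1 (right_ne_zero_of_mul hη) b (Finset.mem_univ b)
  let θ : MVar v n → K := fun x => if x.2 = 0 then 0 else η x
  have hpencil : ∀ (α β : Fin v → Polynomial K) (c : Fin m → Fin v),
      aeval (fun x => α x.1 * Polynomial.C (ω x) + β x.1 * Polynomial.C (θ x)) (colMinor A c) =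
        ((pencil (A.map (eval ω)) (A.map (eval θ)) α β).submatrix id c).det := by
    intro α β c
    rw [colMinor, AlgHom.map_det]
    congr 1
    ext1 i r
    exact aeval_pencil (hA i (c r)) ω θ α β
  obtain ⟨α, β, hαH, hα, hβ, hdet⟩ := exists_pencil_minors_eq_zero (A.map (eval ω))
    (A.map (eval θ)) H (fun c hc α β => by rw [← hpencil, hH c hc, map_zero])
    (fun j hj => by
      obtain ⟨c, hc, hne⟩ := hmax j hj
      refine ⟨c, hc, ?_⟩
      have := hωA c hne
      rwa [colMinor, RingHom.map_det] at this)
    (fun b => η ⟨b, 0⟩) hη0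
  have hzero : aeval (fun x => α x.1 * Polynomial.C (ω x) + β x.1 * Polynomial.C (θ x))
      (recenter ω u) = 0 := by
    have hle : Ideal.span (Set.range (colMinor A)) ≤ RingHom.ker (aeval (R := K)
        fun x : MVar v n => α x.1 * Polynomial.C (ω x) + β x.1 * Polynomial.C (θ x)) := by
      rw [Ideal.span_le]
      rintro _ ⟨c, rfl⟩
      exact (hpencil α β c).trans (hdet c)
    exact hle hmem
  rw [aeval_recenter hω θ α β (fun b => by simp [θ])] at hzero
  choose β' hβ' hβ'0 using hβ
  choose! α' hα' using hα
  let q : MVar v n → Polynomial K := fun x =>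
    if x.2 = 0 then (if x.1 ∈ H then Polynomial.C (η ⟨x.1, 0⟩) else α' x.1)
    else β' x.1 * Polynomial.C (η x)
  have hcurve : (fun x : MVar v n => if x.2 = 0 then α x.1 else β x.1 * Polynomial.C (θ x)) =
      fun x => Polynomial.X ^ w x * q x := by
    funext x
    obtain ⟨b, k⟩ := x
    by_cases hk : k = 0
    · subst hk
      by_cases hb : b ∈ H
      · simp [w, q, hb, hαH b hb]
      · simp [w, q, hb, hα' b hb]
    · simp [w, q, hk, θ, hβ' b, mul_assoc]
  rw [hcurve] at hzero
  have hcoeff := coeff_aeval_curve w q u d hdw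
  rw [hzero, Polynomial.coeff_zero] at hcoeff
  refine hηu ?_
  rw [hu', map_sum, hcoeff]
  refine Finset.sum_congr rfl fun s hs => ?_
  obtain ⟨hs, hsd⟩ := Finset.mem_filter.1 hs
  rw [eval_monomial, Finsupp.prod_fintype _ _ (by simp)]
  congr 1
  refine Finset.prod_congr rfl fun x _ => ?_
  obtain ⟨b, k⟩ := x
  by_cases hk : k = 0
  · subst hk
    by_cases hb : b ∈ H
    · simp [q, hb]
    · simp [hvanish s hs hsd b hb]
  · simp [q, hk, Polynomial.mul_coeff_zero, hβ'0]

end ColumnGraded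


section Counting

variable {K : Type} [Field K] {v : ℕ} {n : Fin v → ℕ} {m : ℕ}

/-- The exponents of the monomials of total degree at most `D`. -/
def degreeLE (σ : Type*) [Finite σ] (D : ℕ) : Finset (σ →₀ ℕ) :=
  (Finsupp.finite_of_degree_le D).toFinset

theorem mem_degreeLE {σ : Type*} [Finite σ] {D : ℕ} {s : σ →₀ ℕ} :
    s ∈ degreeLE σ D ↔ s.degree ≤ D := by
  simp [degreeLE]

theorem mem_restrictSupport_degreeLE {σ : Type*} [Finite σ] {D : ℕ} {p : MvPolynomial σ K} :
    p ∈ restrictSupport K (degreeLE σ D : Set (σ →₀ ℕ)) ↔ p.totalDegree ≤ D := by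
  rw [mem_restrictSupport_iff, totalDegree, Finset.sup_le_iff]
  exact forall₂_congr fun s _ => by rw [Finset.mem_coe, mem_degreeLE]; rfl

/-- Every linear order of finitely many variables is induced by a term order. -/
theorem exists_monomialOrder_single_lt {σ κ : Type} [Finite σ] [LinearOrder κ] (e : σ → κ)
    (he : Function.Injective e) :
    ∃ τ : MonomialOrder.{0, 0} σ, ∀ x y, e x < e y →
      τ.toSyn (Finsupp.single y 1) < τ.toSyn (Finsupp.single x 1) := by
  let : LinearOrder σ := LinearOrder.lift' e he
  exact ⟨MonomialOrder.lex, fun x y hxy => Finsupp.Lex.single_lt_iff.2 hxy⟩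

/-- There is a term order for which the first variable of each block is the largest one. -/
theorem exists_monomialOrder_first_largest (n : Fin v → ℕ) :
    ∃ τ : MonomialOrder.{0, 0} (MVar v n), ∀ b (k : Fin (n b + 1)), k ≠ 0 →
      τ.toSyn (Finsupp.single ⟨b, k⟩ 1) < τ.toSyn (Finsupp.single ⟨b, 0⟩ 1) := by
  have he : Function.Injective fun x : MVar v n => toLex ((x.2 : ℕ), (x.1 : ℕ)) := by
    rintro ⟨b, k⟩ ⟨b', k'⟩ h
    have h' := toLex.injective h
    simp only [Prod.mk.injEq] at h'
    obtain ⟨h1, h2⟩ := h'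
    obtain rfl := Fin.ext h2
    rw [Fin.ext h1]
  obtain ⟨τ, hτ⟩ := exists_monomialOrder_single_lt _ he
  refine ⟨τ, fun b k hk => hτ _ _ ?_⟩
  rw [Prod.Lex.toLex_lt_toLex]
  exact Or.inl (Fin.pos_iff_ne_zero.2 hk)

theorem degree_eq_sum_weight (s : MVar v n →₀ ℕ) :
    s.degree = ∑ b, Finsupp.weight (wt v n) s b := by
  simp only [weight_wt_apply]
  rw [Finsupp.degree_eq_sum, Fintype.sum_sigma]

theorem Tmono_apply (a : Fin v → ℕ) (x : MVar v n) :
    Tmono v n a x = if x.2 = 0 then a x.1 else 0 := by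
  obtain ⟨b, k⟩ := x
  rw [Tmono, Finsupp.finsetSum_apply, Finset.sum_eq_single b]
  · split_ifs with hk
    · obtain rfl : k = 0 := hk
      simp
    · rw [Finsupp.single_eq_of_ne]
      simpa using hk
  · intro b' _ hb
    rw [Finsupp.single_eq_of_ne]
    intro h
    exact hb (congrArg Sigma.fst h).symm
  · simp

theorem weight_Tmono (a : Fin v → ℕ) : Finsupp.weight (wt v n) (Tmono v n a) = a := by
  rw [Tmono, map_sum]
  ext b
  simp [Finsupp.weight_apply, wt, Pi.single_apply]

/-- The substitution `X ⟨b, k⟩ ↦ X ⟨b, 0⟩ + X ⟨b, k⟩` for `k ≠ 0`. -/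
def shear (v : ℕ) (n : Fin v → ℕ) (K : Type) [Field K] :
    MvPolynomial (MVar v n) K →ₐ[K] MvPolynomial (MVar v n) K :=
  aeval fun x => if x.2 = 0 then X x else X ⟨x.1, 0⟩ + X x

/-- The substitution inverse to `shear`. -/
def unshear (v : ℕ) (n : Fin v → ℕ) (K : Type) [Field K] :
    MvPolynomial (MVar v n) K →ₐ[K] MvPolynomial (MVar v n) K :=
  aeval fun x => if x.2 = 0 then X x else X x - X ⟨x.1, 0⟩

theorem shear_unshear (p : MvPolynomial (MVar v n) K) : shear v n K (unshear v n K p) = p := by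
  rw [← AlgHom.comp_apply, ← AlgHom.id_apply (R := K) p]
  congr 1
  refine algHom_ext fun x => ?_
  by_cases hx : x.2 = 0 <;> simp [shear, unshear, hx]

theorem totalDegree_unshear_le (p : MvPolynomial (MVar v n) K) :
    (unshear v n K p).totalDegree ≤ p.totalDegree := by
  refine totalDegree_aeval_le_of_linear _ (fun x => ?_) p
  split_ifs
  · exact (totalDegree_X x).le
  · exact (totalDegree_sub _ _).trans (by simp)

theorem degree_shear_monomial {τ : MonomialOrder (MVar v n)}
    (hτ : ∀ b (k : Fin (n b + 1)), k ≠ 0 →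
      τ.toSyn (Finsupp.single ⟨b, k⟩ 1) < τ.toSyn (Finsupp.single ⟨b, 0⟩ 1))
    (l : MVar v n →₀ ℕ) :
    shear v n K (monomial l 1) ≠ 0 ∧
      τ.degree (shear v n K (monomial l 1)) = Tmono v n (Finsupp.weight (wt v n) l) := by
  classical
  have hX : ∀ x : MVar v n, shear v n K (X x) ≠ 0 ∧
      τ.degree (shear v n K (X x)) = Finsupp.single ⟨x.1, 0⟩ 1 := by
    rintro ⟨b, k⟩
    by_cases hk : k = 0
    · subst hk
      simp [shear, τ.degree_X]
    · have hdeg : τ.degree (shear v n K (X ⟨b, k⟩)) = Finsupp.single ⟨b, 0⟩ 1 := by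
        rw [shear, aeval_X, if_neg hk, τ.degree_add_of_lt, τ.degree_X]
        rw [τ.degree_X, τ.degree_X]
        exact hτ b k hk
      refine ⟨fun h => ?_, hdeg⟩
      rw [h, τ.degree_zero] at hdeg
      exact one_ne_zero (Finsupp.single_eq_zero.1 hdeg.symm)
  have hmon : shear v n K (monomial l 1) = ∏ x, shear v n K (X x) ^ l x := by
    rw [monomial_eq, C_1, one_mul, Finsupp.prod_fintype _ _ (by simp), map_prod]
    simp only [map_pow]
  have hne : ∀ x ∈ Finset.univ, shear v n K (X x) ^ l x ≠ 0 := fun x _ => pow_ne_zero _ (hX x).1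
  rw [hmon]
  refine ⟨Finset.prod_ne_zero_iff.2 hne, ?_⟩
  rw [τ.degree_prod hne, Fintype.sum_sigma, Tmono]
  refine Finset.sum_congr rfl fun b _ => ?_
  rw [weight_wt_apply, Finsupp.single_finsetSum]
  refine Finset.sum_congr rfl fun k _ => ?_
  rw [τ.degree_pow, (hX _).2, Finsupp.smul_single_one]

variable {A : Matrix (Fin m) (Fin v) (MvPolynomial (MVar v n) K)}

/-- Exponents divisible by the leading exponent of a nonzero maximal minor. -/
def LeadDivisible (τ : MonomialOrder (MVar v n))
    (A : Matrix (Fin m) (Fin v) (MvPolynomial (MVar v n) K)) (s : MVar v n →₀ ℕ) : Prop :=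
  ∃ c, colMinor A c ≠ 0 ∧ leadExp τ (colMinor A c) ≤ s

theorem weight_leadExp_colMinor (τ : MonomialOrder (MVar v n))
    (hA : ∀ i j, (A i j).IsWeightedHomogeneous (wt v n) (Pi.single j 1)) {c : Fin m → Fin v}
    (hc : colMinor A c ≠ 0) :
    Finsupp.weight (wt v n) (leadExp τ (colMinor A c)) = ∑ r, Pi.single (c r) 1 :=
  colMinor_isWeightedHomogeneous hA c ((τ.coeff_degree_ne_zero_iff).2 hc)

theorem totalDegree_colMinor_le (τ : MonomialOrder (MVar v n))
    (hA : ∀ i j, (A i j).IsWeightedHomogeneous (wt v n) (Pi.single j 1)) {c : Fin m → Fin v}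
    (hc : colMinor A c ≠ 0) :
    (colMinor A c).totalDegree ≤ (leadExp τ (colMinor A c)).degree := by
  refine Finset.sup_le fun s hs => ?_
  change s.degree ≤ _
  rw [degree_eq_sum_weight, degree_eq_sum_weight, weight_leadExp_colMinor τ hA hc,
    colMinor_isWeightedHomogeneous hA c (mem_support_iff.1 hs)]

open Classical in
/-- In bounded degree, there are at least as many exponents divisible by a leading exponent of a
minor as there are exponents with spanning special support. -/
theorem card_specialSpanning_le (τ : MonomialOrder (MVar v n))
    (hA : ∀ i j, (A i j).IsWeightedHomogeneous (wt v n) (Pi.single j 1)) (D : ℕ) :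
    ((degreeLE (MVar v n) D).filter (SpecialSpanning A)).card ≤
      ((degreeLE (MVar v n) D).filter (LeadDivisible τ A)).card := by
  obtain ⟨τ', hτ'⟩ := exists_monomialOrder_first_largest n
  set W := restrictSupport K
    (((degreeLE (MVar v n) D).filter (LeadDivisible τ A) : Finset _) : Set (MVar v n →₀ ℕ))
  have : FiniteDimensional K W := finiteDimensional_restrictSupport _
  refine (card_le_finrank_of_degree τ' (W.map (shear v n K).toLinearMap) _ ?_).trans
    ((Submodule.finrank_map_le _ _).trans (finrank_restrictSupport _).le)
  intro s hs
  obtain ⟨hsD, c, hc, hcs⟩ := Finset.mem_filter.1 hs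
  rw [mem_degreeLE] at hsD
  set l := leadExp τ (colMinor A c)
  have hl : Finsupp.weight (wt v n) l = ∑ r, Pi.single (c r) 1 := weight_leadExp_colMinor τ hA hc
  set e := Tmono v n (Finsupp.weight (wt v n) l) with he
  have hes : e ≤ s := by
    rintro ⟨b, k⟩
    rw [he, Tmono_apply, hl, Finset.sum_apply]
    split_ifs with hk
    · obtain rfl : k = 0 := hk
      by_cases hb : ∃ r, c r = b
      · obtain ⟨r, rfl⟩ := hb
        rw [Finset.sum_eq_single r _ (by simp), Pi.single_eq_same]
        · exact Nat.one_le_iff_ne_zero.2 (hcs r)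
        · intro r' _ hr'
          exact Pi.single_eq_of_ne (fun h => hr' (colMinor_injective hc h.symm)) _
      · rw [Finset.sum_eq_zero]
        · exact Nat.zero_le _
        · intro r _
          exact Pi.single_eq_of_ne (fun h => hb ⟨r, h.symm⟩) _
    · exact Nat.zero_le _
  have hdeg : l.degree + (s - e).degree = s.degree := by
    conv_rhs => rw [← add_tsub_cancel_of_le hes, map_add]
    rw [degree_eq_sum_weight l, degree_eq_sum_weight e, weight_Tmono]
  obtain ⟨hne, hlead⟩ := degree_shear_monomial (K := K) hτ' l
  have hmap : shear v n K (monomial l 1 * unshear v n K (monomial (s - e) 1)) =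
      shear v n K (monomial l 1) * monomial (s - e) 1 := by
    rw [map_mul, shear_unshear]
  have hne' : (monomial (s - e) 1 : MvPolynomial (MVar v n) K) ≠ 0 := by simp
  refine ⟨_, ⟨monomial l 1 * unshear v n K (monomial (s - e) 1), ?_, rfl⟩, ?_, ?_⟩
  · have hD : monomial l 1 * unshear v n K (monomial (s - e) 1) ∈
        restrictSupport K (degreeLE (MVar v n) D : Set (MVar v n →₀ ℕ)) := by
      rw [mem_restrictSupport_degreeLE]
      refine (totalDegree_mul _ _).trans (le_trans ?_ (hdeg.trans_le hsD))
      exact add_le_add (totalDegree_monomial_le _ _)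
        ((totalDegree_unshear_le _).trans (totalDegree_monomial_le _ _))
    refine (mem_restrictSupport_iff K).2 fun t ht => Finset.mem_filter.2 ⟨hD ht, c, hc, ?_⟩
    by_contra hle
    refine mem_support_iff.1 (Finset.mem_coe.1 ht) ?_
    rw [coeff_monomial_mul', if_neg hle]
  · change shear v n K _ ≠ 0
    rw [hmap]
    exact mul_ne_zero hne hne'
  · change τ'.degree (shear v n K _) = s
    rw [hmap, τ'.degree_mul hne hne', hlead, τ'.degree_monomial, if_neg one_ne_zero]
    exact add_tsub_cancel_of_le hes

open Classical in
theorem finrank_le_card_specialSpanning [Infinite K]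
    (hA : ∀ i j, (A i j).IsWeightedHomogeneous (wt v n) (Pi.single j 1)) (D : ℕ) :
    Module.finrank K
      ((Ideal.span (Set.range (colMinor A))).restrictScalars K ⊓
        restrictSupport K (degreeLE (MVar v n) D : Set (MVar v n →₀ ℕ)) : Submodule K _) ≤
      ((degreeLE (MVar v n) D).filter (SpecialSpanning A)).card := by
  obtain ⟨ω, hω⟩ : ∃ ω : MVar v n → K,
      eval ω ((∏ c with colMinor A c ≠ 0, colMinor A c) * ∏ b : Fin v, X ⟨b, 0⟩) ≠ 0 := by
    by_contra! h
    refine mul_ne_zero (Finset.prod_ne_zero_iff.2 fun c hc => (Finset.mem_filter.1 hc).2)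
      (Finset.prod_ne_zero_iff.2 fun b _ => X_ne_zero (⟨b, 0⟩ : MVar v n))
      (MvPolynomial.funext fun x => by rw [h x, map_zero])
  rw [map_mul, map_prod, map_prod] at hω
  have hω0 : ∀ b, ω ⟨b, 0⟩ ≠ 0 := fun b => by
    simpa using Finset.prod_ne_zero_iff.1 (right_ne_zero_of_mul hω) b (Finset.mem_univ b)
  have hωA : ∀ c, colMinor A c ≠ 0 → eval ω (colMinor A c) ≠ 0 := fun c hc =>
    Finset.prod_ne_zero_iff.1 (left_ne_zero_of_mul hω) c (by simp [hc])
  refine finrank_le_card_filter _ _ _ inf_le_right (recenter ω).toLinearMap ?_ ?_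
  · intro u hu
    rw [mem_restrictSupport_degreeLE] at hu ⊢
    refine (totalDegree_aeval_le_of_linear _ (fun x => ?_) u).trans hu
    split_ifs
    · exact (totalDegree_mul _ _).trans (by simp)
    · refine (totalDegree_sub _ _).trans (max_le (totalDegree_X x).le ?_)
      exact (totalDegree_mul _ _).trans (by rw [totalDegree_C, totalDegree_X])
  · intro u hu hmem
    exact eq_zero_of_recenter_mem hA hω0 hωA u
      (fun s hs => (Finset.mem_filter.1 (hu hs)).2) hmem.1

/-- Every leading exponent of the ideal of maximal minors is divisible by the leading exponent of
a maximal minor. -/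
theorem leadDivisible_leadExp [Infinite K] (τ : MonomialOrder (MVar v n))
    (hA : ∀ i j, (A i j).IsWeightedHomogeneous (wt v n) (Pi.single j 1))
    {f : MvPolynomial (MVar v n) K} (hf : f ∈ Ideal.span (Set.range (colMinor A)))
    (hf0 : f ≠ 0) : LeadDivisible τ A (leadExp τ f) := by
  classical
  by_contra hdiv
  set D := f.totalDegree
  set W : Submodule K (MvPolynomial (MVar v n) K) :=
    (Ideal.span (Set.range (colMinor A))).restrictScalars K ⊓
      restrictSupport K (degreeLE (MVar v n) D : Set (MVar v n →₀ ℕ))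
  have := finiteDimensional_restrictSupport (F := K) (degreeLE (MVar v n) D)
  have : FiniteDimensional K W := Submodule.finiteDimensional_of_le inf_le_right
  have hcard := card_le_finrank_of_degree τ W
    (insert (leadExp τ f) ((degreeLE (MVar v n) D).filter (LeadDivisible τ A))) (by
      intro s hs
      rcases Finset.mem_insert.1 hs with rfl | hs
      · exact ⟨f, ⟨hf, mem_restrictSupport_degreeLE.2 le_rfl⟩, hf0, rfl⟩
      · obtain ⟨hsD, c, hc, hcs⟩ := Finset.mem_filter.1 hs
        rw [mem_degreeLE] at hsD
        have hne : (monomial (s - leadExp τ (colMinor A c)) 1 : MvPolynomial (MVar v n) K) ≠ 0 := by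
          simp
        refine ⟨monomial (s - leadExp τ (colMinor A c)) 1 * colMinor A c,
          ⟨Ideal.mul_mem_left _ _ (Ideal.subset_span ⟨c, rfl⟩), ?_⟩, mul_ne_zero hne hc, ?_⟩
        · refine mem_restrictSupport_degreeLE.2 ?_
          refine (totalDegree_mul _ _).trans ((add_le_add (totalDegree_monomial_le _ _)
            (totalDegree_colMinor_le τ hA hc)).trans (le_of_eq_of_le ?_ hsD))
          conv_rhs => rw [← tsub_add_cancel_of_le hcs, map_add]
          rfl
        · rw [τ.degree_mul hne hc, τ.degree_monomial, if_neg one_ne_zero]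
          exact tsub_add_cancel_of_le hcs)
  rw [Finset.card_insert_of_notMem fun h => hdiv (Finset.mem_filter.1 h).2] at hcard
  exact Nat.not_succ_le_self _
    (hcard.trans ((finrank_le_card_specialSpanning hA D).trans (card_specialSpanning_le τ hA D)))

end Counting

section Padding

variable {K : Type} [Field K] {v : ℕ} {n : Fin v → ℕ} {m N : ℕ}

/-- The matrix obtained from `A` by appending zero columns. -/
def padColumns (A : Matrix (Fin m) (Fin N) (MvPolynomial (MVar v n) K)) :
    Matrix (Fin m) (Fin v) (MvPolynomial (MVar v n) K) :=
  Matrix.of fun i j => if hj : (j : ℕ) < N then A i ⟨j, hj⟩ else 0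

variable {A : Matrix (Fin m) (Fin N) (MvPolynomial (MVar v n) K)}

theorem padColumns_isWeightedHomogeneous (hA : ColumnGraded A) (i : Fin m)
    (j : Fin v) : (padColumns A i j).IsWeightedHomogeneous (wt v n) (Pi.single j 1) := by
  obtain ⟨h, hA⟩ := hA
  rw [padColumns, Matrix.of_apply]
  split_ifs with hj
  · rcases hA i ⟨j, hj⟩ with h0 | h0
    · rw [h0]
      exact isWeightedHomogeneous_zero _ _ _
    · exact h0
  · exact isWeightedHomogeneous_zero _ _ _

theorem colMinor_padColumns_mem_minorsSet {c : Fin m → Fin v}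
    (hc : colMinor (padColumns A) c ≠ 0) : colMinor (padColumns A) c ∈ minorsSet m A := by
  have hN : ∀ r, (c r : ℕ) < N := by
    intro r
    by_contra hr
    exact hc (Matrix.det_eq_zero_of_column_eq_zero r fun i => by simp [padColumns, hr])
  refine ⟨id, fun r => ⟨c r, hN r⟩, Function.injective_id, fun r s hrs => ?_, ?_⟩
  · exact colMinor_injective hc (Fin.ext (by simpa using hrs))
  · rw [colMinor]
    congr 1
    ext1 i r
    simp [padColumns, hN r]

theorem minorsIdeal_le_span_colMinor (hA : ColumnGraded A) :
    minorsIdeal m A ≤ Ideal.span (Set.range (colMinor (padColumns A))) := by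
  obtain ⟨h, -⟩ := hA
  rw [minorsIdeal, Ideal.span_le]
  rintro _ ⟨r, c, hr, -, rfl⟩
  have hpad : A.submatrix r c = ((padColumns A).submatrix id (Fin.castLE h ∘ c)).submatrix
      (Equiv.ofBijective r (Finite.injective_iff_bijective.1 hr)) id := by
    ext1 i j
    simp [padColumns]
  rw [hpad, Matrix.det_permute]
  exact Ideal.mul_mem_left _ _ (Ideal.subset_span ⟨_, rfl⟩)

end Padding

/-- **Main Theorem (2), column-graded case.** If `A` is a column-graded `m × n` matrix of
linear forms with `m ≤ n`, then the set of maximal minors of `A` is a Gröbner basis of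
`I_m(A)` with respect to every term order. -/
theorem maximal_minors_universal_groebner_basis
    {K : Type} [Field K] [Infinite K] {v : ℕ} {n : Fin v → ℕ} {m N : ℕ} (hmn : m ≤ N)
    (A : Matrix (Fin m) (Fin N) (MvPolynomial (MVar v n) K))
    (hA : ColumnGraded A) :
    ∀ τ : MonomialOrder (MVar v n),
      IsGroebnerBasis τ (minorsSet m A) (minorsIdeal m A) := by
  intro τ
  refine ⟨Ideal.subset_span, le_antisymm ?_ ?_⟩
  · refine Ideal.span_mono ?_
    rintro _ ⟨f, ⟨hf, hf0⟩, rfl⟩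
    exact ⟨f, Ideal.subset_span hf, hf0, rfl⟩
  · rw [inIdeal, Ideal.span_le]
    rintro _ ⟨f, hf, hf0, rfl⟩
    obtain ⟨c, hc, hle⟩ := leadDivisible_leadExp τ (padColumns_isWeightedHomogeneous hA)
      (minorsIdeal_le_span_colMinor hA hf) hf0
    have hmul : (monomial (leadExp τ f) (1 : K)) =
        monomial (leadExp τ f - leadExp τ (colMinor (padColumns A) c)) 1 *
          monomial (leadExp τ (colMinor (padColumns A) c)) 1 := by
      rw [monomial_mul, one_mul, tsub_add_cancel_of_le hle]
    rw [hmul]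
    exact Ideal.mul_mem_left _ _
      (Ideal.subset_span ⟨_, ⟨colMinor_padColumns_mem_minorsSet hc, hc⟩, rfl⟩)

end
end

section
/- Let A be a row-graded m×n matrix of linear forms over S with m ≤ n. Then the ideal I_m(A) of maximal minors of A has a universal Gröbner basis consisting of Z^m-homogeneous elements all of multidegree equal to e_1+e_2+...+e_m = (1,1,...,1) ∈ Z^m. -/
open MvPolynomial

noncomputable section

open CSPaper

namespace MonoComb

open Finset Function

section Compression
variable {σ : Type} [DecidableEq σ]

/-- The point with `p`-coordinate `s` on the fibre through `u` along which the sum of the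
coordinates at `p` and `q` is constant. -/
def fib (p q : σ) (u : σ → ℕ) (s : ℕ) : σ → ℕ :=
  update (update u p s) q (u p + u q - s)

open Classical in
/-- The positions on the fibre through `u` that belong to `H`. -/
noncomputable def fibSet (p q : σ) (H : Set (σ → ℕ)) (u : σ → ℕ) : Finset ℕ :=
  (range (u p + u q + 1)).filter fun s => fib p q u s ∈ H

/-- The compression of `H`: every fibre of `H` is replaced by an initial segment of the same
cardinality. -/
def compress (p q : σ) (H : Set (σ → ℕ)) : Set (σ → ℕ) :=
  {u | u p < (fibSet p q H u).card}

lemma mem_fibSet {p q : σ} {H : Set (σ → ℕ)} {u : σ → ℕ} {s : ℕ} :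
    s ∈ fibSet p q H u ↔ s ≤ u p + u q ∧ fib p q u s ∈ H := by
  classical
  simp [fibSet]

lemma card_fibSet_le (p q : σ) (H : Set (σ → ℕ)) (u : σ → ℕ) :
    (fibSet p q H u).card ≤ u p + u q + 1 := by
  classical
  exact (card_filter_le _ _).trans (by simp)

lemma fib_p {p q : σ} (h : p ≠ q) (u : σ → ℕ) (s : ℕ) : fib p q u s p = s := by
  simp [fib, h]

lemma fib_q (p q : σ) (u : σ → ℕ) (s : ℕ) : fib p q u s q = u p + u q - s := by
  simp [fib]

lemma fib_of_ne {p q x : σ} (hp : x ≠ p) (hq : x ≠ q) (u : σ → ℕ) (s : ℕ) :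
    fib p q u s x = u x := by
  simp [fib, hp, hq]

lemma fib_fib {p q : σ} (h : p ≠ q) (u : σ → ℕ) {s : ℕ} (hs : s ≤ u p + u q) (t : ℕ) :
    fib p q (fib p q u s) t = fib p q u t := by
  funext x
  by_cases hq : x = q
  · subst hq
    rw [fib_q, fib_q, fib_p h, fib_q]; omega
  · by_cases hp : x = p
    · subst hp; rw [fib_p h, fib_p h]
    · rw [fib_of_ne hp hq, fib_of_ne hp hq, fib_of_ne hp hq]

lemma fib_self {p q : σ} (h : p ≠ q) (u : σ → ℕ) : fib p q u (u p) = u := by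
  funext x
  by_cases hq : x = q
  · subst hq; rw [fib_q]; omega
  · by_cases hp : x = p
    · subst hp; rw [fib_p h]
    · rw [fib_of_ne hp hq]

lemma fibSet_fib {p q : σ} (h : p ≠ q) (H : Set (σ → ℕ)) (u : σ → ℕ) {s : ℕ}
    (hs : s ≤ u p + u q) : fibSet p q H (fib p q u s) = fibSet p q H u := by
  ext t
  rw [mem_fibSet, mem_fibSet, fib_fib h u hs, fib_p h, fib_q]
  have : s + (u p + u q - s) = u p + u q := by omega
  rw [this]

lemma fibSet_mono (p q : σ) {H H' : Set (σ → ℕ)} (h : H ⊆ H') (u : σ → ℕ) :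
    fibSet p q H u ⊆ fibSet p q H' u := fun s hs => by
  rw [mem_fibSet] at hs ⊢
  exact ⟨hs.1, h hs.2⟩

lemma compress_mono (p q : σ) {H H' : Set (σ → ℕ)} (h : H ⊆ H') :
    compress p q H ⊆ compress p q H' := fun u hu =>
  lt_of_lt_of_le hu (card_le_card (fibSet_mono p q h u))

lemma fibSet_compress {p q : σ} (h : p ≠ q) (H : Set (σ → ℕ)) (u : σ → ℕ) :
    fibSet p q (compress p q H) u = range (fibSet p q H u).card := by
  ext s
  rw [mem_fibSet, mem_range]
  constructor
  · rintro ⟨hs, hm⟩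
    have hm' : fib p q u s p < (fibSet p q H (fib p q u s)).card := hm
    rwa [fibSet_fib h H u hs, fib_p h] at hm'
  · intro hs
    have hs' : s ≤ u p + u q := by
      have := card_fibSet_le p q H u
      omega
    refine ⟨hs', ?_⟩
    change fib p q u s p < (fibSet p q H (fib p q u s)).card
    rwa [fibSet_fib h H u hs', fib_p h]

lemma isUpperSet_of_add_single [Fintype σ] {H : Set (σ → ℕ)}
    (hH : ∀ u ∈ H, ∀ x, u + Pi.single x 1 ∈ H) : IsUpperSet H := by
  have key : ∀ n : ℕ, ∀ u v : σ → ℕ, u ≤ v → ∑ x, (v x - u x) = n → u ∈ H → v ∈ H := by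
    intro n
    induction n with
    | zero =>
      intro u v huv hn hu
      have : v = u := by
        funext x
        have h0 : v x - u x = 0 := (sum_eq_zero_iff.mp hn) x (mem_univ x)
        have h1 : u x ≤ v x := huv x
        omega
      rwa [this]
    | succ n ih =>
      intro u v huv hn hu
      obtain ⟨x, -, hx⟩ : ∃ x ∈ (univ : Finset σ), v x - u x ≠ 0 :=
        exists_ne_zero_of_sum_ne_zero (by omega)
      refine ih (u + Pi.single x 1) v ?_ ?_ (hH u hu x)
      · intro y
        by_cases hy : y = x
        · subst hy
          change (u + Pi.single y 1 : σ → ℕ) y ≤ v y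
          rw [Pi.add_apply, Pi.single_eq_same]; omega
        · simpa [hy] using huv y
      · have h1 : ∑ y, (v y - u y) = ∑ y, (v y - (u + Pi.single x 1 : σ → ℕ) y) + 1 := by
          rw [← add_sum_erase _ _ (mem_univ x), ← add_sum_erase univ _ (mem_univ x)]
          have : ∑ y ∈ univ.erase x, (v y - u y) =
              ∑ y ∈ univ.erase x, (v y - (u + Pi.single x 1 : σ → ℕ) y) :=
            sum_congr rfl fun y hy => by simp [ne_of_mem_erase hy]
          rw [this]
          simp
          omega
        omega
  exact fun u v huv hu => key _ u v huv rfl hu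

lemma isUpperSet_compress [Fintype σ] {p q : σ} (h : p ≠ q) {H : Set (σ → ℕ)}
    (hH : IsUpperSet H) : IsUpperSet (compress p q H) := by
  refine isUpperSet_of_add_single fun u hu x => ?_
  change u p < (fibSet p q H u).card at hu
  change (u + Pi.single x 1 : σ → ℕ) p < (fibSet p q H (u + Pi.single x 1)).card
  have up : ∀ s t : ℕ, fib p q u s ≤ fib p q (u + Pi.single x 1) t →
      s ≤ u p + u q → fib p q u s ∈ H →
      t ≤ (u + Pi.single x 1 : σ → ℕ) p + (u + Pi.single x 1 : σ → ℕ) q →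
      t ∈ fibSet p q H (u + Pi.single x 1) := fun s t hle _ hm ht =>
    mem_fibSet.mpr ⟨ht, hH hle hm⟩
  have same : ∀ s, s ∈ fibSet p q H u → s ∈ fibSet p q H (u + Pi.single x 1) := by
    intro s hs
    rw [mem_fibSet] at hs
    refine up s s ?_ hs.1 hs.2 ?_
    · intro y
      by_cases hq : y = q
      · subst hq
        rw [fib_q, fib_q]
        simp only [Pi.add_apply]; omega
      · by_cases hp : y = p
        · subst hp; rw [fib_p h, fib_p h]
        · rw [fib_of_ne hp hq, fib_of_ne hp hq]; simp
    · simp only [Pi.add_apply]; omega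
  by_cases hxp : x = p
  · subst hxp
    have hsucc : ∀ s, s ∈ fibSet x q H u → s + 1 ∈ fibSet x q H (u + Pi.single x 1) := by
      intro s hs
      rw [mem_fibSet] at hs
      refine up s (s + 1) ?_ hs.1 hs.2 ?_
      · intro y
        by_cases hq : y = q
        · subst hq
          change fib x y u s y ≤ fib x y (u + Pi.single x 1) (s + 1) y
          rw [fib_q, fib_q, Pi.add_apply, Pi.add_apply, Pi.single_eq_same,
            Pi.single_eq_of_ne h.symm]
          omega
        · by_cases hp : y = x
          · subst hp; rw [fib_p h, fib_p h]; exact Nat.le_succ s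
          · rw [fib_of_ne hp hq, fib_of_ne hp hq]; simp
      · simp [Pi.single_apply]; omega
    have hne : (fibSet x q H u).Nonempty := card_pos.mp (by omega)
    have hsub : insert ((fibSet x q H u).max' hne + 1) (fibSet x q H u) ⊆
        fibSet x q H (u + Pi.single x 1) := by
      intro s hs
      rcases mem_insert.mp hs with rfl | hs
      · exact hsucc _ (max'_mem _ _)
      · exact same s hs
    have hnot : (fibSet x q H u).max' hne + 1 ∉ fibSet x q H u := fun hc => by
      have := le_max' _ _ hc
      omega
    have := card_le_card hsub
    rw [card_insert_of_notMem hnot] at this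
    simp; omega
  · have h1 : (u + Pi.single x 1 : σ → ℕ) p = u p := by simp [Ne.symm hxp]
    rw [h1]
    exact lt_of_lt_of_le hu (card_le_card same)

open Classical in
lemma sum_eq_sum_fibSet {p q : σ} (h : p ≠ q) (H : Set (σ → ℕ)) {B : Finset (σ → ℕ)}
    (hB : ∀ u ∈ B, ∀ s ≤ u p + u q, fib p q u s ∈ B) (F : (σ → ℕ) → ℕ) :
    ∑ u ∈ B with u ∈ H, F u =
      ∑ w ∈ B with w p = 0, ∑ s ∈ fibSet p q H w, F (fib p q w s) := by
  rw [sum_sigma']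
  refine sum_bij' (fun u _ => (⟨fib p q u 0, u p⟩ : Σ _ : σ → ℕ, ℕ))
    (fun x _ => fib p q x.1 x.2) ?_ ?_ ?_ ?_ ?_
  · intro u hu
    rw [mem_filter] at hu
    rw [mem_sigma, mem_filter, fibSet_fib h H u (Nat.zero_le _), mem_fibSet, fib_self h]
    exact ⟨⟨hB u hu.1 0 (Nat.zero_le _), fib_p h u 0⟩, by simp, hu.2⟩
  · rintro ⟨w, s⟩ hx
    rw [mem_sigma, mem_filter, mem_fibSet] at hx
    rw [mem_filter]
    exact ⟨hB w hx.1.1 s hx.2.1, hx.2.2⟩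
  · intro u hu
    change fib p q (fib p q u 0) (u p) = u
    rw [fib_fib h u (Nat.zero_le _), fib_self h]
  · rintro ⟨w, s⟩ hx
    rw [mem_sigma, mem_filter, mem_fibSet] at hx
    have hw : w p = 0 := hx.1.2
    have e1 : fib p q (fib p q w s) 0 = w := by
      rw [fib_fib h w hx.2.1]
      conv_lhs => rw [← hw]
      rw [fib_self h]
    have e2 : fib p q w s p = s := fib_p h w s
    simp only [e1, e2]
  · intro u hu
    change F u = F (fib p q (fib p q u 0) (u p))
    rw [fib_fib h u (Nat.zero_le _), fib_self h]

open Classical in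
lemma card_compress {p q : σ} (h : p ≠ q) (H : Set (σ → ℕ)) {B : Finset (σ → ℕ)}
    (hB : ∀ u ∈ B, ∀ s ≤ u p + u q, fib p q u s ∈ B) :
    (B.filter (· ∈ compress p q H)).card = (B.filter (· ∈ H)).card := by
  rw [card_eq_sum_ones, card_eq_sum_ones, sum_eq_sum_fibSet h _ hB (fun _ => 1),
    sum_eq_sum_fibSet h _ hB (fun _ => 1)]
  refine sum_congr rfl fun w _ => ?_
  rw [fibSet_compress h]
  simp

lemma sum_range_card_lt {A : Finset ℕ} (hA : A ≠ range A.card) :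
    ∑ s ∈ range A.card, s < ∑ s ∈ A, s := by
  have hc : (A \ range A.card).card = (range A.card \ A).card := by
    have h1 := card_sdiff_add_card_inter A (range A.card)
    have h2 := card_sdiff_add_card_inter (range A.card) A
    rw [inter_comm, card_range] at h2
    omega
  have hpos : 0 < (A \ range A.card).card := by
    rw [card_pos, sdiff_nonempty]
    intro hsub
    exact hA (eq_of_subset_of_card_le hsub (by simp))
  have e1 : ∑ s ∈ A, s = ∑ s ∈ A \ range A.card, s + ∑ s ∈ A ∩ range A.card, s := by
    rw [add_comm, sum_inter_add_sum_sdiff]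
  have e2 : ∑ s ∈ range A.card, s =
      ∑ s ∈ range A.card \ A, s + ∑ s ∈ A ∩ range A.card, s := by
    rw [inter_comm, add_comm, sum_inter_add_sum_sdiff]
  have g1 : (A \ range A.card).card • A.card ≤ ∑ s ∈ A \ range A.card, s :=
    card_nsmul_le_sum _ _ _ fun s hs => by simpa using (mem_sdiff.mp hs).2
  have g2 : ∑ s ∈ range A.card \ A, (s + 1) ≤ (range A.card \ A).card • A.card :=
    sum_le_card_nsmul _ _ _ fun s hs => by
      have := mem_range.mp (mem_sdiff.mp hs).1
      omega
  rw [sum_add_distrib] at g2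
  simp only [sum_const, smul_eq_mul, mul_one] at g1 g2
  rw [hc] at g1 hpos
  omega

lemma sum_range_card_le (A : Finset ℕ) : ∑ s ∈ range A.card, s ≤ ∑ s ∈ A, s := by
  by_cases hA : A = range A.card
  · rw [← hA]
  · exact (sum_range_card_lt hA).le

lemma weight_fib [Fintype σ] {p q : σ} (h : p ≠ q) {ω : σ → ℕ} (hω : ω q ≤ ω p)
    {w : σ → ℕ} (hw : w p = 0) {s : ℕ} (hs : s ≤ w q) :
    ∑ x, fib p q w s x * ω x = ∑ x, w x * ω x + s * (ω p - ω q) := by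
  have hq : q ∈ (univ : Finset σ).erase p := by simp [h.symm]
  rw [← add_sum_erase _ _ (mem_univ p), ← add_sum_erase _ (fun x => w x * ω x) (mem_univ p),
    ← add_sum_erase _ _ hq, ← add_sum_erase _ (fun x => w x * ω x) hq,
    sum_congr rfl fun x hx => by
      rw [fib_of_ne (ne_of_mem_erase (mem_of_mem_erase hx)) (ne_of_mem_erase hx)],
    fib_p h, fib_q, hw]
  obtain ⟨a, ha⟩ := Nat.exists_eq_add_of_le hs
  obtain ⟨b, hb⟩ := Nat.exists_eq_add_of_le hω
  rw [ha, hb]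
  simp
  ring

open Classical in
lemma weight_compress_lt [Fintype σ] {p q : σ} (h : p ≠ q) {H : Set (σ → ℕ)}
    {B : Finset (σ → ℕ)} (hB : ∀ u ∈ B, ∀ s ≤ u p + u q, fib p q u s ∈ B)
    {ω : σ → ℕ} (hω : ω q < ω p) {w : σ → ℕ} (hwB : w + Pi.single p 1 ∈ B)
    (hp : w + Pi.single p 1 ∈ H) (hq : w + Pi.single q 1 ∉ H) :
    ∑ u ∈ B with u ∈ compress p q H, ∑ x, u x * ω x <
      ∑ u ∈ B with u ∈ H, ∑ x, u x * ω x := by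
  have key : ∀ G : Set (σ → ℕ), ∀ v : σ → ℕ, v p = 0 →
      ∑ s ∈ fibSet p q G v, ∑ x, fib p q v s x * ω x =
        (fibSet p q G v).card * ∑ x, v x * ω x + (∑ s ∈ fibSet p q G v, s) * (ω p - ω q) := by
    intro G v hv
    rw [sum_mul, card_eq_sum_ones, sum_mul, ← sum_add_distrib]
    refine sum_congr rfl fun s hs => ?_
    rw [mem_fibSet, hv, zero_add] at hs
    rw [weight_fib h hω.le hv hs.1, one_mul]
  have hδ : 0 < ω p - ω q := by omega
  rw [sum_eq_sum_fibSet h _ hB, sum_eq_sum_fibSet h _ hB]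
  refine sum_lt_sum ?_ ⟨fib p q (w + Pi.single p 1) 0, ?_, ?_⟩
  · intro v hv
    rw [key _ v (mem_filter.mp hv).2, key _ v (mem_filter.mp hv).2, fibSet_compress h, card_range]
    exact Nat.add_le_add_left (Nat.mul_le_mul_right _ (sum_range_card_le _)) _
  · rw [mem_filter]
    exact ⟨hB _ hwB 0 (Nat.zero_le _), fib_p h _ _⟩
  · have h0 := fib_p h (w + Pi.single p 1) 0
    rw [key _ _ h0, key _ _ h0, fibSet_compress h, card_range]
    refine Nat.add_lt_add_left (Nat.mul_lt_mul_of_pos_right (sum_range_card_lt ?_) hδ) _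
    rw [fibSet_fib h H _ (Nat.zero_le _)]
    have hup : (w + Pi.single p 1 : σ → ℕ) p = w p + 1 := by simp
    have huq : (w + Pi.single p 1 : σ → ℕ) q = w q := by simp [h.symm]
    have m1 : w p + 1 ∈ fibSet p q H (w + Pi.single p 1) := by
      have hs := fib_self h (w + Pi.single p 1)
      rw [hup] at hs
      rw [mem_fibSet, hs, hup, huq]
      exact ⟨by omega, hp⟩
    have m2 : w p ∉ fibSet p q H (w + Pi.single p 1) := by
      rw [mem_fibSet]
      rintro ⟨-, hm⟩
      refine hq ?_
      convert hm using 1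
      funext x
      by_cases hxq : x = q
      · subst hxq
        rw [fib_q, hup, huq]; simp; omega
      · by_cases hxp : x = p
        · subst hxp; rw [fib_p h]; simp [h]
        · rw [fib_of_ne hxp hxq]; simp [hxp, hxq]
    intro he
    rw [he, mem_range] at m1 m2
    omega

end Compression

section Rows
variable {m M : ℕ}

/-- The degree of the exponent `u` in the variables of each row. -/
def rdeg (u : Fin m × Fin M → ℕ) (i : Fin m) : ℕ := ∑ j, u (i, j)

/-- The exponents of row degree `d`. -/
def degSet (M : ℕ) (d : Fin m → ℕ) : Finset (Fin m × Fin M → ℕ) :=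
  (Fintype.piFinset fun x => range (d x.1 + 1)).filter fun u => rdeg u = d

/-- The exponents of total degree at most `D`. -/
def totalBox (m M D : ℕ) : Finset (Fin m × Fin M → ℕ) :=
  (Fintype.piFinset fun _ => range (D + 1)).filter fun u => ∑ i, rdeg u i ≤ D

open Classical in
/-- The number of elements of row degree `d` of `H`. -/
noncomputable def cnt (H : Set (Fin m × Fin M → ℕ)) (d : Fin m → ℕ) : ℕ :=
  ((degSet M d).filter (· ∈ H)).card

/-- Strong stability inside each row. -/
def Stable (H : Set (Fin m × Fin M → ℕ)) : Prop :=
  ∀ i (j k : Fin M), k < j → ∀ w : Fin m × Fin M → ℕ,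
    w + Pi.single (i, j) 1 ∈ H → w + Pi.single (i, k) 1 ∈ H

lemma le_rdeg (u : Fin m × Fin M → ℕ) (x : Fin m × Fin M) : u x ≤ rdeg u x.1 :=
  single_le_sum (f := fun j => u (x.1, j)) (fun _ _ => Nat.zero_le _) (mem_univ x.2)

lemma mem_degSet {d : Fin m → ℕ} {u : Fin m × Fin M → ℕ} : u ∈ degSet M d ↔ rdeg u = d := by
  rw [degSet, mem_filter, and_iff_right_iff_imp]
  rintro rfl
  rw [Fintype.mem_piFinset]
  exact fun x => mem_range.mpr (Nat.lt_succ_of_le (le_rdeg u x))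

lemma mem_totalBox {D : ℕ} {u : Fin m × Fin M → ℕ} :
    u ∈ totalBox m M D ↔ ∑ i, rdeg u i ≤ D := by
  rw [totalBox, mem_filter, and_iff_right_iff_imp]
  intro h
  rw [Fintype.mem_piFinset]
  intro x
  have h1 : rdeg u x.1 ≤ ∑ i, rdeg u i :=
    single_le_sum (f := rdeg u) (fun _ _ => Nat.zero_le _) (mem_univ x.1)
  exact mem_range.mpr (Nat.lt_succ_of_le ((le_rdeg u x).trans (h1.trans h)))

lemma sum_fib {τ : Type} [DecidableEq τ] [Fintype τ] {p q : τ} (h : p ≠ q) (u : τ → ℕ) {s : ℕ}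
    (hs : s ≤ u p + u q) : ∑ x, fib p q u s x = ∑ x, u x := by
  have hq : q ∈ (univ : Finset τ).erase p := by simp [h.symm]
  rw [← add_sum_erase _ _ (mem_univ p), ← add_sum_erase _ (fun x => u x) (mem_univ p),
    ← add_sum_erase _ _ hq, ← add_sum_erase _ (fun x => u x) hq, sum_congr rfl fun x hx =>
      fib_of_ne (ne_of_mem_erase (mem_of_mem_erase hx)) (ne_of_mem_erase hx) u s,
    fib_p h, fib_q]
  change s + (u p + u q - s + ∑ x ∈ (univ.erase p).erase q, u x) =
    u p + (u q + ∑ x ∈ (univ.erase p).erase q, u x)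
  omega

lemma rdeg_fib {i : Fin m} {j k : Fin M} (h : j ≠ k) (u : Fin m × Fin M → ℕ) {s : ℕ}
    (hs : s ≤ u (i, j) + u (i, k)) : rdeg (fib (i, j) (i, k) u s) = rdeg u := by
  funext i'
  by_cases hi : i' = i
  · subst hi
    rw [rdeg, rdeg, ← sum_fib h (fun l => u (i', l)) hs]
    refine sum_congr rfl fun l _ => ?_
    by_cases h1 : l = j
    · subst h1; rw [fib_p h, fib_p (by simpa using h)]
    · by_cases h2 : l = k
      · subst h2; rw [fib_q, fib_q]
      · rw [fib_of_ne h1 h2, fib_of_ne (by simpa using h1) (by simpa using h2)]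
  · exact sum_congr rfl fun l _ => fib_of_ne (by simp [hi]) (by simp [hi]) u s

lemma rdeg_add (u w : Fin m × Fin M → ℕ) : rdeg (u + w) = rdeg u + rdeg w := by
  funext i
  simp [rdeg, sum_add_distrib]

lemma rdeg_single (i : Fin m) (j : Fin M) (s : ℕ) :
    rdeg (Pi.single (i, j) s) = Pi.single i s := by
  funext i'
  by_cases hi : i' = i
  · subst hi
    simp [rdeg, Pi.single_apply]
  · simp [rdeg, hi]

lemma cnt_compress {i : Fin m} {j k : Fin M} (h : j ≠ k) (H : Set (Fin m × Fin M → ℕ))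
    (d : Fin m → ℕ) : cnt (compress (i, j) (i, k) H) d = cnt H d := by
  classical
  exact card_compress (by simpa using h) H fun u hu s hs => by
    rw [mem_degSet] at hu ⊢
    rw [rdeg_fib h u hs, hu]

/-- A nested pair of upper sets can be moved, keeping all row-degree counts, in such a way that
the larger set becomes strongly stable. -/
theorem exists_stable {H₀ H : Set (Fin m × Fin M → ℕ)} (u0 : IsUpperSet H₀) (u1 : IsUpperSet H)
    (h01 : H₀ ⊆ H) : ∃ P₀ P : Set (Fin m × Fin M → ℕ), IsUpperSet P₀ ∧ IsUpperSet P ∧ P₀ ⊆ P ∧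
      Stable P ∧ (∀ d, cnt P d = cnt H d) ∧ ∀ d, cnt P₀ d = cnt H₀ d := by
  classical
  let Cand : Set (Set (Fin m × Fin M → ℕ) × Set (Fin m × Fin M → ℕ)) :=
    {c | IsUpperSet c.1 ∧ IsUpperSet c.2 ∧ c.1 ⊆ c.2 ∧ (∀ d, cnt c.2 d = cnt H d) ∧
      ∀ d, cnt c.1 d = cnt H₀ d}
  have step : ∀ D : ℕ, ∃ c ∈ Cand, ∀ i (j k : Fin M), k < j → ∀ w : Fin m × Fin M → ℕ,
      w + Pi.single (i, j) 1 ∈ totalBox m M D →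
      w + Pi.single (i, j) 1 ∈ c.2 → w + Pi.single (i, k) 1 ∈ c.2 := by
    intro D
    let pot : Set (Fin m × Fin M → ℕ) × Set (Fin m × Fin M → ℕ) → ℕ := fun c =>
      ∑ u ∈ totalBox m M D with u ∈ c.2, ∑ x, u x * (x.2 : ℕ)
    obtain ⟨c, hc, hmin⟩ := WellFounded.has_min (InvImage.wf pot Nat.lt_wfRel.wf) Cand
      ⟨(H₀, H), u0, u1, h01, fun _ => rfl, fun _ => rfl⟩
    refine ⟨c, hc, fun i j k hkj w hwB hj => ?_⟩
    by_contra hk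
    have hne : ((i, j) : Fin m × Fin M) ≠ (i, k) := by simpa using hkj.ne'
    refine hmin (compress (i, j) (i, k) c.1, compress (i, j) (i, k) c.2)
      ⟨isUpperSet_compress hne hc.1, isUpperSet_compress hne hc.2.1, compress_mono _ _ hc.2.2.1,
        fun d => (cnt_compress hkj.ne' _ d).trans (hc.2.2.2.1 d),
        fun d => (cnt_compress hkj.ne' _ d).trans (hc.2.2.2.2 d)⟩ ?_
    refine weight_compress_lt (ω := fun x => (x.2 : ℕ)) hne (fun u hu s hs => ?_) hkj hwB hj hk
    rw [mem_totalBox] at hu ⊢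
    rwa [rdeg_fib hkj.ne' u hs]
  choose c hc hst using step
  have lim : ∀ (Q : ℕ → Set (Fin m × Fin M → ℕ)) (G : Set (Fin m × Fin M → ℕ)),
      (∀ D d, cnt (Q D) d = cnt G d) →
      ∀ d, cnt {u | ∀ᶠ D in Filter.hyperfilter ℕ, u ∈ Q D} d = cnt G d := by
    intro Q G hQ d
    have : ∀ᶠ D in (Filter.hyperfilter ℕ : Filter ℕ), ∀ u ∈ degSet M d,
        (u ∈ Q D ↔ ∀ᶠ D in Filter.hyperfilter ℕ, u ∈ Q D) := by
      rw [Filter.eventually_all_finset]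
      intro u _
      by_cases hu : ∀ᶠ D in Filter.hyperfilter ℕ, u ∈ Q D
      · filter_upwards [hu] with D hD
        simp [hD, hu]
      · filter_upwards [Ultrafilter.eventually_not.mpr hu] with D hD
        simp [hD, hu]
    obtain ⟨D, hD⟩ := this.exists
    rw [← hQ D d, cnt, cnt]
    congr 1
    exact filter_congr fun u hu => (hD u hu).symm
  refine ⟨{u | ∀ᶠ D in Filter.hyperfilter ℕ, u ∈ (c D).1},
    {u | ∀ᶠ D in Filter.hyperfilter ℕ, u ∈ (c D).2}, ?_, ?_, ?_, ?_,
    lim _ _ fun D => (hc D).2.2.2.1, lim _ _ fun D => (hc D).2.2.2.2⟩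
  · exact fun u v huv hu => hu.mono fun D hD => (hc D).1 huv hD
  · exact fun u v huv hu => hu.mono fun D hD => (hc D).2.1 huv hD
  · exact fun u hu => hu.mono fun D hD => (hc D).2.2.1 hD
  · intro i j k hkj w hw
    have hge : ∀ᶠ D in (Filter.hyperfilter ℕ : Filter ℕ),
        ∑ i', rdeg (w + Pi.single (i, j) 1) i' ≤ D :=
      Nat.hyperfilter_le_atTop (Filter.eventually_ge_atTop _)
    filter_upwards [hw, hge] with D h1 h2
    exact hst D i j k hkj w (mem_totalBox.mpr h2) h1

end Rows

section StableSets
variable {m M : ℕ}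

/-- The upper set generated by the exponents `∏ x_{i, a_i}` with `∑ (a_i + 1) ≤ N`. -/
def chainUpper (m M N : ℕ) : Set (Fin m × Fin M → ℕ) :=
  {u | ∃ a : Fin m → Fin M, (∀ i, 0 < u (i, a i)) ∧ ∑ i, ((a i : ℕ) + 1) ≤ N}

/-- `H` is generated by elements whose row degrees are at most `c`. -/
def GenBy (c : ℕ) (H : Set (Fin m × Fin M → ℕ)) : Prop :=
  ∀ u ∈ H, ∃ g ∈ H, g ≤ u ∧ ∀ i, rdeg g i ≤ c

/-- The exponent `u` only involves the first `y i` variables of row `i`. -/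
def SuppBelow (y : Fin m → ℕ) (u : Fin m × Fin M → ℕ) : Prop :=
  ∀ x, u x ≠ 0 → (x.2 : ℕ) < y x.1

open Classical in
/-- The number of exponents of row degree `d` outside `H` in the variables bounded by `y`. -/
noncomputable def cocnt (H : Set (Fin m × Fin M → ℕ)) (y d : Fin m → ℕ) : ℕ :=
  ((degSet M d).filter fun u => SuppBelow y u ∧ u ∉ H).card

lemma isUpperSet_chainUpper (m M N : ℕ) : IsUpperSet (chainUpper m M N) := by
  rintro u v huv ⟨a, ha, hs⟩
  exact ⟨a, fun i => (ha i).trans_le (huv _), hs⟩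

lemma stable_chainUpper (m M N : ℕ) : Stable (chainUpper m M N) := by
  rintro i j k hkj w ⟨a, ha, hs⟩
  by_cases hj : a i = j
  · refine ⟨update a i k, fun i' => ?_, le_trans (sum_le_sum fun i' _ => ?_) hs⟩
    · by_cases hi : i' = i
      · subst hi; simp
      · have := ha i'
        simpa [hi] using this
    · by_cases hi : i' = i
      · subst hi
        have : (k : ℕ) < j := hkj
        rw [update_self, hj]; omega
      · simp [hi]
  · refine ⟨a, fun i' => ?_, hs⟩
    have := ha i'
    by_cases hi : i' = i
    · subst hi
      have h2 : ((w + Pi.single (i', j) 1 : Fin m × Fin M → ℕ)) (i', a i') = w (i', a i') := by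
        simp [hj]
      rw [h2] at this
      exact this.trans_le (by simp)
    · simpa [hi] using this

lemma exists_le_mem_chainUpper {N : ℕ} {u : Fin m × Fin M → ℕ} (hu : u ∈ chainUpper m M N) :
    ∃ g ∈ chainUpper m M N, g ≤ u ∧ ∀ i, rdeg g i = 1 := by
  obtain ⟨a, ha, hs⟩ := hu
  refine ⟨fun x => if x.2 = a x.1 then 1 else 0, ⟨a, by simp, hs⟩, fun x => ?_, ?_⟩
  · by_cases hx : x.2 = a x.1
    · have h1 : 0 < u x := by
        have := ha x.1
        rwa [← hx] at this
      simp only [hx, if_true]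
      exact h1
    · simp [hx]
  · intro i
    simp [rdeg]

lemma genBy_chainUpper (m M N : ℕ) {c : ℕ} (hc : 1 ≤ c) : GenBy c (chainUpper m M N) := by
  intro u hu
  obtain ⟨g, hg, hgu, h1⟩ := exists_le_mem_chainUpper hu
  exact ⟨g, hg, hgu, fun i => (h1 i).trans_le hc⟩

/-- Dickson's lemma: every set of exponents is bounded below by elements of bounded degree. -/
lemma exists_genBy (H : Set (Fin m × Fin M → ℕ)) : ∃ c, 1 ≤ c ∧ GenBy c H := by
  have hfin : {u | Minimal (· ∈ H) u}.Finite :=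
    WellQuasiOrderedLE.finite_of_isAntichain (setOfPred_minimal_antichain _)
  obtain ⟨b, hb⟩ := (hfin.image rdeg).bddAbove
  refine ⟨∑ i, b i + 1, by omega, fun u hu => ?_⟩
  obtain ⟨g, hgu, hg⟩ := exists_minimal_le_of_wellFoundedLT (· ∈ H) u hu
  refine ⟨g, hg.prop, hgu, fun i => ?_⟩
  have h1 : rdeg g i ≤ b i := hb ⟨g, hg, rfl⟩ i
  have h2 : b i ≤ ∑ i, b i := single_le_sum (fun _ _ => Nat.zero_le _) (mem_univ i)
  omega

/-- Modulo a stable set, the last available variable of a row is a nonzerodivisor in large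
degrees. -/
lemma add_single_notMem {H : Set (Fin m × Fin M → ℕ)} (hU : IsUpperSet H) (hS : Stable H) {c : ℕ}
    (hG : GenBy c H) {i : Fin m} {b : Fin M} {v : Fin m × Fin M → ℕ} (hv : v ∉ H)
    (hb : ∀ j, v (i, j) ≠ 0 → j ≤ b) (hc : c ≤ rdeg v i) : v + Pi.single (i, b) 1 ∉ H := by
  intro hin
  obtain ⟨g, hg, hgv, hgc⟩ := hG _ hin
  have hle : ∀ x, x ≠ (i, b) → g x ≤ v x := fun x hx => by
    have := hgv x
    simpa [hx] using this
  have hleb : g (i, b) ≤ v (i, b) + 1 := by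
    have := hgv (i, b)
    simpa using this
  by_cases h1 : g (i, b) ≤ v (i, b)
  · refine hv (hU (fun x => ?_) hg)
    by_cases hx : x = (i, b)
    · rw [hx]; exact h1
    · exact hle x hx
  · obtain ⟨j, hj, hlt⟩ : ∃ j, j ≠ b ∧ g (i, j) < v (i, j) := by
      by_contra! hcon
      have : rdeg v i < rdeg g i := by
        refine sum_lt_sum (fun j _ => ?_) ⟨b, mem_univ _, by omega⟩
        by_cases hj : j = b
        · rw [hj]; omega
        · exact hcon j hj
      have := hgc i
      omega
    have hjb : j < b := lt_of_le_of_ne (hb j (by omega)) hj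
    let w : Fin m × Fin M → ℕ := fun x => if x = (i, b) then g x - 1 else g x
    have hw : w + Pi.single (i, b) 1 = g := by
      funext x
      by_cases hx : x = (i, b)
      · subst hx
        simp [w]; omega
      · simp [w, hx]
    have h2 := hS i b j hjb w (by rwa [hw])
    refine hv (hU (fun x => ?_) h2)
    by_cases hx : x = (i, j)
    · subst hx
      simp [w, hj]; omega
    · by_cases hx2 : x = (i, b)
      · subst hx2
        simp [w, hj.symm]; omega
      · simpa [w, hx, hx2] using hle x hx2

lemma cocnt_add_single {H : Set (Fin m × Fin M → ℕ)} (hU : IsUpperSet H) (hS : Stable H) {c : ℕ}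
    (hG : GenBy c H) {i : Fin m} {b : Fin M} {y d : Fin m → ℕ} (hy : y i = b) (hc : c ≤ d i) :
    cocnt H (update y i (b + 1)) (d + Pi.single i 1) =
      cocnt H (update y i (b + 1)) d + cocnt H y (d + Pi.single i 1) := by
  classical
  rw [cocnt, ← card_filter_add_card_filter_not (fun u => u (i, b) ≠ 0)]
  congr 1
  · symm
    refine card_bij' (fun v _ => v + Pi.single (i, b) 1) (fun u _ => u - Pi.single (i, b) 1)
      ?_ ?_ ?_ ?_
    · intro v hv
      simp only [mem_filter, mem_degSet] at hv ⊢
      obtain ⟨hd, hs, hn⟩ := hv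
      refine ⟨⟨by rw [rdeg_add, hd, rdeg_single], ?_, ?_⟩, by simp⟩
      · intro x hx
        by_cases hxb : x = (i, b)
        · subst hxb; simp
        · exact hs x (by simpa [hxb] using hx)
      · refine add_single_notMem hU hS hG hn (fun j hj => ?_) (by rw [hd]; exact hc)
        have := hs (i, j) hj
        simp only [update_self] at this
        exact Fin.le_def.mpr (by omega)
    · intro u hu
      simp only [mem_filter, mem_degSet] at hu ⊢
      obtain ⟨⟨hd, hs, hn⟩, h0⟩ := hu
      have hle : u - Pi.single (i, b) 1 ≤ u := fun x => Nat.sub_le _ _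
      have hsub : u - Pi.single (i, b) 1 + Pi.single (i, b) 1 = u := by
        funext x
        by_cases hx : x = (i, b)
        · subst hx
          simp; omega
        · simp [hx]
      refine ⟨?_, fun x hx => hs x fun h => hx (by simp [h]), fun h => hn (hU hle h)⟩
      have := congrArg rdeg hsub
      rw [rdeg_add, rdeg_single, hd] at this
      exact add_right_cancel this
    · intro v _
      funext x
      simp
    · intro u hu
      simp only [mem_filter] at hu
      funext x
      by_cases hx : x = (i, b)
      · subst hx
        have := hu.2
        simp; omega
      · simp [hx]
  · rw [cocnt, filter_filter]
    congr 1
    refine filter_congr fun u _ => ?_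
    constructor
    · rintro ⟨⟨hs, hn⟩, h0⟩
      refine ⟨fun x hx => ?_, hn⟩
      have := hs x hx
      by_cases hi : x.1 = i
      · rw [hi, update_self] at this
        rw [hi, hy]
        have hne : (x.2 : ℕ) ≠ b := fun h => by
          have : x = (i, b) := Prod.ext hi (Fin.ext h)
          rw [this] at hx
          exact h0 hx
        omega
      · rwa [update_of_ne hi] at this
    · rintro ⟨hs, hn⟩
      refine ⟨⟨fun x hx => ?_, hn⟩, fun h => ?_⟩
      · have := hs x hx
        by_cases hi : x.1 = i
        · rw [hi, hy] at this
          rw [hi, update_self]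
          omega
        · rwa [update_of_ne hi]
      · have := hs (i, b) h
        simp only [hy] at this
        omega

lemma cocnt_full_add_cnt (H : Set (Fin m × Fin M → ℕ)) (d : Fin m → ℕ) :
    cnt H d + cocnt H (fun _ => M) d = (degSet M d).card := by
  classical
  rw [← card_filter_add_card_filter_not (s := degSet M d) (· ∈ H), cnt, cocnt]
  congr 2
  refine filter_congr fun u _ => ?_
  rw [and_iff_right_iff_imp]
  exact fun _ x _ => x.2.isLt

lemma eventually_cocnt_eq {H H' : Set (Fin m × Fin M → ℕ)} (hU : IsUpperSet H) (hS : Stable H)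
    (hU' : IsUpperSet H') (hS' : Stable H') {c : ℕ} (hG : GenBy c H) (hG' : GenBy c H')
    (hcnt : ∀ d, cnt H d = cnt H' d) (y : Fin m → ℕ) (hy : ∀ i, y i ≤ M) :
    ∃ D, ∀ d : Fin m → ℕ, (∀ i, D ≤ d i) → cocnt H y d = cocnt H' y d := by
  have key : ∀ s, ∀ y : Fin m → ℕ, (∀ i, y i ≤ M) → ∑ i, (M - y i) = s →
      ∃ D, ∀ d : Fin m → ℕ, (∀ i, D ≤ d i) → cocnt H y d = cocnt H' y d := by
    intro s
    induction s with
    | zero =>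
      intro y hy hs
      refine ⟨0, fun d _ => ?_⟩
      have hM : y = fun _ => M := by
        funext i
        have h0 : M - y i = 0 := (sum_eq_zero_iff.mp hs) i (mem_univ i)
        have := hy i
        omega
      subst hM
      have h1 := cocnt_full_add_cnt H d
      have h2 := cocnt_full_add_cnt H' d
      have := hcnt d
      omega
    | succ s ih =>
      intro y hy hs
      obtain ⟨i, -, hi⟩ : ∃ i ∈ (univ : Finset (Fin m)), M - y i ≠ 0 :=
        exists_ne_zero_of_sum_ne_zero (by omega)
      have hyM : y i < M := by omega
      obtain ⟨D, hD⟩ := ih (update y i (y i + 1)) (fun i' => by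
        by_cases h : i' = i
        · subst h; rw [update_self]; omega
        · rw [update_of_ne h]; exact hy i') (by
        rw [← add_sum_erase _ _ (mem_univ i)] at hs ⊢
        rw [sum_congr rfl fun i' hi' => by rw [update_of_ne (ne_of_mem_erase hi')], update_self]
        omega)
      refine ⟨max D c + 1, fun d hd => ?_⟩
      obtain ⟨e, rfl⟩ : ∃ e : Fin m → ℕ, d = e + (Pi.single i 1 : Fin m → ℕ) := by
        refine ⟨d - (Pi.single i 1 : Fin m → ℕ), ?_⟩
        funext i'
        by_cases h : i' = i
        · subst h
          have := hd i'
          rw [Pi.add_apply, Pi.sub_apply, Pi.single_eq_same]; omega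
        · simp [h]
      have hei : max D c ≤ e i := by simpa using hd i
      have he : ∀ i', D ≤ e i' := fun i' => by
        by_cases h : i' = i
        · subst h; omega
        · have h1 := hd i'
          simp [h] at h1
          omega
      have r1 := cocnt_add_single (b := ⟨y i, hyM⟩) (y := y) (d := e) hU hS hG rfl
        (by omega : c ≤ e i)
      have r2 := cocnt_add_single (b := ⟨y i, hyM⟩) (y := y) (d := e) hU' hS' hG' rfl
        (by omega : c ≤ e i)
      have q1 := hD e he
      have q2 := hD (e + Pi.single i 1) fun i' => (he i').trans (by simp)
      simp only at r1 r2
      omega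
  exact key _ y hy rfl

/-- A stable upper set is closed under moving an exponent to smaller indices. -/
lemma mem_of_rowwise {H : Set (Fin m × Fin M → ℕ)} (hU : IsUpperSet H) (hS : Stable H)
    {u v : Fin m × Fin M → ℕ} (hu : u ∈ H) (hd : rdeg u ≤ rdeg v)
    (huv : ∀ i j j', v (i, j) < u (i, j) → u (i, j') < v (i, j') → j' ≤ j) : v ∈ H := by
  have key : ∀ s, ∀ u : Fin m × Fin M → ℕ, u ∈ H → rdeg u ≤ rdeg v →
      (∀ i j j', v (i, j) < u (i, j) → u (i, j') < v (i, j') → j' ≤ j) →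
      ∑ x, (u x - v x) = s → v ∈ H := by
    intro s
    induction s with
    | zero =>
      intro u hu _ _ hs
      refine hU (fun x => ?_) hu
      have h0 : u x - v x = 0 := (sum_eq_zero_iff.mp hs) x (mem_univ x)
      exact Nat.le_of_sub_eq_zero h0
    | succ s ih =>
      intro u hu hd huv hs
      obtain ⟨⟨i, j⟩, -, hx⟩ : ∃ x ∈ (univ : Finset (Fin m × Fin M)), u x - v x ≠ 0 :=
        exists_ne_zero_of_sum_ne_zero (by omega)
      obtain ⟨k, hk⟩ : ∃ k, u (i, k) < v (i, k) := by
        by_contra! hcon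
        have h1 : rdeg v i < rdeg u i :=
          sum_lt_sum (fun l _ => hcon l) ⟨j, mem_univ _, by omega⟩
        have h2 : rdeg u i ≤ rdeg v i := hd i
        omega
      have hkj : k < j := lt_of_le_of_ne (huv i j k (by omega) hk) (by rintro rfl; omega)
      have hne : ((i, k) : Fin m × Fin M) ≠ (i, j) := by simpa using hkj.ne
      let w : Fin m × Fin M → ℕ := fun x => if x = (i, j) then u x - 1 else u x
      have hw : w + Pi.single (i, j) 1 = u := by
        funext x
        by_cases hx' : x = (i, j)
        · subst hx'
          simp [w]; omega
        · simp [w, hx']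
      let u' : Fin m × Fin M → ℕ := w + Pi.single (i, k) 1
      have e1 : u' (i, j) = u (i, j) - 1 := by simp [u', w, hne.symm]
      have e2 : u' (i, k) = u (i, k) + 1 := by simp [u', w, hkj.ne]
      have e3 : ∀ x, x ≠ (i, j) → x ≠ (i, k) → u' x = u x := fun x h1 h2 => by
        simp [u', w, h1, h2]
      have hdeg : rdeg u' = rdeg u := by
        rw [← hw, rdeg_add, rdeg_add, rdeg_single, rdeg_single]
      refine ih u' (hS i j k hkj w (by rwa [hw])) (by rwa [hdeg]) ?_ ?_
      · intro i' a a' h1 h2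
        refine huv i' a a' ?_ ?_
        · by_cases h3 : ((i', a) : Fin m × Fin M) = (i, j)
          · rw [h3] at h1 ⊢; omega
          · by_cases h4 : ((i', a) : Fin m × Fin M) = (i, k)
            · rw [h4] at h1 ⊢; omega
            · rwa [e3 _ h3 h4] at h1
        · by_cases h3 : ((i', a') : Fin m × Fin M) = (i, j)
          · rw [h3] at h2 ⊢; omega
          · by_cases h4 : ((i', a') : Fin m × Fin M) = (i, k)
            · rw [h4] at h2 ⊢; omega
            · rwa [e3 _ h3 h4] at h2
      · have h1 : ∑ x, (u x - v x) = ∑ x, (u' x - v x) + 1 := by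
          rw [← add_sum_erase _ _ (mem_univ (i, j)), ← add_sum_erase univ _ (mem_univ (i, j)), e1]
          have : ∑ x ∈ univ.erase (i, j), (u x - v x) =
              ∑ x ∈ univ.erase (i, j), (u' x - v x) := by
            refine sum_congr rfl fun x hx' => ?_
            by_cases h4 : x = (i, k)
            · rw [h4, e2]; omega
            · rw [e3 x (ne_of_mem_erase hx') h4]
          rw [this]
          omega
        omega
  exact key _ u hu hd huv rfl

lemma eq_of_subset_of_cnt {H H' : Set (Fin m × Fin M → ℕ)} (h : H ⊆ H') {d : Fin m → ℕ}
    (hc : cnt H' d ≤ cnt H d) {u : Fin m × Fin M → ℕ} (hd : rdeg u = d) (hu : u ∈ H') :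
    u ∈ H := by
  classical
  have h1 : (degSet M d).filter (· ∈ H) ⊆ (degSet M d).filter (· ∈ H') :=
    fun v hv => by
      rw [mem_filter] at hv ⊢
      exact ⟨hv.1, h hv.2⟩
  have h2 := eq_of_subset_of_card_le h1 hc
  have h3 : u ∈ (degSet M d).filter (· ∈ H') := mem_filter.mpr ⟨mem_degSet.mpr hd, hu⟩
  rw [← h2] at h3
  exact (mem_filter.mp h3).2

theorem subset_chainUpper {P : Set (Fin m × Fin M → ℕ)} {N : ℕ} (hU : IsUpperSet P)
    (hS : Stable P) (hcnt : ∀ d, cnt P d = cnt (chainUpper m M N) d) :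
    P ⊆ chainUpper m M N := by
  classical
  intro u hu
  by_contra hnot
  have hrow : ∀ i, ∃ j, u (i, j) ≠ 0 := by
    intro i
    by_contra! h0
    have h1 : 0 < cnt P (rdeg u) :=
      card_pos.mpr ⟨u, mem_filter.mpr ⟨mem_degSet.mpr rfl, hu⟩⟩
    rw [hcnt] at h1
    obtain ⟨v, hv⟩ := card_pos.mp h1
    rw [mem_filter, mem_degSet] at hv
    obtain ⟨a, ha, -⟩ := hv.2
    have h2 : rdeg v i = 0 := by rw [hv.1, rdeg, sum_eq_zero fun j _ => h0 j]
    have h3 := le_rdeg v (i, a i)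
    have := ha i
    simp only at h3
    omega
  have hmin : ∀ i, ∃ k, u (i, k) ≠ 0 ∧ ∀ j, u (i, j) ≠ 0 → k ≤ j := by
    intro i
    obtain ⟨k, hk, hk'⟩ := WellFounded.has_min (wellFounded_lt (α := Fin M))
      {j | u (i, j) ≠ 0} (hrow i)
    exact ⟨k, hk, fun j hj => not_lt.mp (hk' j hj)⟩
  choose k hk hkmin using hmin
  obtain ⟨c, hc, hG⟩ := exists_genBy P
  obtain ⟨D, hD⟩ := eventually_cocnt_eq hU hS (isUpperSet_chainUpper m M N)
    (stable_chainUpper m M N) hG (genBy_chainUpper m M N hc) hcnt (fun i => (k i : ℕ) + 1)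
    (fun i => (k i).isLt)
  have h1 := hD (fun i => D + rdeg u i) (fun i => Nat.le_add_right _ _)
  have h2 : cocnt P (fun i => (k i : ℕ) + 1) (fun i => D + rdeg u i) = 0 := by
    rw [cocnt, card_eq_zero, filter_eq_empty_iff]
    rintro v hv ⟨hs, hn⟩
    rw [mem_degSet] at hv
    refine hn (mem_of_rowwise hU hS hu (fun i => by rw [hv]; simp) fun i j j' h3 h4 => ?_)
    have h5 := hs (i, j') (by omega)
    exact le_trans (Fin.le_def.mpr (by simp only at h5; omega)) (hkmin i j (by omega))
  rw [h2, eq_comm, cocnt, card_eq_zero, filter_eq_empty_iff] at h1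
  refine h1 (x := fun x => if x.2 = k x.1 then D + rdeg u x.1 else 0) ?_ ⟨?_, ?_⟩
  · rw [mem_degSet]
    funext i
    simp [rdeg]
  · intro x hx
    have : x.2 = k x.1 := by
      by_contra h
      simp [h] at hx
    rw [this]
    exact Nat.lt_succ_self _
  · rintro ⟨a, ha, hs⟩
    refine hnot ⟨a, fun i => ?_, hs⟩
    have : a i = k i := by
      by_contra h
      have := ha i
      simp [h] at this
    rw [this]
    have := hk i
    omega

/-- An upper set with the same row-degree counts as `chainUpper` is generated in row degree
`(1, …, 1)`. -/
theorem exists_le_of_cnt_eq {L : Set (Fin m × Fin M → ℕ)} {N : ℕ} (hL : IsUpperSet L)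
    (hcnt : ∀ d, cnt L d = cnt (chainUpper m M N) d) {u : Fin m × Fin M → ℕ} (hu : u ∈ L) :
    ∃ v ∈ L, v ≤ u ∧ rdeg v = fun _ => 1 := by
  classical
  let L₀ : Set (Fin m × Fin M → ℕ) := {u | ∃ v ∈ L, v ≤ u ∧ rdeg v = fun _ => 1}
  have hL₀ : IsUpperSet L₀ := fun u w huw ⟨v, hv, hvu, hd⟩ => ⟨v, hv, hvu.trans huw, hd⟩
  have hsub : L₀ ⊆ L := fun u ⟨v, hv, hvu, _⟩ => hL hvu hv
  obtain ⟨P₀, P, uP₀, uP, hPP, sP, cP, cP₀⟩ := exists_stable hL₀ hL hsub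
  have hPJ : P ⊆ chainUpper m M N := subset_chainUpper uP sP fun d => (cP d).trans (hcnt d)
  have hP₀J := hPP.trans hPJ
  have hone : cnt L₀ (fun _ => 1) = cnt L (fun _ => 1) := by
    rw [cnt, cnt]
    congr 1
    refine filter_congr fun v hv => ⟨fun h => hsub h, fun h => ?_⟩
    exact ⟨v, h, le_rfl, mem_degSet.mp hv⟩
  have hJP₀ : chainUpper m M N ⊆ P₀ := by
    intro w hw
    obtain ⟨g, hg, hgw, hg1⟩ := exists_le_mem_chainUpper hw
    exact uP₀ hgw (eq_of_subset_of_cnt hP₀J (by rw [cP₀, hone, hcnt]) (funext hg1) hg)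
  have hEq : P₀ = chainUpper m M N := hP₀J.antisymm hJP₀
  exact eq_of_subset_of_cnt hsub (by rw [← cP₀, hEq, hcnt]) rfl hu

end StableSets

section Diagonals
variable {m M : ℕ}

/-- There are positions `a_0 < a_1 < ⋯ < a_{r-1} < s` with `u (i, a_i) > 0` for all `i < r`. -/
def Reach (u : Fin m × Fin M → ℕ) : ℕ → ℕ → Prop
  | 0, _ => True
  | r + 1, s => ∃ (hr : r < m) (p : Fin M), (p : ℕ) < s ∧ 0 < u (⟨r, hr⟩, p) ∧ Reach u r p

lemma exists_threshold (w : Fin M → ℕ) :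
    ∃ t : ℕ, ∀ s ≤ M, (t ≤ s ↔ ∃ q : Fin M, (q : ℕ) < s ∧ 0 < w q) := by
  by_cases h : ∃ q, 0 < w q
  · obtain ⟨k, hk, hk'⟩ := WellFounded.has_min (wellFounded_lt (α := Fin M)) {q | 0 < w q} h
    refine ⟨k + 1, fun s _ => ⟨fun hs => ⟨k, hs, hk⟩, ?_⟩⟩
    rintro ⟨q, hq, hw⟩
    have : k ≤ q := not_lt.mp (hk' q hw)
    exact lt_of_le_of_lt (Fin.le_def.mp this) hq
  · refine ⟨M + 1, fun s hs => ⟨fun h' => by omega, ?_⟩⟩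
    rintro ⟨q, -, hw⟩
    exact (h ⟨q, hw⟩).elim

/-- One more than the position of the first nonzero entry. -/
noncomputable def threshold (w : Fin M → ℕ) : ℕ := (exists_threshold w).choose

lemma threshold_le_iff (w : Fin M → ℕ) {s : ℕ} (hs : s ≤ M) :
    threshold w ≤ s ↔ ∃ q : Fin M, (q : ℕ) < s ∧ 0 < w q :=
  (exists_threshold w).choose_spec s hs

lemma exists_shift (M s : ℕ) : ∃ ρ : Equiv.Perm (Fin M), ∀ j : Fin M, s ≤ j → (ρ j : ℕ) = j - s := by
  by_cases h : s < M
  · have : NeZero M := ⟨by omega⟩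
    refine ⟨Equiv.subRight ⟨s, h⟩, fun j hj => ?_⟩
    rw [Equiv.subRight_apply, Fin.sub_val_of_le (Fin.le_def.mpr hj)]
  · exact ⟨Equiv.refl _, fun j hj => by omega⟩

/-- A permutation of the positions moving `j` to `j - s` whenever `s ≤ j`. -/
noncomputable def shift (M s : ℕ) : Equiv.Perm (Fin M) := (exists_shift M s).choose

lemma shift_val {s : ℕ} {j : Fin M} (h : s ≤ j) : (shift M s j : ℕ) = j - s :=
  (exists_shift M s).choose_spec j h

/-- The sum of the thresholds of the first `r` rows. -/
noncomputable def thresholdSum (u : Fin m × Fin M → ℕ) (r : ℕ) : ℕ :=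
  ∑ l ∈ univ.filter (fun l : Fin m => (l : ℕ) < r), threshold fun j => u (l, j)

lemma thresholdSum_succ (u : Fin m × Fin M → ℕ) {r : ℕ} (hr : r < m) :
    thresholdSum u (r + 1) = thresholdSum u r + threshold fun j => u (⟨r, hr⟩, j) := by
  rw [thresholdSum, thresholdSum]
  have : (univ.filter fun l : Fin m => (l : ℕ) < r + 1) =
      insert ⟨r, hr⟩ (univ.filter fun l : Fin m => (l : ℕ) < r) := by
    ext l
    simp [Fin.ext_iff]
    omega
  rw [this, sum_insert (by simp), add_comm]

lemma thresholdSum_le_iff (u : Fin m × Fin M → ℕ) {N : ℕ} (hN : N ≤ M) :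
    thresholdSum u m ≤ N ↔ u ∈ chainUpper m M N := by
  have e : thresholdSum u m = ∑ l : Fin m, threshold fun j => u (l, j) := by
    rw [thresholdSum]
    congr 1
    simp
  rw [e]
  constructor
  · intro h
    have h1 : ∀ l : Fin m, threshold (fun j => u (l, j)) ≤ M := fun l =>
      (single_le_sum (f := fun l => threshold fun j => u (l, j)) (fun _ _ => Nat.zero_le _)
        (mem_univ l)).trans (h.trans hN)
    choose q hq hq' using fun l => (threshold_le_iff (fun j => u (l, j)) (h1 l)).mp le_rfl
    exact ⟨q, hq', (sum_le_sum fun l _ => hq l).trans h⟩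
  · rintro ⟨a, ha, hs⟩
    exact (sum_le_sum fun l _ => (threshold_le_iff (fun j => u (l, j)) (a l).isLt).mpr
      ⟨a l, Nat.lt_succ_self _, ha l⟩).trans hs

/-- Shift every row by the sum of the thresholds of the preceding rows. -/
noncomputable def straighten (u : Fin m × Fin M → ℕ) : Fin m × Fin M → ℕ := fun x =>
  u (x.1, shift M (thresholdSum u x.1) x.2)

lemma rdeg_straighten (u : Fin m × Fin M → ℕ) : rdeg (straighten u) = rdeg u := by
  funext i
  exact Equiv.sum_comp (shift M (thresholdSum u i)) fun j => u (i, j)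

lemma straighten_injective : Injective (straighten (m := m) (M := M)) := by
  intro u w h
  have key : ∀ r : ℕ, ∀ i : Fin m, (i : ℕ) = r → ∀ j, u (i, j) = w (i, j) := by
    intro r
    induction r using Nat.strong_induction_on with
    | _ r ih =>
      rintro i rfl j
      have hs : thresholdSum u i = thresholdSum w i := by
        refine sum_congr rfl fun l hl => ?_
        congr 1
        funext a
        exact ih l (mem_filter.mp hl).2 l rfl a
      have := congrFun h (i, (shift M (thresholdSum u i)).symm j)
      simp only [straighten] at this
      rw [← hs, Equiv.apply_symm_apply] at this
      exact this
  funext x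
  exact key _ x.1 rfl x.2

lemma reach_straighten (u : Fin m × Fin M → ℕ) (r : ℕ) (hr : r ≤ m) (s : ℕ) (hs : s ≤ M) :
    Reach (straighten u) r s ↔ thresholdSum u r ≤ s := by
  induction r generalizing s with
  | zero => simp [Reach, thresholdSum]
  | succ r ih =>
    have hrm : r < m := hr
    rw [Reach, thresholdSum_succ u hrm]
    constructor
    · rintro ⟨_, p, hps, hp, hR⟩
      rw [ih hrm.le p p.isLt.le] at hR
      have h1 := shift_val hR
      have : threshold (fun j => u (⟨r, hrm⟩, j)) ≤ s - thresholdSum u r := by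
        rw [threshold_le_iff _ (by omega)]
        exact ⟨shift M (thresholdSum u r) p, by omega, hp⟩
      omega
    · intro h
      have h0 : threshold (fun j => u (⟨r, hrm⟩, j)) ≤ s - thresholdSum u r := by omega
      rw [threshold_le_iff _ (by omega)] at h0
      obtain ⟨q, hq, hu⟩ := h0
      have hlt : (q : ℕ) + thresholdSum u r < M := by omega
      have hval := shift_val (M := M) (s := thresholdSum u r) (j := ⟨q + thresholdSum u r, hlt⟩)
        (Nat.le_add_left _ _)
      have heq : shift M (thresholdSum u r) ⟨q + thresholdSum u r, hlt⟩ = q := by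
        ext
        rw [hval]
        simp
      refine ⟨hrm, ⟨q + thresholdSum u r, hlt⟩, by simp only; omega, ?_, ?_⟩
      · simp only [straighten]
        rwa [heq]
      · rw [ih hrm.le _ hlt.le]
        exact Nat.le_add_left _ _

/-- The exponents divisible by a diagonal monomial of a maximal minor are as numerous as the
elements of `chainUpper`. -/
theorem cnt_reach {N : ℕ} (hN : N ≤ M) (d : Fin m → ℕ) :
    cnt {u : Fin m × Fin M → ℕ | Reach u m N} d = cnt (chainUpper m M N) d := by
  classical
  have himg : (degSet M d).image straighten = degSet M d := by
    refine eq_of_subset_of_card_le (fun u hu => ?_)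
      (card_image_of_injective _ straighten_injective).ge
    obtain ⟨w, hw, rfl⟩ := mem_image.mp hu
    rw [mem_degSet] at hw ⊢
    rw [rdeg_straighten, hw]
  symm
  refine card_bij (fun u _ => straighten u) ?_ (fun _ _ _ _ h => straighten_injective h) ?_
  · intro u hu
    simp only [mem_filter, mem_degSet] at hu ⊢
    refine ⟨by rw [rdeg_straighten, hu.1], ?_⟩
    exact (reach_straighten u m le_rfl N hN).mpr ((thresholdSum_le_iff u hN).mpr hu.2)
  · intro w hw
    rw [mem_filter] at hw
    have h1 := hw.1
    rw [← himg] at h1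
    obtain ⟨u, hu, rfl⟩ := mem_image.mp h1
    exact ⟨u, mem_filter.mpr ⟨hu, (thresholdSum_le_iff u hN).mp
      ((reach_straighten u m le_rfl N hN).mp hw.2)⟩, rfl⟩

end Diagonals

section Reach
variable {m M : ℕ}

lemma Reach.mono {u : Fin m × Fin M → ℕ} {r s s' : ℕ} (h : Reach u r s) (hs : s ≤ s') :
    Reach u r s' := by
  cases r with
  | zero => trivial
  | succ r =>
    obtain ⟨hr, p, hp, h1, h2⟩ := h
    exact ⟨hr, p, hp.trans_le hs, h1, h2⟩

lemma Reach.exists_chain {u : Fin m × Fin M → ℕ} {r s : ℕ} (hr : r ≤ m) (h : Reach u r s) :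
    ∃ a : Fin r → Fin M, StrictMono a ∧ (∀ i, (a i : ℕ) < s) ∧
      ∀ i, 0 < u (Fin.castLE hr i, a i) := by
  induction r generalizing s with
  | zero => exact ⟨Fin.elim0, fun i => i.elim0, fun i => i.elim0, fun i => i.elim0⟩
  | succ r ih =>
    obtain ⟨hrm, p, hp, h1, h2⟩ := h
    obtain ⟨a, ha, has, hau⟩ := ih hrm.le h2
    refine ⟨Fin.snoc a p, ?_, ?_, ?_⟩
    · intro i j hij
      induction j using Fin.lastCases with
      | last =>
        induction i using Fin.lastCases with
        | last => exact (lt_irrefl _ hij).elim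
        | cast i => simpa using Fin.lt_def.mpr (has i)
      | cast j =>
        induction i using Fin.lastCases with
        | last => exact absurd hij (not_lt.mpr (Fin.le_last _))
        | cast i => simpa using ha (Fin.castSucc_lt_castSucc_iff.mp hij)
    · intro i
      induction i using Fin.lastCases with
      | last => simpa using hp
      | cast i => simpa using (has i).trans hp
    · intro i
      induction i using Fin.lastCases with
      | last =>
        rw [Fin.snoc_last]
        exact h1
      | cast i => simpa using hau i

end Reach

section Vanishing
variable {K : Type} [Field K] {σ : Type}

/-- The restriction of a polynomial to a line, as a univariate polynomial. -/
noncomputable def alongLine (x b : σ → K) (f : MvPolynomial σ K) : Polynomial K :=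
  aeval (fun w => Polynomial.C (x w) + Polynomial.X * Polynomial.C (b w)) f

lemma eval_alongLine (x b : σ → K) (f : MvPolynomial σ K) (t : K) :
    (alongLine x b f).eval t = MvPolynomial.eval (fun w => x w + t * b w) f := by
  rw [alongLine, aeval_def, polynomial_eval_eval₂, MvPolynomial.eval, coe_eval₂Hom]
  congr 1
  · ext a
    simp
  · funext w
    simp
    ring

lemma exists_eval_update [DecidableEq σ] [Fintype σ] (y : σ → K) (z : σ) (u : σ →₀ ℕ) (c : K) :
    ∃ R : K, ∀ a, MvPolynomial.eval (update y z a) (monomial u c) = a ^ u z * R := by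
  refine ⟨c * ∏ w ∈ univ.erase z, y w ^ u w, fun a => ?_⟩
  rw [eval_monomial, Finsupp.prod_fintype _ _ (fun _ => pow_zero _),
    ← mul_prod_erase _ _ (mem_univ z), update_self,
    prod_congr rfl fun w hw => by rw [update_of_ne (ne_of_mem_erase hw)]]
  ring

/-- The part of `f` of degree `k` in the variable `z`. -/
noncomputable def varPart (z : σ) (k : ℕ) (f : MvPolynomial σ K) : MvPolynomial σ K :=
  ∑ u ∈ f.support.filter (fun u => u z = k), monomial u (coeff u f)

lemma coeff_varPart (z : σ) (k : ℕ) (f : MvPolynomial σ K) (u : σ →₀ ℕ) :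
    coeff u (varPart z k f) = if u z = k then coeff u f else 0 := by
  classical
  rw [varPart, coeff_sum]
  simp only [coeff_monomial]
  rw [sum_ite_eq']
  by_cases h : u z = k
  · by_cases h2 : coeff u f = 0
    · simp [h, h2]
    · simp [h, h2]
  · simp [h]

lemma eval_varPart_update [DecidableEq σ] [Fintype σ] (y : σ → K) (z : σ) (k : ℕ)
    (f : MvPolynomial σ K) (a : K) :
    MvPolynomial.eval (update y z a) (varPart z k f) * y z ^ k = a ^ k * MvPolynomial.eval y (varPart z k f) := by
  rw [varPart, map_sum, map_sum, sum_mul, mul_sum]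
  refine sum_congr rfl fun u hu => ?_
  obtain ⟨R, hR⟩ := exists_eval_update y z u (coeff u f)
  have h := hR (y z)
  rw [update_eq_self] at h
  rw [hR, h, (mem_filter.mp hu).2]
  ring

/-- If `f` vanishes at the points obtained from a line by inverting the parameter in the
coordinate `z`, then the top part of `f` in the variable `z` vanishes at the origin of the
line. -/
lemma eval_varPart_eq_zero [Infinite K] [DecidableEq σ] [Fintype σ] {f : MvPolynomial σ K} {z : σ}
    {k : ℕ} (hk : ∀ u ∈ f.support, u z ≤ k) (x b : σ → K) (hb : b z = 0)
    (h : ∀ t : K, t ≠ 0 → MvPolynomial.eval (update (fun w => x w + t * b w) z (x z * t⁻¹)) f = 0) :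
    MvPolynomial.eval x (varPart z k f) = 0 := by
  let q : Polynomial K := ∑ u ∈ f.support,
    Polynomial.X ^ (k - u z) * alongLine x b (monomial u (coeff u f))
  have hq : Polynomial.X * q = 0 := by
    refine Polynomial.funext fun t => ?_
    rw [Polynomial.eval_mul, Polynomial.eval_X, Polynomial.eval_zero]
    by_cases ht : t = 0
    · rw [ht, zero_mul]
    · have h1 : q.eval t = t ^ k * MvPolynomial.eval (update (fun w => x w + t * b w) z (x z * t⁻¹)) f := by
        rw [Polynomial.eval_finsetSum]
        conv_rhs => rw [f.as_sum, map_sum, mul_sum]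
        refine sum_congr rfl fun u hu => ?_
        rw [Polynomial.eval_mul, Polynomial.eval_pow, Polynomial.eval_X, eval_alongLine]
        obtain ⟨R, hR⟩ := exists_eval_update (fun w => x w + t * b w) z u (coeff u f)
        have h2 := hR (x z)
        have h3 : update (fun w => x w + t * b w) z (x z) = fun w => x w + t * b w := by
          conv_rhs => rw [← update_eq_self z (fun w => x w + t * b w)]
          simp [hb]
        rw [h3] at h2
        rw [hR, h2]
        have h4 : t ^ k = t ^ (k - u z) * t ^ u z := by
          rw [← pow_add, Nat.sub_add_cancel (hk u hu)]
        rw [h4, mul_pow, inv_pow]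
        field_simp
      rw [h1, h t ht, mul_zero, mul_zero]
  have hq0 : q = 0 := (mul_eq_zero.mp hq).resolve_left Polynomial.X_ne_zero
  have h1 : q.eval 0 = MvPolynomial.eval x (varPart z k f) := by
    rw [Polynomial.eval_finsetSum, varPart, map_sum, sum_filter]
    refine sum_congr rfl fun u hu => ?_
    rw [Polynomial.eval_mul, Polynomial.eval_pow, Polynomial.eval_X, eval_alongLine]
    simp only [zero_mul, add_zero]
    by_cases hu' : u z = k
    · simp [hu']
    · have : k - u z ≠ 0 := by
        have := hk u hu
        omega
      simp [hu', this]
  rw [← h1, hq0, Polynomial.eval_zero]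

end Vanishing

section Degenerate
variable {K : Type} [Field K] {m M : ℕ}

/-- The matrices whose row `r` is, in the first `s` columns, a combination of the preceding
rows. -/
def Degenerate (r : Fin m) (s : ℕ) (x : Fin m × Fin M → K) : Prop :=
  ∃ c : Fin m → K, c r = 1 ∧ (∀ i, r < i → c i = 0) ∧
    ∀ j : Fin M, (j : ℕ) < s → ∑ i, c i * x (i, j) = 0

lemma eval_varPart_mul {r r' : Fin m} (hr : r' < r) {s : ℕ} (hs : s < M)
    [Infinite K] {f : MvPolynomial (Fin m × Fin M) K} {k : ℕ}
    (hk : ∀ u ∈ f.support, u (r, ⟨s, hs⟩) ≤ k)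
    (hf : ∀ x, Degenerate r (s + 1) x → MvPolynomial.eval x f = 0)
    (x : Fin m × Fin M → K) (c : Fin m → K) (hc1 : c r' = 1) (hc0 : ∀ i, r' < i → c i = 0)
    (hc : ∀ j : Fin M, (j : ℕ) < s → ∑ i, c i * x (i, j) = 0) :
    (∑ i, c i * x (i, ⟨s, hs⟩)) ^ k * MvPolynomial.eval x (varPart (r, ⟨s, hs⟩) k f) = 0 := by
  classical
  set l := ∑ i, c i * x (i, ⟨s, hs⟩) with hl
  rw [← eval_varPart_update, mul_eq_zero]
  left
  let b : Fin m × Fin M → K := fun w => if w.1 = r' ∧ (w.2 : ℕ) < s then x (r, w.2) else 0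
  have hbr : ∀ i j, i ≠ r' → b (i, j) = 0 := fun i j hi => by simp [b, hi]
  have hbs : ∀ i, b (i, ⟨s, hs⟩) = 0 := fun i => by simp [b]
  refine eval_varPart_eq_zero hk _ b (hbs r) fun t ht => hf _ ?_
  rw [update_self]
  set y := update (fun w => update x (r, ⟨s, hs⟩) l w + t * b w) (r, ⟨s, hs⟩) (l * t⁻¹) with hy
  have hyr : y (r, ⟨s, hs⟩) = l * t⁻¹ := by rw [hy, update_self]
  have hyo : ∀ w, w ≠ (r, ⟨s, hs⟩) → y w = x w + t * b w := fun w hw => by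
    rw [hy, update_of_ne hw, update_of_ne hw]
  have hsum : ∀ j, ∑ i, c i * x (i, j) = ∑ i ∈ univ.erase r, c i * x (i, j) := fun j => by
    rw [← add_sum_erase _ _ (mem_univ r), hc0 r hr, zero_mul, zero_add]
  refine ⟨fun i => if i = r then 1 else -t⁻¹ * c i, if_pos rfl, fun i hi => ?_, fun j hj => ?_⟩
  · beta_reduce
    rw [if_neg hi.ne', hc0 i (hr.trans hi), mul_zero]
  · beta_reduce
    rw [← add_sum_erase _ _ (mem_univ r), if_pos rfl, one_mul]
    have hmem : r' ∈ univ.erase r := mem_erase.mpr ⟨hr.ne, mem_univ _⟩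
    have h1 : ∀ i ∈ univ.erase r, (if i = r then 1 else -t⁻¹ * c i) * y (i, j) =
        -t⁻¹ * (c i * x (i, j)) - c i * b (i, j) := fun i hi => by
      have hi' := ne_of_mem_erase hi
      rw [if_neg hi', hyo _ (by simp [hi'])]
      field_simp
      ring
    have h2 : ∑ i ∈ univ.erase r, c i * b (i, j) = b (r', j) := by
      rw [sum_eq_single_of_mem r' hmem fun i _ hi => by rw [hbr i j hi, mul_zero], hc1, one_mul]
    rw [sum_congr rfl h1, sum_sub_distrib, ← mul_sum, ← hsum, h2]
    by_cases hjs : j = ⟨s, hs⟩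
    · subst hjs
      rw [hyr, hbs, ← hl]
      ring
    · have hlt : (j : ℕ) < s := by
        have : (j : ℕ) ≠ s := fun h => hjs (Fin.ext h)
        omega
      rw [hyo _ (by simp [hjs]), hc j hlt, hbr r j hr.ne']
      simp [b, hlt]

lemma eval_varPart_of_degenerate {r r' : Fin m} (hr : r' < r) {s : ℕ} (hs : s < M)
    [Infinite K] {f : MvPolynomial (Fin m × Fin M) K} {k : ℕ}
    (hk : ∀ u ∈ f.support, u (r, ⟨s, hs⟩) ≤ k)
    (hf : ∀ x, Degenerate r (s + 1) x → MvPolynomial.eval x f = 0)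
    {x : Fin m × Fin M → K} (hx : Degenerate r' s x) :
    MvPolynomial.eval x (varPart (r, ⟨s, hs⟩) k f) = 0 := by
  classical
  obtain ⟨c, hc1, hc0, hc⟩ := hx
  let b : Fin m × Fin M → K := Pi.single (r', ⟨s, hs⟩) 1
  have hz : (Polynomial.X + Polynomial.C (∑ i, c i * x (i, ⟨s, hs⟩))) ^ k *
      alongLine x b (varPart (r, ⟨s, hs⟩) k f) = 0 := by
    refine Polynomial.funext fun t => ?_
    have h1 := eval_varPart_mul hr hs hk hf (fun w => x w + t * b w) c hc1 hc0 fun j hj => by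
      rw [← hc j hj]
      refine sum_congr rfl fun i _ => ?_
      have : j ≠ ⟨s, hs⟩ := fun h => by
        rw [h] at hj
        exact lt_irrefl s hj
      simp [b, this]
    have h2 : ∑ i, c i * (x (i, ⟨s, hs⟩) + t * b (i, ⟨s, hs⟩)) =
        t + ∑ i, c i * x (i, ⟨s, hs⟩) := by
      simp only [mul_add, sum_add_distrib]
      rw [add_comm, sum_eq_single_of_mem r' (mem_univ _) fun i _ hi => by simp [b, hi]]
      simp [b, hc1]
    rw [h2] at h1
    rw [Polynomial.eval_mul, Polynomial.eval_pow, Polynomial.eval_add, Polynomial.eval_X,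
      Polynomial.eval_C, eval_alongLine, h1, Polynomial.eval_zero]
  have h3 := (mul_eq_zero.mp hz).resolve_left
    (pow_ne_zero _ (Polynomial.monic_X_add_C _).ne_zero)
  have h4 := eval_alongLine x b (varPart (r, ⟨s, hs⟩) k f) 0
  rw [h3, Polynomial.eval_zero] at h4
  simpa using h4.symm

/-- A polynomial without monomials divisible by a diagonal which vanishes on all degenerate
matrices is zero. -/
theorem eq_zero_of_vanishes [Infinite K] (r : Fin m) (s : ℕ) (hs : s ≤ M)
    (f : MvPolynomial (Fin m × Fin M) K) (hf : ∀ x, Degenerate r s x → MvPolynomial.eval x f = 0)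
    (hD : ∀ u ∈ f.support, ¬ Reach (u : Fin m × Fin M → ℕ) (r + 1) s) : f = 0 := by
  classical
  obtain ⟨r, hr⟩ := r
  induction r generalizing s f with
  | zero => ?_
  | succ r ihr => ?_
  all_goals
    induction s generalizing f with
    | zero =>
      refine MvPolynomial.funext fun x => ?_
      rw [map_zero]
      exact hf x ⟨Pi.single ⟨_, hr⟩ 1, by simp, fun i hi => by simp [hi.ne'], fun j hj => by omega⟩
    | succ s ihs => ?_
  all_goals
    let z : Fin m × Fin M := (⟨_, hr⟩, ⟨s, hs⟩)
    have free : (∀ u ∈ f.support, u z = 0) → f = 0 := by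
      intro h0
      refine ihs (by omega) f ?_ fun u hu h => hD u hu (h.mono (Nat.le_succ s))
      rintro x ⟨c, hc1, hc0, hc⟩
      have h1 := hf (update x z (x z - ∑ i, c i * x (i, ⟨s, hs⟩))) ⟨c, hc1, hc0, fun j hj => by
        by_cases hjs : j = ⟨s, hs⟩
        · subst hjs
          have hrow : ∀ i ∈ univ.erase (⟨_, hr⟩ : Fin m),
              c i * update x z (x z - ∑ i, c i * x (i, ⟨s, hs⟩)) (i, ⟨s, hs⟩) =
                c i * x (i, ⟨s, hs⟩) := fun i hi => by
            rw [update_of_ne (by simpa [z] using ne_of_mem_erase hi)]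
          rw [← add_sum_erase _ _ (mem_univ (⟨_, hr⟩ : Fin m)), hc1, update_self,
            sum_congr rfl hrow,
            ← add_sum_erase univ (fun i => c i * x (i, ⟨s, hs⟩)) (mem_univ (⟨_, hr⟩ : Fin m)), hc1]
          simp only [z]
          ring
        · have hrow : ∀ i ∈ (univ : Finset (Fin m)),
              c i * update x z (x z - ∑ i, c i * x (i, ⟨s, hs⟩)) (i, j) = c i * x (i, j) :=
            fun i _ => by rw [update_of_ne (by simpa [z] using fun _ => hjs)]
          rw [sum_congr rfl hrow]
          refine hc j ?_
          have : (j : ℕ) ≠ s := fun h => hjs (Fin.ext h)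
          omega⟩
      rw [← h1]
      conv_lhs => rw [f.as_sum, map_sum]
      conv_rhs => rw [f.as_sum, map_sum]
      refine sum_congr rfl fun u hu => ?_
      obtain ⟨R, hR⟩ := exists_eval_update x z u (coeff u f)
      have h2 := hR (x z)
      rw [update_eq_self] at h2
      rw [h2, hR, h0 u hu, pow_zero, pow_zero]
  · refine free fun u hu => ?_
    by_contra h
    exact hD u hu ⟨hr, ⟨s, hs⟩, Nat.lt_succ_self s, Nat.pos_of_ne_zero h, trivial⟩
  · by_contra hne
    have hsupp : f.support.Nonempty := by rwa [support_nonempty]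
    obtain ⟨u₀, hu₀, hmax⟩ := exists_max_image f.support (fun u => u z) hsupp
    by_cases hk : u₀ z = 0
    · exact hne (free fun u hu => Nat.le_zero.mp (hk ▸ hmax u hu))
    · have hr' : r < m := by omega
      have hlt : (⟨r, hr'⟩ : Fin m) < ⟨r + 1, hr⟩ := Fin.lt_def.mpr (Nat.lt_succ_self r)
      have hg : varPart z (u₀ z) f = 0 := by
        refine ihr s (by omega) _ hr' ?_ ?_
        · exact fun x hx => eval_varPart_of_degenerate hlt hs hmax hf hx
        · intro u hu hR
          rw [mem_support_iff, coeff_varPart] at hu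
          have hu1 : u z = u₀ z := by
            by_contra h
            simp [h] at hu
          rw [if_pos hu1] at hu
          exact hD u (mem_support_iff.mpr hu) ⟨hr, ⟨s, hs⟩, Nat.lt_succ_self s,
            by rw [← hu1] at hk; exact Nat.pos_of_ne_zero hk, hR⟩
      have := coeff_varPart z (u₀ z) f u₀
      rw [hg, if_pos rfl, coeff_zero] at this
      exact mem_support_iff.mp hu₀ this.symm

end Degenerate

section GenericMatrix
variable {m M N : ℕ}

/-- The generic `m × N` matrix, whose entries are the first `N` variables of each row. -/
def genMat (K : Type) [Field K] (m : ℕ) (hN : N ≤ M) :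
    Matrix (Fin m) (Fin N) (MvPolynomial (Fin m × Fin M) K) :=
  Matrix.of fun i j => X (i, Fin.castLE hN j)

variable {K : Type} [Field K]

lemma eq_zero_of_mem_minorsIdeal [Infinite K] (hN : N ≤ M) {f : MvPolynomial (Fin m × Fin M) K}
    (hf : f ∈ minorsIdeal m (genMat K m hN))
    (hD : ∀ u ∈ f.support, ¬ Reach (u : Fin m × Fin M → ℕ) m N) : f = 0 := by
  cases m with
  | zero =>
    by_contra h
    obtain ⟨u, hu⟩ := support_nonempty.mpr h
    exact hD u hu trivial
  | succ r =>
    refine eq_zero_of_vanishes (Fin.last r) N hN f ?_ hD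
    rintro x ⟨c, hc1, -, hc⟩
    have hle : minorsIdeal (r + 1) (genMat K (r + 1) hN) ≤ RingHom.ker (MvPolynomial.eval x) := by
      refine Ideal.span_le.mpr ?_
      rintro _ ⟨r', c', hr, -, rfl⟩
      have hbij : Bijective r' := Finite.injective_iff_bijective.mp hr
      rw [SetLike.mem_coe, RingHom.mem_ker, RingHom.map_det, ← Matrix.exists_vecMul_eq_zero_iff]
      refine ⟨c ∘ r', fun h => ?_, ?_⟩
      · obtain ⟨a, ha⟩ := hbij.surjective (Fin.last r)
        have := congrFun h a
        simp [ha, hc1] at this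
      · funext j
        have := hc (Fin.castLE hN (c' j)) (by simp)
        rw [← hbij.sum_comp] at this
        simpa [Matrix.vecMul, dotProduct, genMat] using this
    exact hle hf

/-- The row degree of a finitely supported exponent as an additive map. -/
lemma rdeg_eq_weight (u : Fin m × Fin M →₀ ℕ) :
    rdeg (u : Fin m × Fin M → ℕ) =
      Finsupp.weight (fun x : Fin m × Fin M => (Pi.single x.1 1 : Fin m → ℕ)) u := by
  induction u using Finsupp.induction_linear with
  | zero => funext i; simp [rdeg]
  | add u w hu hw => rw [Finsupp.coe_add, rdeg_add, hu, hw, map_add]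
  | single x s =>
    rw [Finsupp.weight_single, Finsupp.single_eq_pi_single, rdeg_single x.1 x.2 s]
    funext i
    by_cases h : i = x.1
    · subst h; simp
    · simp [h]

lemma monomial_mem_minorsIdeal_sup (hN : N ≤ M) (u : Fin m × Fin M →₀ ℕ) :
    monomial u (1 : K) ∈ (minorsIdeal m (genMat K m hN)).restrictScalars K ⊔
      Submodule.span K ((fun w => monomial w (1 : K)) ''
        {w : Fin m × Fin M →₀ ℕ | rdeg w = rdeg u ∧ ¬ Reach (w : Fin m × Fin M → ℕ) m N}) := by
  induction hk : Finsupp.weight (fun x : Fin m × Fin M => (x.1 : ℕ) * (x.2 : ℕ)) u using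
    Nat.strong_induction_on generalizing u with
  | _ k ih =>
  subst hk
  by_cases hR : Reach (u : Fin m × Fin M → ℕ) m N
  swap
  · exact Submodule.mem_sup_right (Submodule.subset_span ⟨u, ⟨rfl, hR⟩, rfl⟩)
  obtain ⟨a, ha, haN, hapos⟩ := hR.exists_chain le_rfl
  let e : Equiv.Perm (Fin m) → (Fin m × Fin M →₀ ℕ) := fun s =>
    ∑ i, Finsupp.single (s i, a i) 1
  have hdeg : ∀ s, rdeg (e s : Fin m × Fin M → ℕ) = fun _ => 1 := fun s => by
    rw [rdeg_eq_weight, map_sum]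
    simp only [Finsupp.weight_single, one_smul]
    rw [Equiv.sum_comp s fun i => (Pi.single i 1 : Fin m → ℕ)]
    funext i
    simp [Finset.sum_apply, Pi.single_apply]
  have hwt : ∀ s, s ≠ 1 →
      Finsupp.weight (fun x : Fin m × Fin M => (x.1 : ℕ) * (x.2 : ℕ)) (e s) <
        Finsupp.weight (fun x : Fin m × Fin M => (x.1 : ℕ) * (x.2 : ℕ)) (e 1) := fun s hs => by
    simp only [e, map_sum, Finsupp.weight_single, one_smul, Equiv.Perm.one_apply]
    have hmono : Monovary (fun i : Fin m => (i : ℕ)) fun i => (a i : ℕ) := fun i j hij =>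
      (ha.lt_iff_lt.mp hij).le
    refine hmono.sum_comp_perm_mul_lt_sum_mul_iff.mpr fun h => hs ?_
    refine (Equiv.Perm.monotone_iff s).mp (monotone_iff_forall_lt.mpr fun i j hij => ?_)
    exact h (ha hij)
  have he : e 1 ≤ u := fun x => by
    simp only [e, Finsupp.finsetSum_apply, Equiv.Perm.one_apply]
    rw [Finset.sum_eq_single x.1]
    · by_cases hx : a x.1 = x.2
      · have := hapos x.1
        rw [show (Fin.castLE le_rfl x.1 : Fin m) = x.1 from rfl, hx] at this
        rw [hx, Finsupp.single_eq_same]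
        exact this
      · rw [Finsupp.single_eq_of_ne (fun h => hx (congrArg Prod.snd h).symm)]
        exact Nat.zero_le _
    · intro i _ hi
      exact Finsupp.single_eq_of_ne fun h => hi (congrArg Prod.fst h).symm
    · simp
  obtain ⟨w, rfl⟩ := exists_add_of_le he
  let a' : Fin m → Fin N := fun i => ⟨a i, haN i⟩
  let D : MvPolynomial (Fin m × Fin M) K := ((genMat K m hN).submatrix id a').det
  have hD : D = ∑ s : Equiv.Perm (Fin m), Equiv.Perm.sign s • monomial (e s) (1 : K) := by
    simp only [D, Matrix.det_apply]
    refine Finset.sum_congr rfl fun s _ => ?_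
    congr 1
    rw [monomial_sum_one]
    rfl
  have hDI : monomial w 1 * D ∈ minorsIdeal m (genMat K m hN) :=
    Ideal.mul_mem_left _ _ (Ideal.subset_span ⟨id, a', injective_id, fun i j hij =>
      ha.injective (Fin.ext (congrArg Fin.val hij :)), rfl⟩)
  have hsplit : monomial (e 1 + w) (1 : K) = monomial w 1 * D -
      ∑ s ∈ univ.erase 1, Equiv.Perm.sign s • monomial (e s + w) (1 : K) := by
    rw [hD, Finset.mul_sum, ← Finset.add_sum_erase _ _ (Finset.mem_univ (1 : Equiv.Perm (Fin m)))]
    simp [mul_smul_comm, monomial_mul, add_comm]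
  have hrow : ∀ s, rdeg (e s + w : Fin m × Fin M →₀ ℕ) = rdeg (e 1 + w : Fin m × Fin M →₀ ℕ) :=
    fun s => by rw [Finsupp.coe_add, Finsupp.coe_add, rdeg_add, rdeg_add, hdeg, hdeg]
  rw [hsplit]
  refine Submodule.sub_mem _ (Submodule.mem_sup_left hDI) (Submodule.sum_mem _ fun s hs => ?_)
  rw [Units.smul_def, ← Int.cast_smul_eq_zsmul K]
  refine Submodule.smul_mem _ _ ?_
  have := ih _ (by
    rw [map_add, map_add]
    exact Nat.add_lt_add_right (hwt s (Finset.ne_of_mem_erase hs)) _) (e s + w) rfl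
  rwa [hrow] at this

end GenericMatrix

section HilbertFunction
variable {m M : ℕ} {K : Type} [Field K]

/-- The weights of the grading of the polynomial ring by row degree. -/
def rowWt (x : Fin m × Fin M) : Fin m → ℕ := Pi.single x.1 1

lemma isWeightedHomogeneous_rowWt {f : MvPolynomial (Fin m × Fin M) K} {d : Fin m → ℕ} :
    f.IsWeightedHomogeneous rowWt d ↔ ∀ u ∈ f.support, rdeg (u : Fin m × Fin M → ℕ) = d := by
  refine ⟨fun h u hu => ?_, fun h u hu => ?_⟩
  · rw [rdeg_eq_weight]
    exact h (mem_support_iff.mp hu)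
  · have := h u (mem_support_iff.mpr hu)
    rwa [rdeg_eq_weight] at this

/-- The Hilbert function of the quotient by `I` with respect to the row grading. -/
def hfun (I : Ideal (MvPolynomial (Fin m × Fin M) K)) (d : Fin m → ℕ) : ℕ :=
  Module.finrank K
    ((weightedHomogeneousSubmodule K (rowWt (m := m) (M := M)) d).map
      (I.restrictScalars K).mkQ)

/-- The number of monomials of row degree `d` in a set of monomials that is a basis modulo `I` is
the value of the Hilbert function. -/
lemma cnt_eq_hfun {I : Ideal (MvPolynomial (Fin m × Fin M) K)} {S : Set (Fin m × Fin M → ℕ)}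
    (hindep : ∀ f ∈ I, (∀ u ∈ f.support, (u : Fin m × Fin M → ℕ) ∈ S) → f = 0)
    (hspan : ∀ u : Fin m × Fin M →₀ ℕ, monomial u (1 : K) ∈ I.restrictScalars K ⊔
      Submodule.span K ((fun w => monomial w (1 : K)) ''
        {w : Fin m × Fin M →₀ ℕ | rdeg w = rdeg u ∧ (w : Fin m × Fin M → ℕ) ∈ S}))
    (d : Fin m → ℕ) : cnt S d = hfun I d := by
  classical
  let T := (degSet M d).filter (· ∈ S)
  let q := (I.restrictScalars K).mkQ
  let b : T → MvPolynomial (Fin m × Fin M) K := fun t =>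
    monomial (Finsupp.equivFunOnFinite.symm t.1) 1
  have hT : ∀ t : T, rdeg t.1 = d ∧ t.1 ∈ S := fun t => by
    have := Finset.mem_filter.mp t.2
    exact ⟨mem_degSet.mp this.1, this.2⟩
  have hli : LinearIndependent K (q ∘ b) := by
    rw [Fintype.linearIndependent_iff]
    intro g hg t
    have hcoeff : ∀ u, coeff u (∑ t, g t • b t) =
        if h : (u : Fin m × Fin M → ℕ) ∈ T then g ⟨u, h⟩ else 0 := fun u => by
      simp only [coeff_sum, coeff_smul, b, coeff_monomial, smul_eq_mul, mul_ite, mul_one, mul_zero]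
      split_ifs with h
      · rw [Finset.sum_eq_single ⟨u, h⟩]
        · rw [if_pos]
          exact Finsupp.ext fun _ => rfl
        · intro t _ ht
          rw [if_neg]
          rintro rfl
          exact ht (Subtype.ext rfl)
        · simp
      · refine Finset.sum_eq_zero fun t _ => if_neg ?_
        rintro rfl
        exact h t.2
    have h0 : ∑ t, g t • b t = 0 := by
      refine hindep _ ?_ fun u hu => ?_
      · have : q (∑ t, g t • b t) = 0 := by
          rw [map_sum, ← hg]
          exact Finset.sum_congr rfl fun t _ => map_smul _ _ _
        exact (Submodule.Quotient.mk_eq_zero _).mp this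
      · rw [mem_support_iff, hcoeff] at hu
        by_contra hS
        rw [dif_neg fun h => hS (hT ⟨_, h⟩).2] at hu
        exact hu rfl
    have := hcoeff (Finsupp.equivFunOnFinite.symm t.1)
    rw [h0, dif_pos (show ⇑(Finsupp.equivFunOnFinite.symm t.1) ∈ T from t.2)] at this
    exact this.symm
  have hsp : Submodule.span K (Set.range (q ∘ b)) =
      (weightedHomogeneousSubmodule K (rowWt (m := m) (M := M)) d).map q := by
    refine le_antisymm (Submodule.span_le.mpr ?_) ?_
    · rintro _ ⟨t, rfl⟩
      refine Submodule.mem_map_of_mem ?_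
      rw [mem_weightedHomogeneousSubmodule, isWeightedHomogeneous_rowWt]
      intro u hu
      rw [Finset.mem_singleton.mp (support_monomial_subset hu)]
      exact (hT t).1
    · rintro _ ⟨f, hf, rfl⟩
      rw [SetLike.mem_coe, mem_weightedHomogeneousSubmodule, isWeightedHomogeneous_rowWt] at hf
      rw [f.as_sum, map_sum]
      refine Submodule.sum_mem _ fun u hu => ?_
      have hm : (monomial u (coeff u f) : MvPolynomial (Fin m × Fin M) K) =
          coeff u f • monomial u 1 := by
        rw [smul_monomial, smul_eq_mul, mul_one]
      rw [hm, map_smul]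
      refine Submodule.smul_mem _ _ ?_
      obtain ⟨x, hx, y, hy, hxy⟩ := Submodule.mem_sup.mp (hspan u)
      rw [← hxy, map_add, show q x = 0 by simpa [q] using hx, zero_add]
      have : Submodule.span K ((fun w => monomial w (1 : K)) ''
          {w : Fin m × Fin M →₀ ℕ | rdeg w = rdeg u ∧ (w : Fin m × Fin M → ℕ) ∈ S}) ≤
          (Submodule.span K (Set.range (q ∘ b))).comap q := by
        refine Submodule.span_le.mpr ?_
        rintro _ ⟨w, ⟨hw1, hw2⟩, rfl⟩
        refine Submodule.subset_span ⟨⟨w, Finset.mem_filter.mpr ⟨mem_degSet.mpr ?_, hw2⟩⟩, ?_⟩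
        · rw [hw1, hf u hu]
        · simp only [b, comp_apply, Finsupp.equivFunOnFinite_symm_coe]
      exact this hy
  have := finrank_span_eq_card hli
  rw [hsp] at this
  rw [hfun, this, Fintype.card_coe, cnt]

lemma cnt_add_cnt_compl (S : Set (Fin m × Fin M → ℕ)) (d : Fin m → ℕ) :
    cnt S d + cnt Sᶜ d = (degSet M d).card := by
  classical
  have := Finset.card_filter_add_card_filter_not (s := degSet M d) (· ∈ S)
  rw [← this, cnt, cnt]
  congr

/-- A graded automorphism preserves Hilbert functions. -/
lemma hfun_map (γ : MvPolynomial (Fin m × Fin M) K ≃ₐ[K] MvPolynomial (Fin m × Fin M) K)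
    (h₁ : ∀ f d, f.IsWeightedHomogeneous rowWt d → (γ f).IsWeightedHomogeneous rowWt d)
    (h₂ : ∀ f d, f.IsWeightedHomogeneous rowWt d → (γ.symm f).IsWeightedHomogeneous rowWt d)
    (I : Ideal (MvPolynomial (Fin m × Fin M) K)) (d : Fin m → ℕ) :
    hfun (I.map γ) d = hfun I d := by
  have hI : (I.restrictScalars K).map (γ.toLinearEquiv : _ →ₗ[K] _) =
      (I.map γ).restrictScalars K := by
    ext f
    rw [Submodule.restrictScalars_mem, Ideal.mem_map_iff_of_surjective _ γ.surjective]
    rfl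
  let Q := Submodule.Quotient.equiv _ _ γ.toLinearEquiv hI
  have hmap : (weightedHomogeneousSubmodule K (rowWt (m := m) (M := M)) d).map
      ((I.map γ).restrictScalars K).mkQ =
      ((weightedHomogeneousSubmodule K (rowWt (m := m) (M := M)) d).map
        (I.restrictScalars K).mkQ).map (Q : _ →ₗ[K] _) := by
    ext z
    constructor
    · rintro ⟨f, hf, rfl⟩
      refine ⟨_, ⟨γ.symm f, h₂ f d hf, rfl⟩, ?_⟩
      simp [Q]
    · rintro ⟨_, ⟨f, hf, rfl⟩, rfl⟩
      exact ⟨γ f, h₁ f d hf, rfl⟩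
  rw [hfun, hfun, hmap]
  exact LinearEquiv.finrank_map_eq Q _

end HilbertFunction

section Leads
variable {σ K : Type} [Field K] {Γ : Type*} [AddCommMonoid Γ] [LinearOrder Γ]

/-- The exponent `u` is the largest exponent of `f` with respect to `φ`. -/
def IsLead (φ : (σ →₀ ℕ) →+ Γ) (f : MvPolynomial σ K) (u : σ →₀ ℕ) : Prop :=
  u ∈ f.support ∧ ∀ w ∈ f.support, φ w ≤ φ u

/-- The set of leading exponents of the elements of `I`. -/
def leadSet (φ : (σ →₀ ℕ) →+ Γ) (I : Ideal (MvPolynomial σ K)) : Set (σ → ℕ) :=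
  {v | ∃ f ∈ I, ∃ u : σ →₀ ℕ, u = v ∧ IsLead φ f u}

variable {φ : (σ →₀ ℕ) →+ Γ} {I : Ideal (MvPolynomial σ K)}

lemma isUpperSet_leadSet [IsOrderedCancelAddMonoid Γ] [Finite σ] : IsUpperSet (leadSet φ I) := by
  rintro _ v hv ⟨f, hf, u, rfl, hu, hmax⟩
  obtain ⟨w, rfl⟩ := exists_add_of_le
    (show u ≤ Finsupp.equivFunOnFinite.symm v from hv) |>.imp fun w hw =>
      (show v = (u + w : σ →₀ ℕ) by rw [← hw]; rfl)
  refine ⟨monomial w 1 * f, I.mul_mem_left _ hf, u + w, rfl, ?_, fun z hz => ?_⟩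
  · rw [mem_support_iff, add_comm u w, coeff_monomial_mul, one_mul]
    exact mem_support_iff.mp hu
  · rw [mem_support_iff, coeff_monomial_mul'] at hz
    split_ifs at hz with h
    swap
    · exact absurd rfl hz
    rw [one_mul] at hz
    have := hmax _ (mem_support_iff.mpr hz)
    rw [← tsub_add_cancel_of_le h, map_add, map_add]
    exact add_le_add_left this _

lemma eq_zero_of_notMem_leadSet {f : MvPolynomial σ K} (hf : f ∈ I)
    (h : ∀ u ∈ f.support, (u : σ → ℕ) ∈ (leadSet φ I)ᶜ) : f = 0 := by
  by_contra h0
  obtain ⟨u, hu, hmax⟩ := exists_max_image f.support φ (support_nonempty.mpr h0)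
  exact h u hu ⟨f, hf, u, rfl, hu, hmax⟩

end Leads

section GradedLeads
variable {m M : ℕ} {K : Type} [Field K] {Γ : Type*} [AddCommMonoid Γ] [LinearOrder Γ]
  {φ : (Fin m × Fin M →₀ ℕ) →+ Γ} {I : Ideal (MvPolynomial (Fin m × Fin M) K)}

lemma mem_support_component {f : MvPolynomial (Fin m × Fin M) K} {d : Fin m → ℕ}
    {u : Fin m × Fin M →₀ ℕ} :
    u ∈ (weightedHomogeneousComponent rowWt d f).support ↔
      u ∈ f.support ∧ rdeg (u : Fin m × Fin M → ℕ) = d := by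
  classical
  rw [mem_support_iff, coeff_weightedHomogeneousComponent, mem_support_iff, rdeg_eq_weight]
  change (if Finsupp.weight rowWt u = d then _ else _) ≠ _ ↔ _ ∧ Finsupp.weight rowWt u = d
  split_ifs with h <;> simp [h]

lemma monomial_mem_sup_leadSet (hφ : Injective φ)
    (hI : ∀ f ∈ I, ∀ d, weightedHomogeneousComponent rowWt d f ∈ I) (u : Fin m × Fin M →₀ ℕ) :
    monomial u (1 : K) ∈ I.restrictScalars K ⊔
      Submodule.span K ((fun w => monomial w (1 : K)) ''
        {w : Fin m × Fin M →₀ ℕ | rdeg w = rdeg u ∧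
          (w : Fin m × Fin M → ℕ) ∈ (leadSet φ I)ᶜ}) := by
  classical
  set d := rdeg (u : Fin m × Fin M → ℕ) with hd
  set V := I.restrictScalars K ⊔ Submodule.span K ((fun w => monomial w (1 : K)) ''
    {w : Fin m × Fin M →₀ ℕ | rdeg w = d ∧ (w : Fin m × Fin M → ℕ) ∈ (leadSet φ I)ᶜ}) with hV
  by_contra hu
  obtain ⟨t, ht, hmin⟩ := exists_min_image
    ((degSet M d).filter fun t => monomial (Finsupp.equivFunOnFinite.symm t) (1 : K) ∉ V)
    (fun t => φ (Finsupp.equivFunOnFinite.symm t))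
    ⟨u, Finset.mem_filter.mpr ⟨mem_degSet.mpr hd.symm, by simpa using hu⟩⟩
  rw [Finset.mem_filter, mem_degSet] at ht
  obtain ⟨htd, htV⟩ := ht
  by_cases hL : t ∈ leadSet φ I
  swap
  · exact htV (Submodule.mem_sup_right (Submodule.subset_span ⟨_, ⟨htd, hL⟩, rfl⟩))
  obtain ⟨f, hf, w, rfl, hw, hmax⟩ := hL
  rw [Finsupp.equivFunOnFinite_symm_coe] at htV
  set g := weightedHomogeneousComponent rowWt d f with hg
  have hwg : w ∈ g.support := mem_support_component.mpr ⟨hw, htd⟩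
  have hsum : coeff w g • monomial w (1 : K) =
      g - ∑ z ∈ g.support.erase w, coeff z g • monomial z (1 : K) := by
    have : g = ∑ z ∈ g.support, coeff z g • monomial z (1 : K) := by
      conv_lhs => rw [g.as_sum]
      refine Finset.sum_congr rfl fun z _ => ?_
      rw [smul_monomial, smul_eq_mul, mul_one]
    conv_rhs => enter [1]; rw [this]
    rw [← Finset.add_sum_erase _ _ hwg, add_sub_cancel_right]
  have hmem : coeff w g • monomial w (1 : K) ∈ V := by
    rw [hsum]
    refine Submodule.sub_mem _ (Submodule.mem_sup_left (hI f hf d))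
      (Submodule.sum_mem _ fun z hz => Submodule.smul_mem _ _ ?_)
    obtain ⟨hne, hz⟩ := Finset.mem_erase.mp hz
    rw [hg, mem_support_component] at hz
    by_contra hzV
    have := hmin z (Finset.mem_filter.mpr ⟨mem_degSet.mpr hz.2, by simpa using hzV⟩)
    simp only [Finsupp.equivFunOnFinite_symm_coe] at this
    exact hne (hφ (le_antisymm (hmax z hz.1) this))
  refine htV ?_
  rwa [Submodule.smul_mem_iff _ (mem_support_iff.mp hwg)] at hmem

end GradedLeads

section GradedSubstitution
variable {m M N : ℕ} {K : Type} [Field K]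

lemma minorsIdeal_map {R S : Type} [CommRing R] [CommRing S] (f : R →+* S) (t : ℕ) {a b : ℕ}
    (A : Matrix (Fin a) (Fin b) R) : minorsIdeal t (A.map f) = (minorsIdeal t A).map f := by
  rw [minorsIdeal, minorsIdeal, Ideal.map_span]
  congr 1
  ext d
  constructor
  · rintro ⟨r, c, hr, hc, rfl⟩
    exact ⟨_, ⟨r, c, hr, hc, rfl⟩, by rw [RingHom.map_det]; rfl⟩
  · rintro ⟨_, ⟨r, c, hr, hc, rfl⟩, rfl⟩
    exact ⟨r, c, hr, hc, by rw [RingHom.map_det]; rfl⟩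

lemma isWeightedHomogeneous_minor (hN : N ≤ M) {f : MvPolynomial (Fin m × Fin M) K}
    (hf : f ∈ minorsSet m (genMat K m hN)) : f.IsWeightedHomogeneous rowWt (fun _ => 1) := by
  obtain ⟨r, c, hr, -, rfl⟩ := hf
  rw [Matrix.det_apply]
  refine IsWeightedHomogeneous.sum _ _ _ fun s _ => ?_
  rw [Units.smul_def]
  change _ ∈ weightedHomogeneousSubmodule K (rowWt (m := m) (M := M)) fun _ => 1
  refine zsmul_mem ?_ _
  have h := IsWeightedHomogeneous.prod univ
    (fun i => ((genMat K m hN).submatrix r c) (s i) i) (fun i => rowWt (r (s i), Fin.castLE hN (c i)))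
    (w := rowWt) fun i _ => isWeightedHomogeneous_X K rowWt _
  have hb : Bijective (r ∘ s) := (Finite.injective_iff_bijective.mp hr).comp s.bijective
  have hsum : ∑ i, rowWt (r (s i), Fin.castLE hN (c i)) = fun _ => 1 := by
    simp only [rowWt]
    rw [show (∑ i, (Pi.single (r (s i)) 1 : Fin m → ℕ)) = ∑ i, Pi.single i 1 from
      hb.sum_comp fun i => (Pi.single i 1 : Fin m → ℕ)]
    funext i
    simp [Finset.sum_apply, Pi.single_apply]
  rw [hsum] at h
  exact h

lemma isWeightedHomogeneous_aeval {g : Fin m × Fin M → MvPolynomial (Fin m × Fin M) K}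
    (hg : ∀ x, (g x).IsWeightedHomogeneous rowWt (rowWt x)) {f : MvPolynomial (Fin m × Fin M) K}
    {d : Fin m → ℕ} (hf : f.IsWeightedHomogeneous rowWt d) :
    (aeval g f).IsWeightedHomogeneous rowWt d := by
  rw [f.as_sum, map_sum]
  refine IsWeightedHomogeneous.sum _ _ _ fun u hu => ?_
  rw [aeval_monomial, ← hf (mem_support_iff.mp hu), Finsupp.weight_apply]
  exact (IsWeightedHomogeneous.prod _ _ _ fun x _ => (hg x).pow (u x)).C_mul _

lemma component_mem_map_minorsIdeal (hN : N ≤ M)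
    (γ : MvPolynomial (Fin m × Fin M) K ≃ₐ[K] MvPolynomial (Fin m × Fin M) K)
    (hγ : ∀ f d, f.IsWeightedHomogeneous rowWt d → (γ f).IsWeightedHomogeneous rowWt d)
    {f : MvPolynomial (Fin m × Fin M) K} (hf : f ∈ (minorsIdeal m (genMat K m hN)).map γ)
    (d : Fin m → ℕ) :
    weightedHomogeneousComponent rowWt d f ∈ (minorsIdeal m (genMat K m hN)).map γ := by
  let _ := weightedGradedAlgebra K (rowWt (m := m) (M := M))
  refine weightedHomogeneousComponent_mem_of_mem K rowWt ?_ hf d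
  rw [minorsIdeal, Ideal.map_span]
  refine Ideal.homogeneous_span _ _ ?_
  rintro _ ⟨g, hg, rfl⟩
  exact ⟨_, hγ _ _ (isWeightedHomogeneous_minor hN hg)⟩

/-- Leading exponents of a graded specialization of the generic maximal minors are divisible by
leading exponents of row degree `(1, …, 1)`. -/
theorem exists_le_mem_leadSet [Infinite K] {Γ : Type*} [AddCommMonoid Γ] [LinearOrder Γ]
    [IsOrderedCancelAddMonoid Γ] {φ : (Fin m × Fin M →₀ ℕ) →+ Γ} (hφ : Injective φ) (hN : N ≤ M)
    (γ : MvPolynomial (Fin m × Fin M) K ≃ₐ[K] MvPolynomial (Fin m × Fin M) K)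
    (h₁ : ∀ f d, f.IsWeightedHomogeneous rowWt d → (γ f).IsWeightedHomogeneous rowWt d)
    (h₂ : ∀ f d, f.IsWeightedHomogeneous rowWt d → (γ.symm f).IsWeightedHomogeneous rowWt d)
    {u : Fin m × Fin M → ℕ} (hu : u ∈ leadSet φ ((minorsIdeal m (genMat K m hN)).map γ)) :
    ∃ v ∈ leadSet φ ((minorsIdeal m (genMat K m hN)).map γ), v ≤ u ∧ rdeg v = fun _ => 1 := by
  refine exists_le_of_cnt_eq (N := N) isUpperSet_leadSet (fun d => ?_) hu
  have h1 := cnt_eq_hfun (S := {u | Reach u m N}ᶜ)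
    (fun f hf hS => eq_zero_of_mem_minorsIdeal (K := K) hN hf hS)
    (fun u => monomial_mem_minorsIdeal_sup hN u) d
  have h2 := cnt_eq_hfun (fun f hf hS => eq_zero_of_notMem_leadSet (φ := φ) hf hS)
    (fun u => monomial_mem_sup_leadSet hφ
      (fun f hf d => component_mem_map_minorsIdeal hN γ h₁ hf d) u) d
  rw [hfun_map γ h₁ h₂, ← h1] at h2
  have h3 := cnt_add_cnt_compl (leadSet φ ((minorsIdeal m (genMat K m hN)).map γ)) d
  have h4 := cnt_add_cnt_compl {u : Fin m × Fin M → ℕ | Reach u m N} d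
  rw [cnt_reach hN] at h4
  omega

end GradedSubstitution

section Translation
variable {σ τ K : Type} [Field K] {ι : σ → τ}

/-- The automorphism translating the variables outside the range of `ι` by polynomials in the
variables in the range of `ι`. -/
def translation (s : τ → MvPolynomial σ K) (hs : ∀ y, s (ι y) = 0) :
    MvPolynomial τ K ≃ₐ[K] MvPolynomial τ K :=
  have key : ∀ (g : τ → MvPolynomial τ K), (∀ y, g (ι y) = X (ι y)) → ∀ p,
      aeval g (rename ι p) = rename ι p := fun g hg p => by
    rw [aeval_rename, show g ∘ ι = X ∘ ι from funext hg]
    exact AlgHom.congr_fun (show aeval (X ∘ ι) = rename ι by ext1 y; simp) p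
  AlgEquiv.ofAlgHom (aeval fun x => X x + rename ι (s x)) (aeval fun x => X x - rename ι (s x))
    (by
      ext1 x
      rw [AlgHom.comp_apply, aeval_X, map_sub, aeval_X,
        key (fun x => X x + rename ι (s x)) fun y => by simp [hs]]
      simp)
    (by
      ext1 x
      rw [AlgHom.comp_apply, aeval_X, map_add, aeval_X,
        key (fun x => X x - rename ι (s x)) fun y => by simp [hs]]
      simp)

lemma translation_apply (s : τ → MvPolynomial σ K) (hs : ∀ y, s (ι y) = 0) (f : MvPolynomial τ K) :
    translation s hs f = aeval (fun x => X x + rename ι (s x)) f := rfl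

end Translation

section EliminationOrder
variable {σ τ : Type} {ι : σ → τ}

open Classical in
/-- The degree in the variables outside the range of `ι`. -/
def outDeg (ι : σ → τ) : (τ →₀ ℕ) →+ ℕ :=
  Finsupp.weight fun x => if x ∈ Set.range ι then 0 else 1

lemma outDeg_eq_zero_iff {u : τ →₀ ℕ} : outDeg ι u = 0 ↔ ↑u.support ⊆ Set.range ι := by
  classical
  rw [outDeg, Finsupp.weight_apply, Finsupp.sum, Finset.sum_eq_zero_iff]
  refine forall₂_congr fun x hx => ?_
  have := Finsupp.mem_support_iff.mp hx
  by_cases h : x ∈ Set.range ι <;> simp_all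

lemma outDeg_mapDomain (v : σ →₀ ℕ) : outDeg ι (v.mapDomain ι) = 0 := by
  classical
  rw [outDeg_eq_zero_iff]
  intro x hx
  have := Finsupp.mapDomain_support hx
  obtain ⟨y, -, rfl⟩ := Finset.mem_image.mp this
  exact ⟨y, rfl⟩

lemma nonempty_monomialOrder (τ : Type) [Finite τ] : Nonempty (MonomialOrder.{0, 0} τ) := by
  obtain ⟨k, ⟨e⟩⟩ := Finite.exists_equiv_fin τ
  let _ := LinearOrder.lift' e e.injective
  exact ⟨MonomialOrder.lex⟩

/-- The order in which a larger degree in the variables outside the range of `ι` makes a monomial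
smaller; then the part in the range of `ι` is compared by `o`, and ties are broken by `p`. -/
def elimOrder (hι : Injective ι) (o : MonomialOrder σ) (p : MonomialOrder τ) :
    (τ →₀ ℕ) →+ ℕᵒᵈ ×ₗ (o.syn ×ₗ p.syn) where
  toFun u := toLex (OrderDual.toDual (outDeg ι u),
    toLex (o.toSyn (u.comapDomain ι hι.injOn), p.toSyn u))
  map_zero' := by simp
  map_add' u w := by simp [Finsupp.comapDomain_add_of_injective hι]; rfl

lemma elimOrder_injective (hι : Injective ι) (o : MonomialOrder σ) (p : MonomialOrder τ) :
    Injective (elimOrder hι o p) := fun _ _ h =>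
  p.toSyn.injective (congrArg (fun z => (ofLex (ofLex z).2).2) h)

lemma elimOrder_mapDomain_le_iff (hι : Injective ι) (o : MonomialOrder σ) (p : MonomialOrder τ)
    {v w : σ →₀ ℕ} : elimOrder hι o p (w.mapDomain ι) ≤ elimOrder hι o p (v.mapDomain ι) ↔
      o.toSyn w ≤ o.toSyn v := by
  simp only [elimOrder, AddMonoidHom.coe_mk, ZeroHom.coe_mk, Prod.Lex.toLex_le_toLex,
    outDeg_mapDomain, lt_irrefl, false_or, true_and, Finsupp.comapDomain_mapDomain _ hι]
  constructor
  · rintro (h | h)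
    exacts [h.le, h.1.le]
  · intro h
    rcases h.lt_or_eq with h | h
    · exact Or.inl h
    · exact Or.inr ⟨h, by rw [o.toSyn.injective h]⟩

lemma elimOrder_lt_mapDomain (hι : Injective ι) (o : MonomialOrder σ) (p : MonomialOrder τ)
    {w : τ →₀ ℕ} (hw : ¬ ↑w.support ⊆ Set.range ι) (v : σ →₀ ℕ) :
    elimOrder hι o p w < elimOrder hι o p (v.mapDomain ι) := by
  simp only [elimOrder, AddMonoidHom.coe_mk, ZeroHom.coe_mk, Prod.Lex.toLex_lt_toLex,
    outDeg_mapDomain]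
  exact Or.inl (Nat.pos_of_ne_zero fun h => hw (outDeg_eq_zero_iff.mp h))

end EliminationOrder

section Section
variable {σ τ K : Type} [Field K] {ι : σ → τ} {hι : Injective ι} {o : MonomialOrder σ}
  {p : MonomialOrder τ}

lemma isLead_elimOrder_mapDomain {f : MvPolynomial τ K} {v : σ →₀ ℕ}
    (hv : v ∈ (killCompl hι f).support)
    (hmax : ∀ w ∈ (killCompl hι f).support, o.toSyn w ≤ o.toSyn v) :
    IsLead (elimOrder hι o p) f (v.mapDomain ι) := by
  refine ⟨?_, fun w hw => ?_⟩
  · rw [mem_support_iff, coeff_killCompl] at hv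
    exact mem_support_iff.mpr hv
  · by_cases h : ↑w.support ⊆ Set.range ι
    · rw [← Finsupp.mapDomain_comapDomain ι hι w h] at hw ⊢
      refine (elimOrder_mapDomain_le_iff hι o p).mpr (hmax _ ?_)
      rwa [mem_support_iff, coeff_killCompl, ← mem_support_iff]
    · exact (elimOrder_lt_mapDomain hι o p h v).le

lemma leadExp_eq {v : ℕ} {n : Fin v → ℕ} (o : MonomialOrder (MVar v n))
    {f : MvPolynomial (MVar v n) K} {u : MVar v n →₀ ℕ} (hu : u ∈ f.support)
    (hmax : ∀ w ∈ f.support, o.toSyn w ≤ o.toSyn u) : leadExp o f = u := by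
  rw [leadExp, AddEquiv.symm_apply_eq]
  exact le_antisymm (Finset.sup_le hmax) (Finset.le_sup hu)

lemma exists_leadExp {v : ℕ} {n : Fin v → ℕ} (o : MonomialOrder (MVar v n))
    {f : MvPolynomial (MVar v n) K} (hf : f ≠ 0) :
    leadExp o f ∈ f.support ∧ ∀ w ∈ f.support, o.toSyn w ≤ o.toSyn (leadExp o f) := by
  obtain ⟨u, hu, hmax⟩ := exists_max_image f.support o.toSyn (support_nonempty.mpr hf)
  rw [leadExp_eq o hu hmax]
  exact ⟨hu, hmax⟩

end Section

section RowGraded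
variable {m N : ℕ} {n : Fin m → ℕ} {K : Type} [Field K]

lemma rdeg_mapDomain {M : ℕ} {ι : MVar m n → Fin m × Fin M} (hrow : ∀ x, (ι x).1 = x.1)
    (v : MVar m n →₀ ℕ) :
    rdeg (v.mapDomain ι : Fin m × Fin M → ℕ) = Finsupp.weight (wt m n) v := by
  rw [rdeg_eq_weight]
  induction v using Finsupp.induction_linear with
  | zero => simp
  | add u w hu hw => rw [Finsupp.mapDomain_add, map_add, map_add, hu, hw]
  | single x s => rw [Finsupp.mapDomain_single, Finsupp.weight_single, Finsupp.weight_single, wt, hrow]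

lemma isWeightedHomogeneous_rename {M : ℕ} {ι : MVar m n → Fin m × Fin M}
    (hrow : ∀ x, (ι x).1 = x.1) {f : MvPolynomial (MVar m n) K} {d : Fin m → ℕ}
    (hf : f.IsWeightedHomogeneous (wt m n) d) :
    (rename ι f).IsWeightedHomogeneous rowWt d := by
  rw [isWeightedHomogeneous_rowWt]
  intro u hu
  obtain ⟨v, rfl, hv⟩ := coeff_rename_ne_zero ι f u (mem_support_iff.mp hu)
  rw [rdeg_mapDomain hrow, hf hv]

/-- Leading exponents of maximal minors ideals of row-graded matrices are divisible by leading
exponents of elements of multidegree `(1, …, 1)`. -/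
theorem exists_leadExp_le [Infinite K] {A : Matrix (Fin m) (Fin N) (MvPolynomial (MVar m n) K)}
    (hA : RowGraded A) (o : MonomialOrder (MVar m n)) {f : MvPolynomial (MVar m n) K}
    (hf : f ∈ minorsIdeal m A) (hf0 : f ≠ 0) :
    ∃ g ∈ minorsIdeal m A, g ≠ 0 ∧ g.IsWeightedHomogeneous (wt m n) (fun _ => 1) ∧
      leadExp o g ≤ leadExp o f := by
  let M := N + ∑ i, (n i + 1)
  have hN : N ≤ M := Nat.le_add_right _ _
  let ι : MVar m n → Fin m × Fin M := fun x => (x.1, ⟨N + x.2, Nat.add_lt_add_left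
    (x.2.2.trans_le (Finset.single_le_sum (f := fun i => n i + 1) (fun _ _ => Nat.zero_le _)
      (mem_univ x.1))) N⟩)
  have hrow : ∀ x, (ι x).1 = x.1 := fun _ => rfl
  have hι : Injective ι := by
    rintro ⟨i, k⟩ ⟨i', k'⟩ h
    obtain rfl : i = i' := congrArg Prod.fst h
    have : N + (k : ℕ) = N + k' := congrArg (fun z => (z.2 : ℕ)) h
    rw [Fin.ext (Nat.add_left_cancel this)]
  let s : Fin m × Fin M → MvPolynomial (MVar m n) K := fun x =>
    if h : (x.2 : ℕ) < N then A x.1 ⟨x.2, h⟩ else 0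
  have hs : ∀ y, s (ι y) = 0 := fun y => dif_neg (Nat.not_lt.mpr (Nat.le_add_right _ _))
  have hsdeg : ∀ x, (rename ι (s x)).IsWeightedHomogeneous rowWt (rowWt x) := fun x => by
    refine isWeightedHomogeneous_rename hrow ?_
    simp only [s]
    split_ifs with h
    · obtain ⟨_, hA⟩ := hA
      rcases hA x.1 ⟨x.2, h⟩ with h0 | h0
      · rw [h0]
        exact isWeightedHomogeneous_zero K _ _
      · exact h0
    · exact isWeightedHomogeneous_zero K _ _
  let γ := translation s hs
  have h₁ : ∀ f d, f.IsWeightedHomogeneous rowWt d → (γ f).IsWeightedHomogeneous rowWt d :=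
    fun f d hf => isWeightedHomogeneous_aeval
      (fun x => (isWeightedHomogeneous_X K rowWt x).add (hsdeg x)) hf
  have h₂ : ∀ f d, f.IsWeightedHomogeneous rowWt d → (γ.symm f).IsWeightedHomogeneous rowWt d :=
    fun f d hf => isWeightedHomogeneous_aeval
      (fun x => (isWeightedHomogeneous_X K rowWt x).sub (hsdeg x)) hf
  set J := (minorsIdeal m (genMat K m hN)).map γ with hJ
  have hAJ : minorsIdeal m A = J.map (killCompl hι) := by
    have : A = ((genMat K m hN).map (γ : _ →+* _)).map
        (killCompl hι : _ →ₐ[K] MvPolynomial (MVar m n) K).toRingHom := by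
      ext1 i j
      have hnot : (i, Fin.castLE hN j) ∉ Set.range ι := by
        rintro ⟨x, hx⟩
        have : N + (x.2 : ℕ) = j := congrArg (fun z => (z.2 : ℕ)) hx
        omega
      have hX : killCompl hι (X (i, Fin.castLE hN j) : MvPolynomial _ K) = 0 := by
        simp only [killCompl, aeval_X, dif_neg hnot]
      have hγ : γ (X (i, Fin.castLE hN j)) =
          X (i, Fin.castLE hN j) + rename ι (A i j) := by
        rw [translation_apply, aeval_X]
        simp [s]
      change A i j = killCompl hι (γ (X (i, Fin.castLE hN j)))
      rw [hγ, map_add, hX, zero_add, killCompl_rename_app]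
    conv_lhs => rw [this]
    rw [minorsIdeal_map, minorsIdeal_map]
    rfl
  have hsurj : Surjective (killCompl hι : MvPolynomial (Fin m × Fin M) K →ₐ[K] _) := fun q =>
    ⟨_, killCompl_rename_app hι q⟩
  obtain ⟨p⟩ := nonempty_monomialOrder (Fin m × Fin M)
  obtain ⟨hu, hmax⟩ := exists_leadExp o hf0
  set u := leadExp o f
  rw [hAJ, Ideal.mem_map_iff_of_surjective _ hsurj] at hf
  obtain ⟨F, hF, rfl⟩ := hf
  have hlead : ((u.mapDomain ι : Fin m × Fin M →₀ ℕ) : Fin m × Fin M → ℕ) ∈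
      leadSet (elimOrder hι o p) J := ⟨F, hF, _, rfl, isLead_elimOrder_mapDomain hu hmax⟩
  obtain ⟨_, ⟨H, hH, z, rfl, hz, hzmax⟩, hzu, hzdeg⟩ :=
    exists_le_mem_leadSet (elimOrder_injective hι o p) hN γ h₁ h₂ hlead
  replace hzu : z ≤ u.mapDomain ι := hzu
  have hzι : ↑z.support ⊆ Set.range ι := by
    rw [← outDeg_eq_zero_iff]
    obtain ⟨w, hw⟩ := exists_add_of_le hzu
    have := outDeg_mapDomain (ι := ι) u
    rw [hw, map_add] at this
    omega
  obtain ⟨v, rfl⟩ : ∃ v, z = Finsupp.mapDomain ι v :=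
    ⟨_, (Finsupp.mapDomain_comapDomain ι hι z hzι).symm⟩
  set g := weightedHomogeneousComponent rowWt (fun _ => 1) H with hg
  have hsupp : ∀ w, w ∈ (killCompl hι g).support ↔ w.mapDomain ι ∈ H.support ∧
      rdeg (w.mapDomain ι : Fin m × Fin M → ℕ) = fun _ => 1 := fun w => by
    rw [← mem_support_component, ← hg, mem_support_iff, mem_support_iff, coeff_killCompl]
  have hv : v ∈ (killCompl hι g).support := (hsupp v).mpr ⟨hz, hzdeg⟩
  refine ⟨killCompl hι g, ?_, support_nonempty.mp ⟨v, hv⟩, fun w hw => ?_, ?_⟩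
  · rw [hAJ]
    exact Ideal.mem_map_of_mem _ (component_mem_map_minorsIdeal hN γ h₁ hH _)
  · rw [← rdeg_mapDomain hrow]
    exact ((hsupp w).mp (mem_support_iff.mpr hw)).2
  · rw [leadExp_eq o hv fun w hw =>
      (elimOrder_mapDomain_le_iff hι o p).mp (hzmax _ ((hsupp w).mp hw).1)]
    intro x
    have := hzu (ι x)
    rwa [Finsupp.mapDomain_apply hι, Finsupp.mapDomain_apply hι] at this

end RowGraded

end MonoComb

/-- **Main Theorem (2), row-graded case.** If `A` is a row-graded `m × n` matrix of linear
forms with `m ≤ n` (here `v = m`), then `I_m(A)` has a universal Gröbner basis consisting of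
multihomogeneous elements of multidegree `e_1 + ⋯ + e_m = (1,…,1) ∈ ℤ^m`. -/
theorem row_graded_maximal_minors_universal_groebner_basis
    {K : Type} [Field K] [Infinite K] {m N : ℕ} {n : Fin m → ℕ} (hmn : m ≤ N)
    (A : Matrix (Fin m) (Fin N) (MvPolynomial (MVar m n) K))
    (hA : RowGraded A) :
    ∃ G : Set (MvPolynomial (MVar m n) K),
      (∀ f ∈ G, f.IsWeightedHomogeneous (wt m n) (fun _ => 1)) ∧
      ∀ τ : MonomialOrder (MVar m n), IsGroebnerBasis τ G (minorsIdeal m A) := by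
  refine ⟨{f | f ∈ minorsIdeal m A ∧ f.IsWeightedHomogeneous (wt m n) fun _ => 1},
    fun f hf => hf.2, fun τ => ⟨fun f hf => hf.1, le_antisymm ?_ ?_⟩⟩
  · refine Ideal.span_mono ?_
    rintro _ ⟨f, ⟨hf, hf0⟩, rfl⟩
    exact ⟨f, hf.1, hf0, rfl⟩
  · refine Ideal.span_le.mpr ?_
    rintro _ ⟨f, hf, hf0, rfl⟩
    obtain ⟨g, hg, hg0, hdeg, hle⟩ := MonoComb.exists_leadExp_le hA τ hf hf0
    obtain ⟨w, hw⟩ := exists_add_of_le hle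
    rw [hw, show monomial (leadExp τ g + w) (1 : K) = monomial w 1 * monomial (leadExp τ g) 1 by
      rw [monomial_mul, one_mul, add_comm]]
    exact Ideal.mul_mem_left _ _ (Ideal.subset_span ⟨g, ⟨⟨hg, hdeg⟩, hg0⟩, rfl⟩)

end
end
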